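/- arXiv:1601.00717 — 5 statements merged into one kernel-verified Lean document; each statement's English description precedes it below -/
import Mathlib

section
/- Moment bound for the first passage time to the sublevel set of the Lyapunov function: there exists γ₀ > 0 such that for every γ ∈ (0, γ₀) there exist h > 0, M > 0 and a constant C = C(γ) with the following property. Set α = 1/2 − γ/8, let A = {x ∈ Δ : V_α(x) ≤ M}, let (x_n)_{n≥0} be the time-h sampling chain x_n = x_{nh} of the energy-exchange process, and let τ_A = inf{n > 0 : x_n ∈ A}. Then for every x ∈ Δ, E_x[ τ_A^{2 − γ/2} ] ≤ C · V_α(x). -/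
open MeasureTheory Set Filter

noncomputable section

/-- The open set `U ⊂ ℝ^m` with which the open simplex `Δ` is identified
(via `y = Ē - ∑ i, x i`). -/
def simU (m : ℕ) (E : ℝ) : Set (Fin m → ℝ) := {x | (∀ i, 0 < x i) ∧ ∑ i, x i < E}

/-- The state space `Δ`. -/
abbrev Delta (m : ℕ) (E : ℝ) : Type := ↥(simU m E)

/-- The tank energy `y = Ē - ∑ i, x i`. -/
def tank (m : ℕ) (E : ℝ) (x : Delta m E) : ℝ := E - ∑ i, x.1 i

/-- The energy exchange map on the ambient space: particle `i` gets energy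
`y + (1-u²) x^i`, and the new tank energy is `u² x^i`. -/
def T0 (m : ℕ) (E : ℝ) (i : Fin m) (u : ℝ) (x : Fin m → ℝ) : Fin m → ℝ :=
  Function.update x i ((E - ∑ j, x j) + (1 - u ^ 2) * x i)

lemma T0_mem {m : ℕ} {E : ℝ} {i : Fin m} {u : ℝ} {x : Fin m → ℝ}
    (hx : x ∈ simU m E) (hu : u ∈ Ioo (0:ℝ) 1) : T0 m E i u x ∈ simU m E := by
  obtain ⟨hpos, hsum⟩ := hx
  obtain ⟨hu0, hu1⟩ := hu
  have hy : 0 < E - ∑ j, x j := sub_pos.mpr hsum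
  have hu2 : 0 < 1 - u ^ 2 := by nlinarith
  have hxi := hpos i
  constructor
  · intro j
    rcases eq_or_ne j i with rfl | hj
    · simp only [T0, Function.update_self]
      nlinarith
    · simpa [T0, Function.update_of_ne hj] using hpos j
  · have h1 : ∑ j, T0 m E i u x j
        = ((E - ∑ j, x j) + (1 - u ^ 2) * x i) + ∑ j ∈ Finset.univ \ {i}, x j := by
      simp only [T0]
      rw [Finset.sum_update_of_mem (Finset.mem_univ i)]
    have h2 : ∑ j ∈ Finset.univ \ {i}, x j = (∑ j, x j) - x i := by
      rw [← Finset.erase_eq]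
      exact Finset.sum_erase_eq_sub (Finset.mem_univ i)
    rw [h1, h2]
    nlinarith [mul_pos (mul_pos hu0 hu0) hxi]

/-- The energy exchange map `T_{i,u} : Δ → Δ` (defined to be the identity for
`u ∉ (0,1)`, which is a probability-zero event). -/
def Texch (m : ℕ) (E : ℝ) (i : Fin m) (u : ℝ) (x : Delta m E) : Delta m E :=
  if hu : u ∈ Ioo (0:ℝ) 1 then ⟨T0 m E i u x.1, T0_mem x.2 hu⟩ else x

/-- The uniform distribution on `(0,1)`. -/
def unif01 : Measure ℝ := volume.restrict (Ioo (0:ℝ) 1)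

/-- The uniformization constant `Λ = √(m Ē)`, an upper bound for the total jump rate. -/
def Lam (m : ℕ) (E : ℝ) : ℝ := Real.sqrt (m * E)

/-- The total jump rate `∑ i, √(x^i)`. -/
def jumpRate (m : ℕ) (E : ℝ) (x : Delta m E) : ℝ := ∑ i, Real.sqrt (x.1 i)

/-- One step of the uniformized embedded chain: with probability `1 - r(x)/Λ` stay put,
and with probability `√(x^i)/Λ` particle `i` exchanges energy with the tank, with
`u` drawn uniformly from `(0,1)`. -/
def ustep (m : ℕ) (E : ℝ) (x : Delta m E) : Measure (Delta m E) :=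
  ENNReal.ofReal (1 - jumpRate m E x / Lam m E) • Measure.dirac x
  + (ENNReal.ofReal (Lam m E))⁻¹ •
      Measure.sum (fun i : Fin m =>
        ENNReal.ofReal (Real.sqrt (x.1 i)) • Measure.map (fun u => Texch m E i u x) unif01)

/-- `n`-fold iterate of the uniformized chain. -/
def ustepIter (m : ℕ) (E : ℝ) : ℕ → Delta m E → Measure (Delta m E)
  | 0 => fun x => Measure.dirac x
  | (n+1) => fun x => (ustep m E x).bind (ustepIter m E n)

/-- The transition probabilities `P^t(x, ·)` of the energy-exchange jump process,
constructed by uniformization: `P^t = ∑ₙ e^{-Λt} (Λt)ⁿ/n! Kⁿ`. -/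
def Pt (m : ℕ) (E : ℝ) (t : ℝ) (x : Delta m E) : Measure (Delta m E) :=
  Measure.sum (fun n : ℕ =>
    ENNReal.ofReal (Real.exp (-(Lam m E) * t) * ((Lam m E) * t) ^ n / n.factorial) •
      ustepIter m E n x)

/-- Lebesgue measure on `Δ ≅ U`. -/
def lebU (m : ℕ) (E : ℝ) : Measure (Delta m E) := Measure.comap Subtype.val volume

/-- The (unnormalized) measure with density `y^{-1/2}` w.r.t. Lebesgue measure on `U`. -/
def piPre (m : ℕ) (E : ℝ) : Measure (Delta m E) :=
  (lebU m E).withDensity (fun x => ENNReal.ofReal ((tank m E x) ^ (-(1/2) : ℝ)))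

/-- The invariant probability measure `π`, with density `Z⁻¹ y^{-1/2}`. -/
def piMeasure (m : ℕ) (E : ℝ) : Measure (Delta m E) :=
  (piPre m E Set.univ)⁻¹ • piPre m E

/-- Total variation distance between two (finite) measures:
`sup_A |μ(A) - ν(A)|`. -/
def tvDist {X : Type*} [MeasurableSpace X] (μ ν : Measure X) : ℝ :=
  ⨆ A : {A : Set X // MeasurableSet A}, |(μ A.1).toReal - (ν A.1).toReal|

end

/-- The Lyapunov function `V_α(x) = ∑ i, (x^i)^{-2α} + y^{-α}`. -/
noncomputable def Vfun (m : ℕ) (E : ℝ) (α : ℝ) (x : Delta m E) : ℝ :=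
  ∑ i, (x.1 i) ^ (-(2 * α)) + (tank m E x) ^ (-α)

/-- `Xp` is a (time-homogeneous) Markov chain on `S` under `ℙ` with one-step transition
kernel `K`. -/
def IsMarkovChainWith {Ω : Type} [MeasurableSpace Ω] (ℙ : Measure Ω)
    {S : Type*} [MeasurableSpace S] (K : S → Measure S) (Xp : ℕ → Ω → S) : Prop :=
  (∀ n, Measurable (Xp n)) ∧
  ∀ n : ℕ,
    Measure.map (fun ω => ((fun i : Fin (n+1) => Xp i.1 ω), Xp (n+1) ω)) ℙ
      = (Measure.map (fun ω => (fun i : Fin (n+1) => Xp i.1 ω)) ℙ).bind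
          (fun v => (K (v (Fin.last n))).map (fun z => (v, z)))

/-- The first passage time `τ_A = inf {n > 0 : X_n ∈ A}` (with value `∞` if the set is
never reached), as an extended nonnegative real. -/
noncomputable def hitTime {Ω : Type} {S : Type*} (Xp : ℕ → Ω → S) (A : Set S) (ω : Ω) :
    ENNReal :=
  sInf {t : ENNReal | ∃ n : ℕ, t = n ∧ 0 < n ∧ Xp n ω ∈ A}

lemma aux_convex {p s a r : ℝ} (hp : 1 ≤ p) (hs : 0 < s) (ha : 0 ≤ a) (hr : 0 ≤ r) :
    (r + a) ^ p ≤ (s + a) ^ (p - 1) * (s ^ (1 - p) * r ^ p + a) := by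
  have hsa : 0 < s + a := by linarith
  have hx1 : r / s ∈ Ici (0:ℝ) := by simp only [mem_Ici]; positivity
  have hx2 : (1:ℝ) ∈ Ici (0:ℝ) := by simp
  have hx3 : 0 ≤ s / (s + a) := by positivity
  have hx4 : 0 ≤ a / (s + a) := by positivity
  have h := (convexOn_rpow hp).2 hx1 hx2 hx3 hx4 (by field_simp)
  simp only [smul_eq_mul] at h
  have e1 : s / (s + a) * (r / s) + a / (s + a) * 1 = (r + a) / (s + a) := by field_simp
  rw [e1, Real.div_rpow (by positivity) hsa.le, Real.one_rpow, Real.div_rpow hr hs.le,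
    div_le_iff₀ (by positivity)] at h
  refine h.trans (le_of_eq ?_)
  rw [Real.rpow_sub hsa, Real.rpow_sub hs, Real.rpow_one, Real.rpow_one]
  have := Real.rpow_pos_of_pos hs p
  field_simp

lemma aux_bern {p t e : ℝ} (hp : 1 ≤ p) (ht : 0 < t) (het : e ≤ t) :
    t ^ p - p * e * t ^ (p - 1) ≤ (t - e) ^ p := by
  have h := one_add_mul_self_le_rpow_one_add (s := -(e / t)) (p := p)
    (by rw [neg_le_neg_iff, div_le_one ht]; exact het) hp
  have e1 : t - e = t * (1 + -(e / t)) := by field_simp; ring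
  have h0 : 0 ≤ 1 + -(e / t) := by
    have := (div_le_one ht).2 het
    linarith
  rw [e1, Real.mul_rpow ht.le h0, Real.rpow_sub ht, Real.rpow_one]
  have := mul_le_mul_of_nonneg_left h (Real.rpow_nonneg ht.le p)
  refine le_trans (le_of_eq ?_) this
  field_simp
  ring

/-- one-step estimate for the space-time function -/
lemma aux_step {S : Type*} [MeasurableSpace S] (k : Measure S) (hk : k univ ≤ 1)
    (V : S → ℝ) (hVm : Measurable V) (hV : ∀ s, 0 < V s) {p a s Q : ℝ} (hp : 1 ≤ p)
    (hs : 0 < s) (ha : 0 ≤ a) (hQ : 0 ≤ Q) (hint : ∫⁻ z, ENNReal.ofReal (V z) ∂k ≤ ENNReal.ofReal Q) :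
    ∫⁻ z, ENNReal.ofReal ((V z ^ (1 / p) + a) ^ p) ∂k
      ≤ ENNReal.ofReal ((s + a) ^ (p - 1) * (s ^ (1 - p) * Q + a)) := by
  have hp0 : p ≠ 0 := by linarith
  have hA : 0 ≤ (s + a) ^ (p - 1) := by positivity
  have hB : 0 ≤ s ^ (1 - p) := by positivity
  calc ∫⁻ z, ENNReal.ofReal ((V z ^ (1 / p) + a) ^ p) ∂k
      ≤ ∫⁻ z, (ENNReal.ofReal ((s + a) ^ (p - 1) * s ^ (1 - p)) * ENNReal.ofReal (V z)
          + ENNReal.ofReal ((s + a) ^ (p - 1) * a)) ∂k := by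
        refine lintegral_mono fun z => ?_
        have h := aux_convex hp hs ha (Real.rpow_nonneg (hV z).le (1 / p))
        rw [← Real.rpow_mul (hV z).le, one_div_mul_cancel hp0, Real.rpow_one] at h
        have hv := (hV z).le
        rw [← ENNReal.ofReal_mul (by positivity), ← ENNReal.ofReal_add (by positivity) (by positivity)]
        refine ENNReal.ofReal_le_ofReal (h.trans (le_of_eq (by ring)))
    _ = ENNReal.ofReal ((s + a) ^ (p - 1) * s ^ (1 - p)) * ∫⁻ z, ENNReal.ofReal (V z) ∂k
          + ENNReal.ofReal ((s + a) ^ (p - 1) * a) * k univ := by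
        rw [lintegral_add_right _ measurable_const, lintegral_const_mul _ hVm.ennreal_ofReal,
          lintegral_const]
    _ ≤ ENNReal.ofReal ((s + a) ^ (p - 1) * s ^ (1 - p)) * ENNReal.ofReal Q
          + ENNReal.ofReal ((s + a) ^ (p - 1) * a) * 1 := by gcongr
    _ = _ := by
        rw [mul_one, ← ENNReal.ofReal_mul (by positivity), ← ENNReal.ofReal_add (by positivity) (by positivity)]
        congr 1; ring

lemma aux_step_drift {S : Type*} [MeasurableSpace S] (k : Measure S) (hk : k univ ≤ 1)
    (V : S → ℝ) (hVm : Measurable V) (hV : ∀ s, 0 < V s) {p a c w : ℝ} (hp : 1 ≤ p)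
    (hc : 0 < c) (hw : 0 < w) (ha : c / p ≤ a) (hQ : 0 ≤ w - c * w ^ (1 - 1 / p))
    (hint : ∫⁻ z, ENNReal.ofReal (V z) ∂k ≤ ENNReal.ofReal (w - c * w ^ (1 - 1 / p))) :
    ∫⁻ z, ENNReal.ofReal ((V z ^ (1 / p) + a) ^ p) ∂k
      ≤ ENNReal.ofReal ((w ^ (1 / p) + (a - c / p)) ^ p) := by
  have hp0 : 0 < p := by linarith
  have hcp : 0 < c / p := by positivity
  have hs : 0 < w ^ (1 / p) := by positivity
  refine (aux_step k hk V hVm hV hp hs (by linarith) hQ hint).trans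
    (ENNReal.ofReal_le_ofReal ?_)
  have hb := aux_bern (p := p) (t := w ^ (1 / p) + a) (e := c / p) hp (by linarith) (by linarith)
  have e1 : w ^ (1 / p) + a - c / p = w ^ (1 / p) + (a - c / p) := by ring
  rw [e1] at hb
  refine le_trans (le_of_eq ?_) hb
  have e2 : (w ^ (1 / p)) ^ (1 - p) * (w - c * w ^ (1 - 1 / p)) = w ^ (1 / p) - c := by
    rw [← Real.rpow_mul hw.le, mul_sub]
    have : w ^ (1 / p * (1 - p)) * w = w ^ (1 / p) := by
      nth_rewrite 2 [← Real.rpow_one w]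
      rw [← Real.rpow_add hw]; congr 1; field_simp; ring
    rw [this, mul_left_comm, ← Real.rpow_add hw]
    have : 1 / p * (1 - p) + (1 - 1 / p) = 0 := by field_simp; ring
    rw [this]; simp
  rw [e2]
  have e3 : (w ^ (1 / p) + a) ^ p = (w ^ (1 / p) + a) ^ (p - 1) * (w ^ (1 / p) + a) := by
    rw [← Real.rpow_add_one (by linarith)]; congr 1; ring
  rw [e3]
  field_simp
  ring

lemma hitTime_eq {Ω : Type} {S : Type*} (Xp : ℕ → Ω → S) (A : Set S) (ω : Ω) :
    hitTime Xp A ω = ⨅ n : ℕ, ⨅ _ : 0 < n ∧ Xp n ω ∈ A, (n : ENNReal) := by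
  unfold hitTime
  apply le_antisymm
  · refine le_iInf₂ fun n hn => sInf_le ⟨n, rfl, hn⟩
  · refine le_sInf ?_
    rintro t ⟨n, rfl, hn⟩
    exact iInf₂_le n hn

lemma hitTime_meas {Ω : Type} [MeasurableSpace Ω] {S : Type*} [MeasurableSpace S] (Xp : ℕ → Ω → S)
    (hX : ∀ n, Measurable (Xp n)) (A : Set S) (hA : MeasurableSet A) :
    Measurable (hitTime Xp A) := by
  classical
  have : hitTime Xp A = fun ω => ⨅ n : ℕ, if 0 < n ∧ Xp n ω ∈ A then (n : ENNReal) else ⊤ := by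
    funext ω
    rw [hitTime_eq]
    refine iInf_congr fun n => ?_
    rw [iInf_eq_if]
  rw [this]
  refine Measurable.iInf fun n => ?_
  refine Measurable.ite ?_ measurable_const measurable_const
  by_cases hn : 0 < n
  · simp only [hn, true_and]; exact hX n hA
  · simp [hn]

lemma markov_int {Ω : Type} [MeasurableSpace Ω] (ℙ : Measure Ω) 
    {S : Type*} [MeasurableSpace S] (K : S → Measure S) (hKm : Measurable K)
    (hK : ∀ s, K s univ ≤ 1) (Xp : ℕ → Ω → S) (hX : IsMarkovChainWith ℙ K Xp) (n : ℕ)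
    (G : (Fin (n+1) → S) × S → ENNReal) (hG : Measurable G) :
    ∫⁻ ω, G ((fun i : Fin (n+1) => Xp i.1 ω), Xp (n+1) ω) ∂ℙ
      = ∫⁻ ω, ∫⁻ z, G ((fun i : Fin (n+1) => Xp i.1 ω), z) ∂(K (Xp n ω)) ∂ℙ := by
  obtain ⟨hm, hj⟩ := hX
  have hh : Measurable (fun ω => (fun i : Fin (n+1) => Xp i.1 ω)) :=
    measurable_pi_lambda _ fun i => hm _
  let κ : ProbabilityTheory.Kernel S S := ⟨K, hKm⟩
  have : ProbabilityTheory.IsFiniteKernel κ := ⟨1, ENNReal.one_lt_top, hK⟩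
  let κ' : ProbabilityTheory.Kernel (Fin (n+1) → S) S :=
    κ.comap (fun v => v (Fin.last n)) (measurable_pi_apply _)
  have hmeas : Measurable (fun v : Fin (n+1) → S => (K (v (Fin.last n))).map (fun z => (v, z))) := by
    have h2 := (ProbabilityTheory.Kernel.prod ProbabilityTheory.Kernel.id κ').measurable
    convert h2 using 2 with v
    rw [ProbabilityTheory.Kernel.prod_apply, ProbabilityTheory.Kernel.id_apply, Measure.dirac_prod]
    rfl
  have hGi : Measurable (fun v : Fin (n+1) → S => ∫⁻ z, G (v, z) ∂(K (v (Fin.last n)))) := by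
    have := hG.lintegral_kernel_prod_right' (κ := κ')
    exact this
  calc ∫⁻ ω, G ((fun i : Fin (n+1) => Xp i.1 ω), Xp (n+1) ω) ∂ℙ
      = ∫⁻ q, G q ∂(Measure.map (fun ω => ((fun i : Fin (n+1) => Xp i.1 ω), Xp (n+1) ω)) ℙ) := by
        rw [lintegral_map hG (hh.prodMk (hm _))]
    _ = _ := by
        rw [hj n, Measure.lintegral_bind hmeas.aemeasurable hG.aemeasurable]
        have : ∀ v : Fin (n+1) → S, ∫⁻ q, G q ∂((K (v (Fin.last n))).map (fun z => (v, z)))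
            = ∫⁻ z, G (v, z) ∂(K (v (Fin.last n))) := fun v =>
          lintegral_map hG measurable_prodMk_left
        simp_rw [this]
        rw [lintegral_map hGi hh]
        rfl

lemma passage_abstract {Ω : Type} [MeasurableSpace Ω] (ℙ : Measure Ω) [IsProbabilityMeasure ℙ]
    {S : Type*} [MeasurableSpace S] (K : S → Measure S) (hKm : Measurable K)
    (hK : ∀ s, K s univ ≤ 1) (Xp : ℕ → Ω → S) (hX : IsMarkovChainWith ℙ K Xp)
    (V : S → ℝ) (hVm : Measurable V) (hV : ∀ s, 0 < V s) {p c b M : ℝ} (hp : 1 ≤ p)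
    (hc : 0 < c) (hb : 0 ≤ b)
    (hQ : ∀ s, M < V s → 0 ≤ V s - c * V s ^ (1 - 1 / p))
    (hdrift : ∀ s, M < V s → 
      ∫⁻ z, ENNReal.ofReal (V z) ∂(K s) ≤ ENNReal.ofReal (V s - c * V s ^ (1 - 1 / p)))
    (hone : ∀ s, ∫⁻ z, ENNReal.ofReal (V z) ∂(K s) ≤ ENNReal.ofReal (V s + b))
    (x : S) (hx : ℙ.map (Xp 0) = Measure.dirac x) :
    ∫⁻ ω, (hitTime Xp {z | V z ≤ M} ω) ^ p ∂ℙ ≤ 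
      ENNReal.ofReal ((c / p) ^ (-p) * ((1 + c / p) ^ (p - 1) * (V x + b + c / p))) := by
  classical
  have hm := hX.1
  have hp0 : 0 < p := by linarith
  set e := c / p with he
  have he0 : 0 < e := by positivity
  set A : Set S := {z | V z ≤ M} with hAdef
  have hA : MeasurableSet A := measurableSet_le hVm measurable_const
  set τ := hitTime Xp A with hτ
  have hτm : Measurable τ := hitTime_meas Xp hm A hA
  set H : ℕ → S → ENNReal := fun n s => ENNReal.ofReal ((V s ^ (1 / p) + e * n) ^ p) with hH
  have hHm : ∀ n, Measurable (H n) := fun n => by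
    apply Measurable.ennreal_ofReal; fun_prop
  set D : ∀ n : ℕ, Set (Fin (n+1) → S) := fun n => {v | ∀ i : Fin (n+1), 0 < i.1 → v i ∉ A} with hD
  have hDm : ∀ n, MeasurableSet (D n) := by
    intro n
    have : D n = ⋂ i : Fin (n+1), ⋂ _ : 0 < i.1, (fun v => v i) ⁻¹' Aᶜ := by
      ext v; simp [hD]
    rw [this]
    exact MeasurableSet.iInter fun i => MeasurableSet.iInter fun _ => measurable_pi_apply i hA.compl
  set DO : ℕ → Set Ω := fun n => {ω | (fun i : Fin (n+1) => Xp i.1 ω) ∈ D n} with hDO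
  have hDO' : ∀ n ω, ω ∈ DO n ↔ ∀ k, 0 < k → k ≤ n → Xp k ω ∉ A := by
    intro n ω
    constructor
    · intro h k hk hkn
      exact h ⟨k, by omega⟩ hk
    · intro h i hi
      exact h i.1 hi (by omega)
  have hDOm : ∀ n, MeasurableSet (DO n) := fun n =>
    (measurable_pi_lambda _ fun i => hm _ : Measurable (fun ω => (fun i : Fin (n+1) => Xp i.1 ω))) (hDm n)
  have hIm : ∀ n k, Measurable ((DO n).indicator (fun ω => H k (Xp k ω))) := fun n k =>
    ((hHm k).comp (hm k)).indicator (hDOm n)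
  set B : ENNReal := ENNReal.ofReal ((1 + e) ^ (p - 1) * (V x + b + e)) with hB
  -- one step
  have hstep : ∀ n, ∫⁻ ω, (DO n).indicator (fun ω => H (n+1) (Xp (n+1) ω)) ω ∂ℙ
      = ∫⁻ ω, (DO n).indicator (fun ω => ∫⁻ z, H (n+1) z ∂(K (Xp n ω))) ω ∂ℙ := by
    intro n
    have h := markov_int ℙ K hKm hK Xp hX n 
      (fun q => (D n).indicator (fun _ => H (n+1) q.2) q.1) 
      (by
        have : (fun q : (Fin (n+1) → S) × S => (D n).indicator (fun _ => H (n+1) q.2) q.1)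
          = (Prod.fst ⁻¹' (D n)).indicator (fun q => H (n+1) q.2) := by
          funext q; simp [Set.indicator]
        rw [this]
        exact ((hHm _).comp measurable_snd).indicator (measurable_fst (hDm n)))
    refine Eq.trans ?_ (h.trans ?_)
    · refine lintegral_congr fun ω => ?_
      simp [Set.indicator, hDO]
    · refine lintegral_congr fun ω => ?_
      by_cases hω : ω ∈ DO n
      · have : (fun i : Fin (n+1) => Xp i.1 ω) ∈ D n := hω
        simp [Set.indicator, hω, this]
      · have : (fun i : Fin (n+1) => Xp i.1 ω) ∉ D n := hω
        simp [Set.indicator, hω, this]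
  set Z : ℕ → Ω → ENNReal := fun n ω => (DO n).indicator (fun ω => H n (Xp n ω)) ω
    + (DO n)ᶜ.indicator (fun ω => (ENNReal.ofReal e * τ ω) ^ p) ω with hZ
  have hτle : ∀ n ω, Xp (n+1) ω ∈ A → τ ω ≤ ((n + 1 : ℕ) : ENNReal) := by
    intro n ω h
    exact sInf_le ⟨n+1, rfl, by omega, h⟩
  have hZle : ∀ n ω, Z (n+1) ω ≤ (DO n).indicator (fun ω => H (n+1) (Xp (n+1) ω)) ω
    + (DO n)ᶜ.indicator (fun ω => (ENNReal.ofReal e * τ ω) ^ p) ω := by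
    intro n ω
    by_cases h1 : ω ∈ DO (n+1)
    · have h0 : ω ∈ DO n := by
        rw [hDO'] at h1 ⊢
        exact fun k hk hkn => h1 k hk (by omega)
      simp [hZ, h1, h0]
    · by_cases h0 : ω ∈ DO n
      · have hA1 : Xp (n+1) ω ∈ A := by
          rw [hDO'] at h1 h0
          push Not at h1
          obtain ⟨k, hk, hkn, hkA⟩ := h1
          rcases Nat.lt_or_ge n k with h | h
          · have : k = n + 1 := by omega
            rwa [this] at hkA
          · exact absurd hkA (h0 k hk h)
        simp only [hZ, Set.indicator, h1, h0, mem_compl_iff, not_true, not_false_iff, if_true, if_false,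
          zero_add, add_zero]
        simp only [hH]
        rw [← ENNReal.ofReal_rpow_of_nonneg (by have := hV (Xp (n+1) ω); positivity) hp0.le]
        gcongr
        calc ENNReal.ofReal e * τ ω ≤ ENNReal.ofReal e * ((n+1 : ℕ) : ENNReal) := by
              gcongr; exact hτle n ω hA1
          _ = ENNReal.ofReal (e * (n+1 : ℕ)) := by
              rw [ENNReal.ofReal_mul he0.le, ENNReal.ofReal_natCast]
          _ ≤ _ := ENNReal.ofReal_le_ofReal (by
              have := Real.rpow_nonneg (hV (Xp (n+1) ω)).le (1/p); linarith)
      · simp [hZ, h1, h0]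
  have hZint : ∀ n, ∫⁻ ω, Z (n+1) ω ∂ℙ ≤ B := by
    intro n
    induction n with
    | zero =>
      refine (lintegral_mono (hZle 0)).trans ?_
      have hall : DO 0 = univ := by
        ext ω; rw [hDO']; simp; intro k h1 h2; omega
      rw [lintegral_add_left (hIm _ _), hstep, hall]
      simp only [indicator_univ, compl_univ, indicator_empty, lintegral_zero, add_zero]
      have : ∀ s, ∫⁻ z, H 1 z ∂(K s) ≤ ENNReal.ofReal ((1 + e) ^ (p - 1) * (V s + b + e)) := by
        intro s
        have h := aux_step (K s) (hK s) V hVm hV hp one_pos he0.le (by have := hV s; linarith) (hone s)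
        simpa [hH] using h
      have hmm : Measurable (fun s => ENNReal.ofReal ((1 + e) ^ (p - 1) * (V s + b + e))) := by
        apply Measurable.ennreal_ofReal; fun_prop
      calc _ ≤ ∫⁻ ω, ENNReal.ofReal ((1 + e) ^ (p - 1) * (V (Xp 0 ω) + b + e)) ∂ℙ := 
            lintegral_mono fun ω => this _
        _ = ∫⁻ s, ENNReal.ofReal ((1 + e) ^ (p - 1) * (V s + b + e)) ∂(ℙ.map (Xp 0)) := by
            rw [lintegral_map hmm (hm 0)]
        _ = B := by rw [hx, lintegral_dirac' _ hmm]
        _ ≤ B := le_rfl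
    | succ n ih =>
      refine (lintegral_mono (hZle (n+1))).trans (le_trans ?_ ih)
      rw [lintegral_add_left (hIm _ _), hstep, hZ]
      simp only
      rw [lintegral_add_left (hIm _ _)]
      refine add_le_add (lintegral_mono fun ω => ?_) le_rfl
      by_cases h0 : ω ∈ DO (n+1)
      · simp only [h0, indicator_of_mem]
        have hnA : M < V (Xp (n+1) ω) := by
          have := (hDO' _ _).1 h0 (n+1) (by omega) le_rfl
          simpa [hAdef] using this
        have h := aux_step_drift (K (Xp (n+1) ω)) (hK _) V hVm hV (a := e * ((n+1+1 : ℕ) : ℝ)) hp hc 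
          (hV (Xp (n+1) ω)) (by
            push_cast; have : (0:ℝ) ≤ n := n.cast_nonneg
            nlinarith) (hQ _ hnA) (hdrift _ hnA)
        refine h.trans (le_of_eq ?_)
        simp only [hH]
        congr 3
        rw [← he]; push_cast; ring
      · simp [h0]
  have hmin : ∀ n ω, (ENNReal.ofReal e * min (τ ω) ((n:ℕ) : ENNReal)) ^ p ≤ Z n ω := by
    intro n ω
    by_cases h0 : ω ∈ DO n
    · simp only [hZ, h0, indicator_of_mem, mem_compl_iff, not_true, not_false_iff, indicator_of_notMem, add_zero]
      simp only [hH]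
      rw [← ENNReal.ofReal_rpow_of_nonneg (by have := hV (Xp n ω); positivity) hp0.le]
      gcongr
      calc ENNReal.ofReal e * min (τ ω) (n : ENNReal) ≤ ENNReal.ofReal e * (n : ENNReal) := by
            gcongr; exact min_le_right _ _
        _ = ENNReal.ofReal (e * n) := by
            rw [ENNReal.ofReal_mul he0.le, ENNReal.ofReal_natCast]
        _ ≤ _ := ENNReal.ofReal_le_ofReal (by
            have := Real.rpow_nonneg (hV (Xp n ω)).le (1/p); linarith)
    · have : ω ∈ (DO n)ᶜ := h0
      simp only [hZ, h0, this, indicator_of_mem, not_false_iff, indicator_of_notMem, zero_add]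
      gcongr
      exact min_le_left _ _
  have hmin2 : ∀ n : ℕ, ∫⁻ ω, (min (τ ω) ((n + 1 : ℕ) : ENNReal)) ^ p ∂ℙ
      ≤ ENNReal.ofReal (e ^ (-p) * ((1 + e) ^ (p - 1) * (V x + b + e))) := by
    intro n
    have h := (lintegral_mono (hmin (n+1))).trans (hZint n)
    have h2 : ∀ ω, (min (τ ω) ((n + 1 : ℕ) : ENNReal)) ^ p = ENNReal.ofReal (e ^ (-p)) *
        (ENNReal.ofReal e * min (τ ω) ((n+1:ℕ) : ENNReal)) ^ p := by
      intro ω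
      rw [ENNReal.mul_rpow_of_nonneg _ _ hp0.le, ← mul_assoc, ENNReal.ofReal_rpow_of_nonneg he0.le hp0.le,
        ← ENNReal.ofReal_mul (by positivity), ← Real.rpow_add he0]
      simp
    simp_rw [h2]
    rw [lintegral_const_mul _ (by fun_prop), ENNReal.ofReal_mul (by positivity)]
    gcongr
  have hlim : Tendsto (fun n : ℕ => ∫⁻ ω, (min (τ ω) ((n + 1 : ℕ) : ENNReal)) ^ p ∂ℙ) atTop
      (nhds (∫⁻ ω, (τ ω) ^ p ∂ℙ)) := by
    refine lintegral_tendsto_of_tendsto_of_monotone (fun n => by fun_prop) ?_ ?_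
    · refine Eventually.of_forall fun ω n k hnk => ?_
      dsimp only
      gcongr
    · refine Eventually.of_forall fun ω => ?_
      refine (ENNReal.continuous_rpow_const.tendsto _).comp ?_
      have h1 : Tendsto (fun n : ℕ => ((n + 1 : ℕ) : ENNReal)) atTop (nhds ⊤) :=
        ENNReal.tendsto_nat_nhds_top.comp (tendsto_add_atTop_nat 1)
      simpa using (tendsto_const_nhds (x := τ ω)).min h1
  exact le_of_tendsto' hlim hmin2

lemma Texch_meas (m : ℕ) (E : ℝ) (i : Fin m) :
    Measurable (fun q : Delta m E × ℝ => Texch m E i q.2 q.1) := by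
  classical
  rw [← (MeasurableEmbedding.subtype_coe (by
    have : simU m E = (⋂ i, {x | 0 < x i}) ∩ {x | ∑ i, x i < E} := by
      ext x; simp [simU]
    rw [this]
    refine (MeasurableSet.iInter fun i => ?_).inter ?_
    · exact measurableSet_lt measurable_const (measurable_pi_apply i)
    · exact measurableSet_lt (by fun_prop) measurable_const :
      MeasurableSet (simU m E))).measurable_comp_iff]
  have : (Subtype.val ∘ fun q : Delta m E × ℝ => Texch m E i q.2 q.1)
      = fun q => if q.2 ∈ Ioo (0:ℝ) 1 then T0 m E i q.2 q.1.1 else q.1.1 := by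
    funext q
    simp only [Function.comp, Texch]
    split_ifs <;> rfl
  rw [this]
  have hval : Measurable (fun q : Delta m E × ℝ => q.1.1) := measurable_subtype_coe.comp measurable_fst
  have hc : ∀ j, Measurable (fun q : Delta m E × ℝ => q.1.1 j) := fun j =>
    (measurable_pi_apply j).comp hval
  refine Measurable.ite (measurable_snd measurableSet_Ioo) ?_ hval
  refine measurable_pi_lambda _ fun j => ?_
  unfold T0
  by_cases hj : j = i
  · subst hj
    simp only [Function.update_self]
    have h1 := Finset.measurable_sum Finset.univ (fun j _ => hc j)
    have h2 := hc j
    have h3 : Measurable (fun q : Delta m E × ℝ => q.2) := measurable_snd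
    exact (measurable_const.sub h1).add ((measurable_const.sub (h3.pow_const 2)).mul h2)
  · simp only [Function.update_of_ne hj]
    exact hc j

lemma Texch_meas' (m : ℕ) (E : ℝ) (i : Fin m) (x : Delta m E) :
    Measurable (fun u => Texch m E i u x) :=
  (Texch_meas m E i).comp (measurable_prodMk_left (x := x))

instance unif01_fin : IsProbabilityMeasure unif01 := ⟨by simp [unif01]⟩

lemma coord_meas (m : ℕ) (E : ℝ) (i : Fin m) : Measurable (fun x : Delta m E => x.1 i) :=
  (measurable_pi_apply i).comp measurable_subtype_coe

lemma jumpRate_meas (m : ℕ) (E : ℝ) : Measurable (jumpRate m E) := by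
  unfold jumpRate
  exact Finset.measurable_sum Finset.univ (fun j _ => (coord_meas m E j).sqrt)

lemma ustep_meas (m : ℕ) (E : ℝ) : Measurable (ustep m E) := by
  refine Measure.measurable_of_measurable_coe _ fun s hs => ?_
  have : (fun x => ustep m E x s) = fun x =>
      ENNReal.ofReal (1 - jumpRate m E x / Lam m E) * s.indicator 1 x
      + (ENNReal.ofReal (Lam m E))⁻¹ * ∑ i, ENNReal.ofReal (Real.sqrt (x.1 i)) *
          unif01 (Prod.mk x ⁻¹' ((fun q : Delta m E × ℝ => Texch m E i q.2 q.1) ⁻¹' s)) := by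
    funext x
    simp only [ustep, Measure.add_apply, Measure.smul_apply, smul_eq_mul, Measure.dirac_apply' _ hs,
      Measure.sum_apply _ hs, tsum_fintype]
    congr 2
    refine Finset.sum_congr rfl fun i _ => ?_
    rw [Measure.map_apply (Texch_meas' m E i x) hs]
    rfl
  rw [this]
  refine Measurable.add (Measurable.mul ?_ (measurable_one.indicator hs)) (Measurable.const_mul ?_ _)
  · exact (measurable_const.sub ((jumpRate_meas m E).div_const _)).ennreal_ofReal
  · refine Finset.measurable_sum _ fun i _ => Measurable.mul (coord_meas m E i).sqrt.ennreal_ofReal ?_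
    exact measurable_measure_prodMk_left (Texch_meas m E i hs)

lemma ustep_lintegral (m : ℕ) (E : ℝ) (x : Delta m E) (f : Delta m E → ENNReal) (hf : Measurable f) :
    ∫⁻ z, f z ∂(ustep m E x) = ENNReal.ofReal (1 - jumpRate m E x / Lam m E) * f x
      + (ENNReal.ofReal (Lam m E))⁻¹ * ∑ i, ENNReal.ofReal (Real.sqrt (x.1 i)) *
        ∫⁻ u in Ioo (0:ℝ) 1, f (Texch m E i u x) := by
  simp only [ustep]
  rw [lintegral_add_measure, lintegral_smul_measure, lintegral_smul_measure, lintegral_dirac' _ hf,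
    lintegral_sum_measure, tsum_fintype]
  simp only [smul_eq_mul]
  congr 2
  refine Finset.sum_congr rfl fun i _ => ?_
  rw [lintegral_smul_measure, lintegral_map hf (Texch_meas' m E i x)]
  rfl

lemma Lam_pos {m : ℕ} (hm : 1 ≤ m) {E : ℝ} (hE : 0 < E) : 0 < Lam m E := by
  have : (0:ℝ) < m := by exact_mod_cast hm
  exact Real.sqrt_pos.2 (by positivity)

lemma jumpRate_le (m : ℕ) (E : ℝ) (x : Delta m E) : jumpRate m E x ≤ Lam m E := by
  unfold jumpRate Lam
  apply Real.le_sqrt_of_sq_le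
  refine (sq_sum_le_card_mul_sum_sq).trans ?_
  simp only [Finset.card_univ, Fintype.card_fin]
  have : ∑ i, Real.sqrt (x.1 i) ^ 2 = ∑ i, x.1 i :=
    Finset.sum_congr rfl fun i _ => Real.sq_sqrt (x.2.1 i).le
  rw [this]
  have := x.2.2.le
  gcongr

lemma jumpRate_nonneg (m : ℕ) (E : ℝ) (x : Delta m E) : 0 ≤ jumpRate m E x :=
  Finset.sum_nonneg fun _ _ => Real.sqrt_nonneg _

/-- bounding the uniformized step by bounds on each exchange. -/
lemma ustep_bound {m : ℕ} (hm : 1 ≤ m) {E : ℝ} (hE : 0 < E) (x : Delta m E)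
    (f : Delta m E → ENNReal) (hf : Measurable f) (v : ℝ) (hv : 0 ≤ v) (a : Fin m → ℝ) (ha : ∀ i, 0 ≤ a i)
    (hfx : f x ≤ ENNReal.ofReal v)
    (hfa : ∀ i, ∫⁻ u in Ioo (0:ℝ) 1, f (Texch m E i u x) ≤ ENNReal.ofReal (a i)) :
    ∫⁻ z, f z ∂(ustep m E x) ≤
      ENNReal.ofReal (v + (Lam m E)⁻¹ * ∑ i, Real.sqrt (x.1 i) * (a i - v)) := by
  rw [ustep_lintegral m E x f hf]
  have hL := Lam_pos hm hE
  have h1 : 0 ≤ 1 - jumpRate m E x / Lam m E := by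
    have := (div_le_one hL).2 (jumpRate_le m E x)
    linarith
  calc _ ≤ ENNReal.ofReal (1 - jumpRate m E x / Lam m E) * ENNReal.ofReal v
      + (ENNReal.ofReal (Lam m E))⁻¹ * ∑ i, ENNReal.ofReal (Real.sqrt (x.1 i)) *
        ENNReal.ofReal (a i) := by
        gcongr with i
        exact hfa i
    _ = ENNReal.ofReal ((1 - jumpRate m E x / Lam m E) * v
      + (Lam m E)⁻¹ * ∑ i, Real.sqrt (x.1 i) * a i) := by
        have hs : 0 ≤ ∑ i, Real.sqrt (x.1 i) * a i :=
          Finset.sum_nonneg fun i _ => mul_nonneg (Real.sqrt_nonneg _) (ha i)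
        rw [ENNReal.ofReal_add (by positivity) (by positivity), ENNReal.ofReal_mul h1,
          ENNReal.ofReal_mul (by positivity), ENNReal.ofReal_inv_of_pos hL,
          ENNReal.ofReal_sum_of_nonneg fun i _ => mul_nonneg (Real.sqrt_nonneg _) (ha i)]
        congr 2
        refine Finset.sum_congr rfl fun i _ => ?_
        rw [ENNReal.ofReal_mul (Real.sqrt_nonneg _)]
    _ ≤ _ := by
        refine ENNReal.ofReal_le_ofReal (le_of_eq ?_)
        simp only [mul_sub, Finset.sum_sub_distrib, ← Finset.sum_mul]
        unfold jumpRate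
        field_simp
        ring

lemma ustep_mass {m : ℕ} (hm : 1 ≤ m) {E : ℝ} (hE : 0 < E) (x : Delta m E) :
    ustep m E x univ ≤ 1 := by
  have h := ustep_bound hm hE x (fun _ => 1) measurable_const 1 zero_le_one (fun _ => 1)
    (fun _ => zero_le_one) (by simp) (by simp)
  simpa using h

lemma ustepIter_meas (m : ℕ) (E : ℝ) (n : ℕ) : Measurable (ustepIter m E n) := by
  induction n with
  | zero => exact Measure.measurable_dirac
  | succ n ih => exact (Measure.measurable_bind' ih).comp (ustep_meas m E)

lemma ustepIter_succ_lintegral (m : ℕ) (E : ℝ) (n : ℕ) (x : Delta m E) (f : Delta m E → ENNReal)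
    (hf : Measurable f) : ∫⁻ z, f z ∂(ustepIter m E (n+1) x)
      = ∫⁻ w, ∫⁻ z, f z ∂(ustepIter m E n w) ∂(ustep m E x) := by
  simp only [ustepIter]
  exact Measure.lintegral_bind (ustepIter_meas m E n).aemeasurable hf.aemeasurable

lemma ustepIter_mass {m : ℕ} (hm : 1 ≤ m) {E : ℝ} (hE : 0 < E) (n : ℕ) (x : Delta m E) :
    ustepIter m E n x univ ≤ 1 := by
  induction n generalizing x with
  | zero => simp [ustepIter]
  | succ n ih =>
    have h := ustepIter_succ_lintegral m E n x (fun _ => 1) measurable_const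
    simp only [lintegral_const, one_mul] at h
    rw [h]
    calc _ ≤ ∫⁻ w, 1 ∂(ustep m E x) := lintegral_mono fun w => ih w
      _ ≤ 1 := by simpa using ustep_mass hm hE x

lemma Pt_meas (m : ℕ) (E : ℝ) (t : ℝ) : Measurable (Pt m E t) := by
  refine Measure.measurable_of_measurable_coe _ fun s hs => ?_
  simp only [Pt, Measure.sum_apply _ hs, Measure.smul_apply, smul_eq_mul]
  refine Measurable.tsum fun n => Measurable.const_mul ?_ _
  exact (Measure.measurable_coe hs).comp (ustepIter_meas m E n)

lemma Pt_lintegral (m : ℕ) (E : ℝ) (t : ℝ) (x : Delta m E) (f : Delta m E → ENNReal) :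
    ∫⁻ z, f z ∂(Pt m E t x) = ∑' n : ℕ, 
      ENNReal.ofReal (Real.exp (-(Lam m E) * t) * ((Lam m E) * t) ^ n / n.factorial) *
        ∫⁻ z, f z ∂(ustepIter m E n x) := by
  simp only [Pt]
  rw [lintegral_sum_measure]
  simp only [lintegral_smul_measure, smul_eq_mul]

lemma pois_hasSum (l : ℝ) : 
    HasSum (fun n : ℕ => Real.exp (-l) * l ^ n / n.factorial) 1 := by
  have h : HasSum (fun n : ℕ => l ^ n / n.factorial) (Real.exp l) := by
    have := NormedSpace.expSeries_div_hasSum_exp (𝔸 := ℝ) l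
    rwa [← Real.exp_eq_exp_ℝ] at this
  have h2 := h.mul_left (Real.exp (-l))
  rw [← Real.exp_add] at h2
  simpa [mul_div_assoc] using h2

lemma pois_summable (l : ℝ) (hl : 0 ≤ l) : 
    Summable (fun n : ℕ => Real.exp (-l) * l ^ n / n.factorial * n) := by
  have h := (Real.summable_pow_div_factorial (2 * l)).mul_left (Real.exp (-l))
  refine Summable.of_nonneg_of_le (fun n => by positivity) (fun n => ?_) h
  have : (n:ℝ) ≤ 2 ^ n := by exact_mod_cast Nat.lt_two_pow_self.le
  rw [mul_pow]
  calc _ ≤ Real.exp (-l) * l ^ n / n.factorial * 2 ^ n := by gcongr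
    _ = _ := by ring

lemma Pt_mass {m : ℕ} (hm : 1 ≤ m) {E : ℝ} (hE : 0 < E) (t : ℝ) (ht : 0 ≤ t) (x : Delta m E) :
    Pt m E t x univ ≤ 1 := by
  have h := Pt_lintegral m E t x (fun _ => 1)
  simp only [lintegral_const, one_mul] at h
  rw [h]
  have hL := Lam_pos hm hE
  have hs := pois_hasSum (Lam m E * t)
  calc _ ≤ ∑' n : ℕ, 
      ENNReal.ofReal (Real.exp (-(Lam m E) * t) * ((Lam m E) * t) ^ n / n.factorial) := by
        refine ENNReal.tsum_le_tsum fun n => ?_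
        exact mul_le_of_le_one_right' (ustepIter_mass hm hE n x)
    _ = 1 := by
        rw [← ENNReal.ofReal_tsum_of_nonneg (fun n => by positivity)]
        · rw [neg_mul, hs.tsum_eq]; simp
        · rw [neg_mul]; exact hs.summable
    _ ≤ 1 := le_rfl

/-- Drift for `Pt` from drift of the uniformized step. -/
lemma Pt_drift {m : ℕ} (hm : 1 ≤ m) {E : ℝ} (hE : 0 < E) (V : Delta m E → ℝ) (hVm : Measurable V)
    (hV : ∀ x, 0 < V x) (q c b : ℝ) (hc : 0 < c) (hb : 0 ≤ b) 
    (hQ : ∀ x, 0 ≤ V x - c * V x ^ q + b)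
    (hK : ∀ x, ∫⁻ z, ENNReal.ofReal (V z) ∂(ustep m E x) ≤ ENNReal.ofReal (V x - c * V x ^ q + b)) :
    ∃ c' > 0, ∃ b' ≥ 0, ∀ x, ∫⁻ z, ENNReal.ofReal (V z) ∂(Pt m E 1 x) ≤ 
      ENNReal.ofReal (V x - c' * V x ^ q + b') := by
  have hL := Lam_pos hm hE
  set l := Lam m E with hl
  have hiter : ∀ n x, ∫⁻ z, ENNReal.ofReal (V z) ∂(ustepIter m E n x) ≤ 
      ENNReal.ofReal (V x - (if n = 0 then 0 else c * V x ^ q) + n * b) ∧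
      0 ≤ V x - (if n = 0 then 0 else c * V x ^ q) + n * b := by
    intro n
    induction n with
    | zero =>
      intro x
      simp [ustepIter, lintegral_dirac' _ hVm.ennreal_ofReal, (hV x).le]
    | succ n ih =>
      intro x
      have hx := hQ x
      have hnb : 0 ≤ n * b := by positivity
      constructor
      · rw [ustepIter_succ_lintegral m E n x _ hVm.ennreal_ofReal]
        calc _ ≤ ∫⁻ w, (ENNReal.ofReal (V w) + ENNReal.ofReal (n * b)) ∂(ustep m E x) := by
              refine lintegral_mono fun w => (ih w).1.trans ?_
              rw [← ENNReal.ofReal_add (hV w).le hnb]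
              refine ENNReal.ofReal_le_ofReal ?_
              have := Real.rpow_nonneg (hV w).le q
              split_ifs
              · linarith
              · nlinarith
          _ = ∫⁻ w, ENNReal.ofReal (V w) ∂(ustep m E x) + ENNReal.ofReal (n * b) * ustep m E x univ := by
              rw [lintegral_add_right _ measurable_const, lintegral_const]
          _ ≤ ENNReal.ofReal (V x - c * V x ^ q + b) + ENNReal.ofReal (n * b) * 1 := by
              gcongr
              · exact hK x
              · exact ustep_mass hm hE x
          _ = _ := by
              rw [mul_one, ← ENNReal.ofReal_add hx hnb]
              congr 1
              simp
              ring
      · simp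
        nlinarith
  set P : ℕ → ℝ := fun n => Real.exp (-l) * l ^ n / n.factorial with hP
  have hP0 : ∀ n, 0 ≤ P n := fun n => by positivity
  have hPs : HasSum P 1 := pois_hasSum l
  have hPn : Summable (fun n => P n * n) := pois_summable l hL.le
  have hP00 : P 0 = Real.exp (-l) := by simp [hP]
  have hlt : Real.exp (-l) < 1 := by simpa using hL
  have hPn0 : 0 ≤ ∑' n, P n * n := tsum_nonneg fun n => mul_nonneg (hP0 n) (by positivity)
  refine ⟨(1 - Real.exp (-l)) * c, mul_pos (by linarith) hc, (∑' n, P n * n) * b, by positivity, fun x => ?_⟩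
  have hsum : HasSum (fun n => P n * (V x - (if n = 0 then 0 else c * V x ^ q) + n * b))
      (V x - (1 - Real.exp (-l)) * c * V x ^ q + (∑' n, P n * n) * b) := by
    have h1 := hPs.mul_right (V x - c * V x ^ q)
    have h2 := hPn.hasSum.mul_right b
    have h3 : HasSum (fun n => if n = 0 then P 0 * (c * V x ^ q) else 0) (P 0 * (c * V x ^ q)) :=
      hasSum_ite_eq 0 _
    have h4 := (h1.add h2).add h3
    have e1 : (fun n : ℕ => P n * (V x - c * V x ^ q) + P n * n * b + 
        if n = 0 then P 0 * (c * V x ^ q) else 0) = 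
        (fun n : ℕ => P n * (V x - (if n = 0 then 0 else c * V x ^ q) + n * b)) := by
      funext n
      by_cases hn : n = 0
      · subst hn; simp; ring
      · simp [hn]; ring
    have e2 : 1 * (V x - c * V x ^ q) + (∑' n, P n * n) * b + P 0 * (c * V x ^ q)
        = V x - (1 - Real.exp (-l)) * c * V x ^ q + (∑' n, P n * n) * b := by
      rw [hP00]; ring
    rw [e1, e2] at h4
    exact h4
  rw [Pt_lintegral, ← hsum.tsum_eq,
    ENNReal.ofReal_tsum_of_nonneg (fun n => mul_nonneg (hP0 n) (hiter n x).2) hsum.summable]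
  refine ENNReal.tsum_le_tsum fun n => ?_
  rw [ENNReal.ofReal_mul (hP0 n)]
  simp only [mul_one]
  gcongr
  exact (hiter n x).1

lemma int_rpow1 {s : ℝ} (hs1 : s < 1) :
    ∫⁻ u in Ioo (0:ℝ) 1, ENNReal.ofReal (u ^ (-s)) = ENNReal.ofReal (1 / (1 - s)) := by
  have hi : IntervalIntegrable (fun u : ℝ => u ^ (-s)) volume 0 1 :=
    intervalIntegral.intervalIntegrable_rpow' (by linarith)
  have hi2 : IntegrableOn (fun u : ℝ => u ^ (-s)) (Ioo 0 1) :=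
    ((intervalIntegrable_iff_integrableOn_Ioo_of_le zero_le_one).1 hi)
  rw [← ofReal_integral_eq_lintegral_ofReal hi2]
  · congr 1
    rw [← integral_Ioc_eq_integral_Ioo, ← intervalIntegral.integral_of_le zero_le_one,
      integral_rpow (Or.inl (by linarith))]
    have : -s + 1 ≠ 0 := by linarith
    rw [Real.zero_rpow this, Real.one_rpow]
    congr 1 <;> ring
  · filter_upwards [ae_restrict_mem measurableSet_Ioo] with u hu
    exact Real.rpow_nonneg hu.1.le _

lemma int_rpow2 {s : ℝ} (hs1 : s < 1) :
    ∫⁻ u in Ioo (0:ℝ) 1, ENNReal.ofReal ((1 - u) ^ (-s)) = ENNReal.ofReal (1 / (1 - s)) := by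
  rw [← int_rpow1 hs1, ← lintegral_indicator measurableSet_Ioo, ← lintegral_indicator measurableSet_Ioo,
    ← lintegral_sub_left_eq_self _ (1:ℝ)]
  refine lintegral_congr fun u => ?_
  by_cases hu : u ∈ Ioo (0:ℝ) 1
  · have : 1 - u ∈ Ioo (0:ℝ) 1 := ⟨by linarith [hu.2], by linarith [hu.1]⟩
    simp [hu, this]
  · have : 1 - u ∉ Ioo (0:ℝ) 1 := fun h => hu ⟨by linarith [h.2], by linarith [h.1]⟩
    rw [indicator_of_notMem this, indicator_of_notMem hu]

lemma tank_pos {m : ℕ} {E : ℝ} (x : Delta m E) : 0 < tank m E x := sub_pos.2 x.2.2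

lemma V_Texch {m : ℕ} {E : ℝ} (α : ℝ) (i : Fin m) (x : Delta m E) (u : ℝ) (hu : u ∈ Ioo (0:ℝ) 1) :
    Vfun m E α (Texch m E i u x) = 
      (Vfun m E α x - x.1 i ^ (-(2 * α)) - tank m E x ^ (-α)) + 
        ((tank m E x + (1 - u ^ 2) * x.1 i) ^ (-(2 * α)) + x.1 i ^ (-α) * u ^ (-(2 * α))) := by
  have hxi := x.2.1 i
  have e0 : (Texch m E i u x).1 = T0 m E i u x.1 := by simp [Texch, hu]
  have e1 : tank m E (Texch m E i u x) = u ^ 2 * x.1 i := by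
    unfold tank
    rw [e0]; unfold T0
    rw [Finset.sum_update_of_mem (Finset.mem_univ i), ← Finset.erase_eq, 
      Finset.sum_erase_eq_sub (Finset.mem_univ i)]
    ring
  unfold Vfun
  rw [e1, e0]
  have e2 : ∑ j, (T0 m E i u x.1 j) ^ (-(2 * α)) = 
      (tank m E x + (1 - u ^ 2) * x.1 i) ^ (-(2 * α)) + (∑ j, (x.1 j) ^ (-(2 * α)) - x.1 i ^ (-(2 * α))) := by
    rw [← Finset.sum_erase_eq_sub (Finset.mem_univ i), ← Finset.add_sum_erase _ _ (Finset.mem_univ i)]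
    congr 1
    · simp [T0, tank]
    · refine Finset.sum_congr rfl fun j hj => ?_
      simp [T0, Function.update_of_ne (Finset.ne_of_mem_erase hj)]
  rw [e2, Real.mul_rpow (by positivity) hxi.le, ← Real.rpow_natCast, ← Real.rpow_mul hu.1.le]
  have : ((2:ℕ):ℝ) * -α = -(2 * α) := by push_cast; ring
  rw [this]
  ring

lemma V_meas (m : ℕ) (E α : ℝ) : Measurable (Vfun m E α) := by
  unfold Vfun tank
  refine Measurable.add (Finset.measurable_sum _ fun i _ => (coord_meas m E i).pow_const _) ?_
  exact (measurable_const.sub (Finset.measurable_sum _ fun i _ => coord_meas m E i)).pow_const _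

lemma V_rest_nonneg {m : ℕ} {E : ℝ} (α : ℝ) (i : Fin m) (x : Delta m E) :
    0 ≤ Vfun m E α x - x.1 i ^ (-(2 * α)) - tank m E x ^ (-α) := by
  unfold Vfun
  have : x.1 i ^ (-(2 * α)) ≤ ∑ j, x.1 j ^ (-(2 * α)) :=
    Finset.single_le_sum (f := fun j => x.1 j ^ (-(2 * α))) 
      (fun j _ => Real.rpow_nonneg (x.2.1 j).le _) (Finset.mem_univ i)
  linarith

lemma exch_int {m : ℕ} {E : ℝ} {α : ℝ} (hα : 0 < α) (hα2 : α < 1/2) (i : Fin m) (x : Delta m E) (μ : ℝ)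
    (hμ : μ = tank m E x ^ (-(2 * α)) ∨ μ = 1 / (1 - 2 * α) * x.1 i ^ (-(2 * α))) :
    ∫⁻ u in Ioo (0:ℝ) 1, ENNReal.ofReal (Vfun m E α (Texch m E i u x)) ≤
      ENNReal.ofReal ((Vfun m E α x - x.1 i ^ (-(2 * α)) - tank m E x ^ (-α)) + 
        (μ + x.1 i ^ (-α) * (1 / (1 - 2 * α)))) := by
  have hxi := x.2.1 i
  have hy := tank_pos x
  set y := tank m E x
  set R := Vfun m E α x - x.1 i ^ (-(2 * α)) - y ^ (-α) with hR
  have hR0 : 0 ≤ R := V_rest_nonneg α i x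
  have hk : 0 < 1 - 2 * α := by linarith
  have hμ0 : 0 ≤ μ := by rcases hμ with h | h <;> rw [h] <;> positivity
  have hpt : ∀ u ∈ Ioo (0:ℝ) 1, ENNReal.ofReal (Vfun m E α (Texch m E i u x)) = 
      ENNReal.ofReal R + (ENNReal.ofReal ((y + (1 - u ^ 2) * x.1 i) ^ (-(2 * α))) +
        ENNReal.ofReal (x.1 i ^ (-α)) * ENNReal.ofReal (u ^ (-(2 * α)))) := by
    intro u hu
    have h1 : 0 < 1 - u ^ 2 := by nlinarith [hu.1, hu.2]
    have h2 := hu.1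
    rw [V_Texch α i x u hu, ENNReal.ofReal_add hR0 (by positivity), 
      ENNReal.ofReal_add (by positivity) (by positivity), ENNReal.ofReal_mul (by positivity)]
  rw [setLIntegral_congr_fun measurableSet_Ioo hpt, lintegral_add_left measurable_const,
    lintegral_add_right _ (by fun_prop), lintegral_const_mul _ (by fun_prop), 
    int_rpow1 (by linarith), lintegral_const, ENNReal.ofReal_add hR0 (by positivity),
      ENNReal.ofReal_add hμ0 (by positivity), ENNReal.ofReal_mul (p := x.1 i ^ (-α)) (by positivity)]
  have hone : (volume.restrict (Ioo (0:ℝ) 1)) univ = 1 := by simp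
  rw [hone, mul_one]
  gcongr
  rcases hμ with h | h
  · calc _ ≤ ∫⁻ u in Ioo (0:ℝ) 1, ENNReal.ofReal μ := by
          refine setLIntegral_mono measurable_const fun u hu => ENNReal.ofReal_le_ofReal ?_
          rw [h]
          have h1 : 0 < 1 - u ^ 2 := by nlinarith [hu.1, hu.2]
          refine Real.rpow_le_rpow_of_nonpos hy ?_ (by linarith)
          have := mul_pos h1 hxi
          linarith
      _ ≤ _ := by simp
  · calc _ ≤ ∫⁻ u in Ioo (0:ℝ) 1, ENNReal.ofReal (x.1 i ^ (-(2 * α))) * ENNReal.ofReal ((1 - u) ^ (-(2 * α))) := by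
          refine setLIntegral_mono (by fun_prop) fun u hu => ?_
          rw [← ENNReal.ofReal_mul (by positivity)]
          refine ENNReal.ofReal_le_ofReal ?_
          have h1 : 0 < 1 - u := by linarith [hu.2]
          rw [← Real.mul_rpow hxi.le h1.le]
          refine Real.rpow_le_rpow_of_nonpos (by positivity) ?_ (by linarith)
          have : 0 ≤ u * (1 - u) * x.1 i := by have := hu.1; positivity
          nlinarith
      _ = _ := by
          rw [lintegral_const_mul _ (by fun_prop), int_rpow2 (by linarith), ← ENNReal.ofReal_mul (by positivity), h]
          congr 1; ring

lemma neg_pow_dom {p q d : ℝ} (hp : 0 < p) (hpq : p < q) (hd : 0 < d) :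
    ∃ b ≥ (0:ℝ), ∀ y > (0:ℝ), y ^ (-p) ≤ d * y ^ (-q) + b := by
  set y0 := d ^ (1 / (q - p)) with hy0
  have hy0p : 0 < y0 := by positivity
  have hqp : 0 < q - p := by linarith
  refine ⟨y0 ^ (-p), by positivity, fun y hy => ?_⟩
  rcases le_total y0 y with h | h
  · have := Real.rpow_le_rpow_of_nonpos hy0p h (by linarith : -p ≤ 0)
    have : 0 ≤ d * y ^ (-q) := by positivity
    linarith
  · have h1 : y ^ (q - p) ≤ d := by
      calc y ^ (q - p) ≤ y0 ^ (q - p) := Real.rpow_le_rpow hy.le h hqp.le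
        _ = d := by rw [hy0, ← Real.rpow_mul hd.le, one_div_mul_cancel hqp.ne', Real.rpow_one]
    have h2 : y ^ (-p) = y ^ (q - p) * y ^ (-q) := by
      rw [← Real.rpow_add hy]; congr 1; ring
    rw [h2]
    have : 0 ≤ y0 ^ (-p) := by positivity
    have := mul_le_mul_of_nonneg_right h1 (Real.rpow_nonneg hy.le (-q))
    linarith

lemma rpow_sum_le {ι : Type*} (s : Finset ι) (f : ι → ℝ) (hf : ∀ i, 0 ≤ f i) {q : ℝ} (hq : 0 < q) (hq1 : q ≤ 1) :
    (∑ i ∈ s, f i) ^ q ≤ ∑ i ∈ s, f i ^ q := by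
  classical
  induction s using Finset.induction_on with
  | empty => simp [Real.zero_rpow hq.ne']
  | insert a s ha ih =>
    rw [Finset.sum_insert ha, Finset.sum_insert ha]
    have := Real.rpow_add_le_add_rpow (hf a) (Finset.sum_nonneg fun i _ => hf i : 0 ≤ ∑ i ∈ s, f i) hq.le hq1
    linarith

lemma rpow_le_one_add {t q : ℝ} (ht : 0 ≤ t) (hq : 0 < q) (hq1 : q ≤ 1) : t ^ q ≤ 1 + t := by
  rcases le_total t 1 with h | h
  · have := Real.rpow_le_one ht h hq.le
    linarith
  · have := Real.rpow_le_rpow_of_exponent_le h hq1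
    rw [Real.rpow_one] at this
    linarith

/-- choice of the bound on the exchanged particle term -/
lemma mu_choice {α : ℝ} (hα : 1/4 < α) (hα2 : α < 1/2) : ∃ D ≥ (0:ℝ), ∀ y > (0:ℝ), ∀ t > (0:ℝ),
    ∃ μ, (μ = y ^ (-(2 * α)) ∨ μ = 1 / (1 - 2 * α) * t ^ (-(2 * α))) ∧
      Real.sqrt t * μ ≤ 1/2 * t ^ (1/2 - 2 * α) + D * y ^ (-(2 * α - 1/2)) := by
  have hk : 0 < 1 - 2 * α := by linarith
  set k := (2:ℝ) ^ (1 / (2 * α)) with hkdef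
  have hk0 : 0 < k := by positivity
  have hk2 : k ^ (-(2 * α)) = 1/2 := by
    rw [hkdef, ← Real.rpow_mul (by norm_num)]
    have : 1 / (2 * α) * -(2 * α) = -1 := by
      field_simp
    rw [this, Real.rpow_neg_one]; norm_num
  refine ⟨1 / (1 - 2 * α) * k ^ (2 * α - 1/2), by positivity, fun y hy t ht => ?_⟩
  have hst : ∀ s : ℝ, Real.sqrt t * t ^ s = t ^ (1/2 + s) := fun s => by
    rw [Real.sqrt_eq_rpow, ← Real.rpow_add ht]
  rcases le_total (k * t) y with h | h
  · refine ⟨_, Or.inl rfl, ?_⟩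
    have h1 := Real.rpow_le_rpow_of_nonpos (by positivity) h (by linarith : -(2 * α) ≤ 0)
    rw [Real.mul_rpow hk0.le ht.le, hk2] at h1
    have h2 := mul_le_mul_of_nonneg_left h1 (Real.sqrt_nonneg t)
    have h3 : Real.sqrt t * (1/2 * t ^ (-(2 * α))) = 1/2 * t ^ (1/2 - 2 * α) := by
      rw [mul_left_comm, hst]; congr 2
    have : 0 ≤ 1 / (1 - 2 * α) * k ^ (2 * α - 1/2) * y ^ (-(2 * α - 1/2)) := by positivity
    linarith
  · refine ⟨_, Or.inr rfl, ?_⟩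
    have h1 : t ^ (-(2 * α - 1/2)) ≤ k ^ (2 * α - 1/2) * y ^ (-(2 * α - 1/2)) := by
      have := Real.rpow_le_rpow_of_nonpos hy h (by linarith : -(2 * α - 1/2) ≤ 0)
      rw [Real.mul_rpow hk0.le ht.le, Real.rpow_neg hk0.le] at this
      have hkp : 0 < k ^ (2 * α - 1/2) := by positivity
      rw [inv_mul_le_iff₀ hkp] at *
      exact this
    have h3 : Real.sqrt t * (1 / (1 - 2 * α) * t ^ (-(2 * α))) = 1 / (1 - 2 * α) * t ^ (-(2 * α - 1/2)) := by
      rw [mul_left_comm, hst]; congr 2; ring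
    rw [h3]
    have h4 := mul_le_mul_of_nonneg_left h1 (by positivity : 0 ≤ 1 / (1 - 2 * α))
    have : 0 ≤ 1/2 * t ^ (1/2 - 2 * α) := by positivity
    linarith

lemma sqrt_le_jumpRate {m : ℕ} {E : ℝ} (x : Delta m E) : Real.sqrt (E - tank m E x) ≤ jumpRate m E x := by
  have h := rpow_sum_le Finset.univ (fun i => x.1 i) (fun i => (x.2.1 i).le) (q := 1/2) (by norm_num) (by norm_num)
  have : E - tank m E x = ∑ i, x.1 i := by unfold tank; ring
  rw [this]
  unfold jumpRate
  simpa only [Real.sqrt_eq_rpow] using h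

lemma V_ge_tank {m : ℕ} {E : ℝ} (α : ℝ) (x : Delta m E) : tank m E x ^ (-α) ≤ Vfun m E α x := by
  unfold Vfun
  have : 0 ≤ ∑ i, x.1 i ^ (-(2 * α)) := Finset.sum_nonneg fun i _ => Real.rpow_nonneg (x.2.1 i).le _
  linarith

lemma V_pos {m : ℕ} {E : ℝ} (α : ℝ) (x : Delta m E) : 0 < Vfun m E α x :=
  lt_of_lt_of_le (Real.rpow_pos_of_pos (tank_pos x) _) (V_ge_tank α x)

lemma V_lower {m : ℕ} {E : ℝ} {α : ℝ} (hα : 0 < α) (x : Delta m E) : E ^ (-α) ≤ Vfun m E α x := by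
  refine le_trans ?_ (V_ge_tank α x)
  refine Real.rpow_le_rpow_of_nonpos (tank_pos x) ?_ (by linarith)
  unfold tank
  have : 0 ≤ ∑ i, x.1 i := Finset.sum_nonneg fun i _ => (x.2.1 i).le
  linarith

lemma coord_le {m : ℕ} {E : ℝ} (x : Delta m E) (i : Fin m) : x.1 i ≤ E := by
  have : x.1 i ≤ ∑ j, x.1 j :=
    Finset.single_le_sum (f := fun j => x.1 j) (fun j _ => (x.2.1 j).le) (Finset.mem_univ i)
  linarith [x.2.2]

lemma V_pow_le {m : ℕ} {E : ℝ} {α : ℝ} (hα : 1/4 < α) (x : Delta m E) :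
    Vfun m E α x ^ (1 - 1 / (4 * α)) ≤ ∑ i, x.1 i ^ (1/2 - 2 * α) + tank m E x ^ (-α) + 1 := by
  have hy := tank_pos x
  have hq0 : 0 < 1 - 1 / (4 * α) := by
    have : 1 / (4 * α) < 1 := (div_lt_one (by linarith)).2 (by linarith)
    linarith
  have hq1 : 1 - 1 / (4 * α) ≤ 1 := by
    have : 0 < 1 / (4 * α) := by positivity
    linarith
  unfold Vfun
  have h1 := Real.rpow_add_le_add_rpow 
    (Finset.sum_nonneg fun i _ => Real.rpow_nonneg (x.2.1 i).le _ : 0 ≤ ∑ i, x.1 i ^ (-(2 * α)))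
    (Real.rpow_nonneg hy.le (-α)) hq0.le hq1
  have h2 := rpow_sum_le Finset.univ (fun i => x.1 i ^ (-(2 * α))) 
    (fun i => Real.rpow_nonneg (x.2.1 i).le _) hq0 hq1
  have h3 := rpow_le_one_add (Real.rpow_nonneg hy.le (-α)) hq0 hq1
  have h4 : ∑ i, (x.1 i ^ (-(2 * α))) ^ (1 - 1 / (4 * α)) = ∑ i, x.1 i ^ (1/2 - 2 * α) := by
    refine Finset.sum_congr rfl fun i _ => ?_
    rw [← Real.rpow_mul (x.2.1 i).le]
    congr 1
    field_simp
    ring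
  rw [h4] at h2
  linarith

lemma ustep_drift {m : ℕ} (hm : 1 ≤ m) {E : ℝ} (hE : 0 < E) {α : ℝ} (hα : 1/4 < α) (hα2 : α < 1/2) :
    ∃ c > (0:ℝ), ∃ b ≥ (0:ℝ), ∀ x : Delta m E,
      ∫⁻ z, ENNReal.ofReal (Vfun m E α z) ∂(ustep m E x) ≤ 
        ENNReal.ofReal (Vfun m E α x - c * Vfun m E α x ^ (1 - 1 / (4 * α)) + b) ∧
      0 ≤ Vfun m E α x - c * Vfun m E α x ^ (1 - 1 / (4 * α)) + b := by
  obtain ⟨D, hD, hmu⟩ := mu_choice hα hα2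
  have hL := Lam_pos hm hE
  set l := Lam m E with hl
  set r0 := Real.sqrt (E / 2) with hr0
  have hr0p : 0 < r0 := Real.sqrt_pos.2 (by positivity)
  obtain ⟨b2, hb2, hdom⟩ := neg_pow_dom (p := 2 * α - 1/2) (q := α) (d := r0 / (2 * (m * D + 1)))
    (by linarith) (by linarith) (by positivity)
  set κ := 1 / (1 - 2 * α) with hκ
  have hκ0 : 0 < κ := by
    have : 0 < 1 - 2 * α := by linarith
    positivity
  set b3 := m * D * b2 + m * (κ * E ^ (1/2 - α)) + r0 * (E/2) ^ (-α) with hb3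
  have hb30 : 0 ≤ b3 := by positivity
  set c0 := min (min (1/2) (r0 / 2)) l with hc0
  have hc0p : 0 < c0 := by
    refine lt_min (lt_min (by norm_num) (by positivity)) hL
  have hc1 : c0 ≤ 1/2 := (min_le_left _ _).trans (min_le_left _ _)
  have hc2 : c0 ≤ r0 / 2 := (min_le_left _ _).trans (min_le_right _ _)
  have hc3 : c0 ≤ l := min_le_right _ _
  have hc4 : l⁻¹ * c0 ≤ 1 := by
    rw [inv_mul_le_iff₀ hL]; linarith
  refine ⟨l⁻¹ * c0, by positivity, l⁻¹ * (c0 + b3) + 1, by positivity, fun x => ?_⟩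
  have hy := tank_pos x
  have hV := V_pos α x
  set y := tank m E x with hydef
  set V := Vfun m E α x with hVdef
  have hq0 : 0 < 1 - 1 / (4 * α) := by
    have : 1 / (4 * α) < 1 := (div_lt_one (by linarith)).2 (by linarith)
    linarith
  have hq1 : 1 - 1 / (4 * α) ≤ 1 := by
    have : 0 < 1 / (4 * α) := by positivity
    linarith
  have hVq := V_pow_le hα x
  rw [← hVdef, ← hydef] at hVq
  set W := V ^ (1 - 1 / (4 * α)) with hW
  have hW0 : 0 ≤ W := by positivity
  set S := ∑ i, x.1 i ^ (1/2 - 2 * α) with hS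
  have hS0 : 0 ≤ S := Finset.sum_nonneg fun i _ => Real.rpow_nonneg (x.2.1 i).le _
  constructor
  · choose μ hμ1 hμ2 using fun i => hmu y hy (x.1 i) (x.2.1 i)
    have hbd := ustep_bound hm hE x (fun z => ENNReal.ofReal (Vfun m E α z)) 
      (V_meas m E α).ennreal_ofReal V hV.le
      (fun i => (V - x.1 i ^ (-(2 * α)) - y ^ (-α)) + (μ i + x.1 i ^ (-α) * κ))
      (fun i => by
        have h1 := V_rest_nonneg α i x
        have h2 : 0 ≤ μ i := by
          have := x.2.1 i
          rcases hμ1 i with h | h <;> rw [h] <;> positivity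
        have h3 : 0 ≤ x.1 i ^ (-α) * κ := by have := x.2.1 i; positivity
        have h4 := add_nonneg h1 (add_nonneg h2 h3)
        exact h4)
      le_rfl
      (fun i => exch_int (by linarith) hα2 i x (μ i) (hμ1 i))
    refine hbd.trans (ENNReal.ofReal_le_ofReal ?_)
    have hterm : ∀ i, Real.sqrt (x.1 i) * 
        ((V - x.1 i ^ (-(2 * α)) - y ^ (-α)) + (μ i + x.1 i ^ (-α) * κ) - V) ≤
        -(1/2) * x.1 i ^ (1/2 - 2 * α) + D * y ^ (-(2 * α - 1/2)) - Real.sqrt (x.1 i) * y ^ (-α)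
          + κ * E ^ (1/2 - α) := by
      intro i
      have hxi := x.2.1 i
      have hst : ∀ s : ℝ, Real.sqrt (x.1 i) * x.1 i ^ s = x.1 i ^ (1/2 + s) := fun s => by
        rw [Real.sqrt_eq_rpow, ← Real.rpow_add hxi]
      have h1 := hst (-(2 * α))
      have h2 := hst (-α)
      have e1 : 1/2 + -(2 * α) = 1/2 - 2 * α := by ring
      have e2 : 1/2 + -α = 1/2 - α := by ring
      rw [e1] at h1
      rw [e2] at h2
      have h3 : x.1 i ^ (1/2 - α) ≤ E ^ (1/2 - α) := 
        Real.rpow_le_rpow hxi.le (coord_le x i) (by linarith)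
      have h4 := mul_le_mul_of_nonneg_left h3 hκ0.le
      have h5 := hμ2 i
      have h6 : Real.sqrt (x.1 i) * 
        ((V - x.1 i ^ (-(2 * α)) - y ^ (-α)) + (μ i + x.1 i ^ (-α) * κ) - V) = 
          - (Real.sqrt (x.1 i) * x.1 i ^ (-(2 * α))) - Real.sqrt (x.1 i) * y ^ (-α) + 
            Real.sqrt (x.1 i) * μ i + κ * (Real.sqrt (x.1 i) * x.1 i ^ (-α)) := by ring
      rw [h6, h1, h2]
      linarith
    have hsum := Finset.sum_le_sum fun i (_ : i ∈ Finset.univ) => hterm i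
    have hsum2 : ∑ i, (-(1/2) * x.1 i ^ (1/2 - 2 * α) + D * y ^ (-(2 * α - 1/2)) 
        - Real.sqrt (x.1 i) * y ^ (-α) + κ * E ^ (1/2 - α)) = 
        -(1/2) * S + m * (D * y ^ (-(2 * α - 1/2))) - jumpRate m E x * y ^ (-α) + m * (κ * E ^ (1/2 - α)) := by
      rw [Finset.sum_add_distrib, Finset.sum_sub_distrib, Finset.sum_add_distrib, ← Finset.mul_sum,
        ← Finset.sum_mul]
      simp [jumpRate, hS]
      rw [Finset.sum_mul]
      ring
    rw [hsum2] at hsum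
    have hyα : 0 < y ^ (-α) := by positivity
    have hrate : r0 * y ^ (-α) - r0 * (E/2) ^ (-α) ≤ jumpRate m E x * y ^ (-α) := by
      rcases le_total y (E/2) with h | h
      · have h1 : r0 ≤ jumpRate m E x := by
          refine le_trans ?_ (sqrt_le_jumpRate x)
          exact Real.sqrt_le_sqrt (by linarith)
        have h2 := mul_le_mul_of_nonneg_right h1 hyα.le
        have h3 : 0 ≤ r0 * (E/2) ^ (-α) := by positivity
        linarith
      · have h1 := Real.rpow_le_rpow_of_nonpos (by positivity) h (by linarith : -α ≤ 0)
        have h2 := mul_le_mul_of_nonneg_left h1 hr0p.le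
        have h3 := mul_nonneg (jumpRate_nonneg m E x) hyα.le
        linarith
    have hdy : m * (D * y ^ (-(2 * α - 1/2))) ≤ r0 / 2 * y ^ (-α) + m * D * b2 := by
      have h1 := mul_le_mul_of_nonneg_left (hdom y hy) (by positivity : 0 ≤ m * D)
      have h2 : m * D * (r0 / (2 * (m * D + 1))) ≤ r0 / 2 := by
        have hmD : 0 ≤ m * D := by positivity
        rw [mul_div_assoc', div_le_div_iff₀ (by positivity) (by norm_num)]
        nlinarith
      have h3 := mul_le_mul_of_nonneg_right h2 hyα.le
      calc m * (D * y ^ (-(2 * α - 1/2))) = m * D * y ^ (-(2 * α - 1/2)) := by ring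
        _ ≤ _ := h1
        _ = m * D * (r0 / (2 * (m * D + 1))) * y ^ (-α) + m * D * b2 := by ring
        _ ≤ _ := by linarith
    have h7 := mul_le_mul_of_nonneg_left hVq hc0p.le
    have h8 := mul_le_mul_of_nonneg_right hc1 hS0
    have h9 := mul_le_mul_of_nonneg_right hc2 hyα.le
    have hfin := hsum.trans (show _ ≤ - (c0 * W) + (c0 + b3) by
      rw [hb3]
      linarith)
    have h10 := mul_le_mul_of_nonneg_left hfin (inv_nonneg.2 hL.le)
    linarith
  · have h1 := rpow_le_one_add hV.le hq0 hq1
    have h2 := mul_le_mul_of_nonneg_right hc4 hW0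
    have h3 : 0 ≤ l⁻¹ * (c0 + b3) := by positivity
    linarith

/-- Proposition 3.5, moment bound for the first passage time to a
sublevel set of the Lyapunov function. There is `γ₀ > 0` such that for every
`γ ∈ (0, γ₀)` there are `h, M > 0` and `C = C(γ)` such that, with `α = 1/2 - γ/8`,
`A = {V_α ≤ M}` and `τ_A` the first passage time to `A` of the time-`h` sampling chain
started at `x`, one has `E_x[τ_A^{2-γ/2}] ≤ C V_α(x)` for every `x ∈ Δ`. -/
theorem passage_time_moment (m : ℕ) (hm : 1 ≤ m) (E : ℝ) (hE : 0 < E) :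
    ∃ γ₀ > (0:ℝ), ∀ γ : ℝ, 0 < γ → γ < γ₀ →
      ∃ h > (0:ℝ), ∃ M > (0:ℝ), ∃ C : ℝ,
        ∀ x : Delta m E,
          ∀ (Ω : Type) (mΩ : MeasurableSpace Ω) (ℙ : Measure Ω),
            IsProbabilityMeasure ℙ →
            ∀ Xp : ℕ → Ω → Delta m E,
              IsMarkovChainWith ℙ (Pt m E h) Xp →
              ℙ.map (Xp 0) = Measure.dirac x →
              ∫⁻ ω, (hitTime Xp {z | Vfun m E (1/2 - γ/8) z ≤ M} ω) ^ ((2:ℝ) - γ/2) ∂ℙ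
                ≤ ENNReal.ofReal (C * Vfun m E (1/2 - γ/8) x) := by
  refine ⟨1, one_pos, fun γ hγ hγ1 => ?_⟩
  set α := 1/2 - γ/8 with hα
  have hα1 : 1/4 < α := by linarith
  have hα2 : α < 1/2 := by linarith
  have hp : (2:ℝ) - γ/2 = 4 * α := by rw [hα]; ring
  rw [hp]
  set p := 4 * α with hpdef
  have hp1 : 1 < p := by linarith
  have hp0 : 0 < p := by linarith
  set q := 1 - 1 / p with hq
  have hq0 : 0 < q := by
    have : 1 / p < 1 := (div_lt_one hp0).2 hp1
    linarith
  obtain ⟨c0, hc0, b0, hb0, h0⟩ := ustep_drift hm hE hα1 hα2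
  have hVpos : ∀ x, 0 < Vfun m E α x := fun x => V_pos α x
  obtain ⟨c1, hc1, b1, hb1, h1⟩ := Pt_drift hm hE (Vfun m E α) (V_meas m E α) hVpos q c0 b0 hc0 hb0
    (fun x => (h0 x).2) (fun x => (h0 x).1)
  set c := c1 / 2 with hc
  have hcpos : 0 < c := by positivity
  set M := (2 * b1 / c1 + 1) ^ (1 / q) + c ^ p with hM
  have hMA : 0 < (2 * b1 / c1 + 1) ^ (1 / q) := by positivity
  have hMB : 0 < c ^ p := by positivity
  set e := c / p with he
  have he0 : 0 < e := by positivity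
  set v0 := E ^ (-α) with hv0
  have hv0p : 0 < v0 := by positivity
  refine ⟨1, one_pos, M, by positivity, e ^ (-p) * ((1 + e) ^ (p - 1) * (1 + (b1 + e) / v0)), ?_⟩
  intro x Ω mΩ ℙ hprob Xp hX hx
  have hmain := passage_abstract ℙ (Pt m E 1) (Pt_meas m E 1) (Pt_mass hm hE 1 zero_le_one) Xp hX
    (Vfun m E α) (V_meas m E α) hVpos (p := p) (c := c) (b := b1) (M := M) hp1.le hcpos hb1
    (fun s hs => by
      have hv := hVpos s
      have h2 : c ≤ Vfun m E α s ^ (1 / p) := by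
        have : (c ^ p) ^ (1 / p) ≤ Vfun m E α s ^ (1 / p) :=
          Real.rpow_le_rpow hMB.le (by linarith) (by positivity)
        rwa [← Real.rpow_mul hcpos.le, mul_one_div_cancel hp0.ne', Real.rpow_one] at this
      have h3 : Vfun m E α s = Vfun m E α s ^ (1 / p) * Vfun m E α s ^ (1 - 1 / p) := by
        rw [← Real.rpow_add hv]; simp
      have h4 := mul_le_mul_of_nonneg_right h2 (Real.rpow_nonneg hv.le (1 - 1 / p))
      linarith)
    (fun s hs => by
      have hv := hVpos s
      refine (h1 s).trans (ENNReal.ofReal_le_ofReal ?_)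
      have h2 : 2 * b1 / c1 + 1 ≤ Vfun m E α s ^ q := by
        have : ((2 * b1 / c1 + 1) ^ (1 / q)) ^ q ≤ Vfun m E α s ^ q :=
          Real.rpow_le_rpow hMA.le (by linarith) hq0.le
        rwa [← Real.rpow_mul (by positivity), one_div_mul_cancel hq0.ne', Real.rpow_one] at this
      have h3 : b1 ≤ c * Vfun m E α s ^ q := by
        calc b1 = c * (2 * b1 / c1) := by rw [hc]; field_simp
          _ ≤ _ := by gcongr; linarith
      have h4 : c1 = 2 * c := by rw [hc]; ring
      rw [h4]
      linarith)
    (fun s => by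
      refine (h1 s).trans (ENNReal.ofReal_le_ofReal ?_)
      have := mul_nonneg hc1.le (Real.rpow_nonneg (hVpos s).le q)
      linarith)
    x hx
  refine hmain.trans (ENNReal.ofReal_le_ofReal ?_)
  rw [← he, mul_assoc, mul_assoc]
  have hVx : v0 ≤ Vfun m E α x := V_lower (by linarith) x
  gcongr
  have : b1 + e ≤ (b1 + e) / v0 * Vfun m E α x := by
    rw [div_mul_eq_mul_div, le_div_iff₀ hv0p]
    gcongr
  linarith
end

section
/- Polynomial moments of a geometrically stopped sum with polynomial-tail increments: let (τ_n)_{n≥0} be a nondecreasing sequence of ℕ-valued random variables with τ_0 = 0, let N be an ℕ-valued random variable, and suppose there are constants η ∈ (0,1), p > 1 and C' > 0 such that P[N > k] ≤ (1−η)^k for all k ≥ 0, and P[τ_{n+1} − τ_n > k and N > n] ≤ C' k^{−p} for all n ≥ 0 and k ≥ 1. Then for every r with 0 < r < p, E[ τ_N^r ] < ∞. -/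
open MeasureTheory

lemma aux_interp (x : ENNReal) (u v s : ℝ) (hu : 0 ≤ u) (hv : 0 ≤ v) (hs0 : 0 < s) (hs1 : s < 1)
    (h1 : x ≤ ENNReal.ofReal u) (h2 : x ≤ ENNReal.ofReal v) :
    x ≤ ENNReal.ofReal (u ^ s * v ^ (1 - s)) := by
  have e : x = x ^ s * x ^ (1 - s) := by
    rw [← ENNReal.rpow_add_of_nonneg _ _ hs0.le (by linarith)]
    simp
  rw [e, ENNReal.ofReal_mul (by positivity), ← ENNReal.ofReal_rpow_of_nonneg hu hs0.le,
    ← ENNReal.ofReal_rpow_of_nonneg hv (by linarith)]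
  gcongr

lemma aux_dyadic (X : ℕ) (hX : 2 ≤ X) : ∃ j : ℕ, 2 ^ j < X ∧ X ≤ 2 ^ (j + 1) := by
  have hex : ∃ k, X ≤ 2 ^ k := ⟨X, Nat.lt_two_pow_self.le⟩
  classical
  have h1 := Nat.find_spec hex
  rcases hk : Nat.find hex with _ | j
  · rw [hk] at h1; omega
  · refine ⟨j, ?_, by rw [hk] at h1; exact h1⟩
    have := Nat.find_min hex (m := j) (by omega)
    omega

lemma aux_sum (f : ℕ → ℕ) (h0 : f 0 = 0) (hm : ∀ n, f n ≤ f (n+1)) (a : ℝ) (ha0 : 0 < a)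
    (ha1 : a < 1) (M : ℕ) (hM : 0 < M) :
    ∃ m < M, (f M : ℝ) ≤ ((f (m+1) - f m : ℕ) : ℝ) * (a ^ m)⁻¹ * (1 - a)⁻¹ := by
  obtain ⟨m, hmM, hmax⟩ := Finset.exists_max_image (Finset.range M)
    (fun n => ((f (n+1) - f n : ℕ) : ℝ) * (a ^ n)⁻¹) ⟨0, by simpa using hM⟩
  refine ⟨m, by simpa using hmM, ?_⟩
  set Q := ((f (m+1) - f m : ℕ) : ℝ) * (a ^ m)⁻¹ with hQ
  have e : (f M : ℝ) = ∑ n ∈ Finset.range M, ((f (n+1) - f n : ℕ) : ℝ) := by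
    have : ∀ n, ((f (n+1) - f n : ℕ) : ℝ) = (f (n+1) : ℝ) - f n := fun n => Nat.cast_sub (hm n)
    simp_rw [this]
    rw [Finset.sum_range_sub (fun n => (f n : ℝ))]
    simp [h0]
  have hQ0 : 0 ≤ Q := by positivity
  calc (f M : ℝ) = _ := e
    _ ≤ ∑ n ∈ Finset.range M, Q * a ^ n := by
        apply Finset.sum_le_sum
        intro n hn
        have := hmax n hn
        have hp : 0 < a ^ n := by positivity
        calc _ = ((f (n+1) - f n : ℕ) : ℝ) * (a ^ n)⁻¹ * a ^ n := by field_simp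
          _ ≤ _ := by gcongr
    _ = Q * ∑ n ∈ Finset.range M, a ^ n := by rw [Finset.mul_sum]
    _ ≤ Q * (1 - a)⁻¹ := by
        gcongr
        rw [← tsum_geometric_of_lt_one ha0.le ha1]
        exact (summable_geometric_of_lt_one ha0.le ha1).sum_le_tsum _ (fun _ _ => by positivity)



/-- polynomial moments of a geometrically stopped sum with
polynomial-tail increments. Let `(τ_n)` be a nondecreasing sequence of ℕ-valued
random variables with `τ_0 = 0` and `N` an ℕ-valued random variable. If
`P[N > k] ≤ (1-η)^k` and `P[τ_{n+1} - τ_n > k, N > n] ≤ C' k^{-p}` (for `k ≥ 1`),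
with `η ∈ (0,1)`, `p > 1`, `C' > 0`, then `E[τ_N^r] < ∞` for every `0 < r < p`. -/
theorem stopped_sum_polynomial_moments
    {Ω : Type*} [MeasurableSpace Ω] (ℙ : Measure Ω) (hℙ : IsProbabilityMeasure ℙ)
    (τ : ℕ → Ω → ℕ) (hτmeas : ∀ n, Measurable (τ n))
    (hτ0 : ∀ ω, τ 0 ω = 0) (hτmono : ∀ (n : ℕ) (ω : Ω), τ n ω ≤ τ (n+1) ω)
    (N : Ω → ℕ) (hNmeas : Measurable N)
    (η : ℝ) (hη0 : 0 < η) (hη1 : η < 1) (p : ℝ) (hp : 1 < p) (C' : ℝ) (hC' : 0 < C')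
    (hNtail : ∀ k : ℕ, ℙ {ω | k < N ω} ≤ ENNReal.ofReal ((1 - η) ^ k))
    (hinc : ∀ n k : ℕ, 1 ≤ k →
      ℙ {ω | k < τ (n+1) ω - τ n ω ∧ n < N ω} ≤ ENNReal.ofReal (C' * (k : ℝ) ^ (-p))) :
    ∀ r : ℝ, 0 < r → r < p →
      ∫⁻ ω, ENNReal.ofReal ((τ (N ω) ω : ℝ) ^ r) ∂ℙ ≠ ⊤ := by

  intro r hr hrp
  obtain ⟨s, hs0, hs1, hsp⟩ : ∃ s : ℝ, 0 < s ∧ s < 1 ∧ r < p * s := by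
    have hp0 : 0 < p := by linarith
    refine ⟨(r / p + 1) / 2, by positivity, ?_, ?_⟩
    · have : r / p < 1 := by rwa [div_lt_one hp0]
      linarith
    · field_simp
      linarith
  set g := 1 - η with hg
  have hg0 : 0 < g := by linarith
  have hg1 : g < 1 := by linarith
  set t := (1 - s) / 2 with ht
  have ht0 : 0 < t := by linarith
  set h := g ^ t with hh
  have hh0 : 0 < h := by positivity
  have hh1 : h < 1 := Real.rpow_lt_one hg0.le hg1 ht0
  have hh2 : h ^ 2 = g ^ (1 - s) := by
    rw [hh, ← Real.rpow_natCast, ← Real.rpow_mul hg0.le]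
    congr 1; push_cast; linarith
  set a := h ^ (1 / r) with ha
  have ha0 : 0 < a := by positivity
  have ha1 : a < 1 := Real.rpow_lt_one hh0.le hh1 (by positivity)
  have har : a ^ r = h := by
    rw [ha, ← Real.rpow_mul hh0.le, one_div_mul_cancel hr.ne', Real.rpow_one]
  have hW : ∀ n : ℕ, ((a ^ n)⁻¹) ^ r = (h ^ n)⁻¹ := by
    intro n
    rw [Real.inv_rpow (by positivity), ← Real.rpow_natCast a n, ← Real.rpow_mul ha0.le, mul_comm,
      Real.rpow_mul ha0.le, har, Real.rpow_natCast]
  set B : ℕ → Set Ω := fun n => {ω | n < N ω} with hB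
  set E : ℕ → ℕ → Set Ω := fun n j => {ω | 2 ^ j < τ (n+1) ω - τ n ω ∧ n < N ω} with hE
  have hBm : ∀ n, MeasurableSet (B n) := fun n => measurableSet_lt measurable_const hNmeas
  have hEm : ∀ n j, MeasurableSet (E n j) := fun n j =>
    (measurableSet_lt measurable_const ((hτmeas (n+1)).sub (hτmeas n))).inter (hBm n)
  set K := ((1 - a)⁻¹) ^ r with hK
  have ha1' : 0 < (1 - a)⁻¹ := inv_pos.2 (by linarith)
  have hK0 : 0 < K := by positivity
  set F : ℕ → Ω → ENNReal := fun n ω => (B n).indicator 1 ω +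
    ∑' j : ℕ, ENNReal.ofReal (((2:ℝ) ^ (j+1)) ^ r) * (E n j).indicator 1 ω with hF
  have hFm : ∀ n, Measurable (F n) := by
    intro n
    refine ((measurable_one.indicator (hBm n))).add (Measurable.tsum ?_)
    intro j
    exact (measurable_one.indicator (hEm n j)).const_mul _
  have hpt : ∀ ω, ENNReal.ofReal ((τ (N ω) ω : ℝ) ^ r) ≤
      ENNReal.ofReal K * ∑' n, ENNReal.ofReal ((h ^ n)⁻¹) * F n ω := by
    intro ω
    rcases Nat.eq_zero_or_pos (N ω) with h0 | hpos
    · rw [h0, hτ0]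
      simp [Real.zero_rpow hr.ne']
    obtain ⟨m, hmN, hle⟩ := aux_sum (fun n => τ n ω) (hτ0 ω) (fun n => hτmono n ω) a ha0 ha1 _ hpos
    set X := τ (m+1) ω - τ m ω with hX
    have hXF : ENNReal.ofReal ((X : ℝ) ^ r) ≤ F m ω := by
      rcases Nat.lt_or_ge X 2 with h2 | h2
      · refine le_trans ?_ (le_add_right le_rfl)
        have : ω ∈ B m := hmN
        rw [Set.indicator_of_mem this]
        simp only [Pi.one_apply, ENNReal.ofReal_le_one]
        apply Real.rpow_le_one (by positivity) _ hr.le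
        exact_mod_cast (by omega : X ≤ 1)
      · obtain ⟨j, hj1, hj2⟩ := aux_dyadic X h2
        refine le_trans ?_ (le_add_left (ENNReal.le_tsum j))
        have : ω ∈ E m j := ⟨hj1, hmN⟩
        rw [Set.indicator_of_mem this]
        simp only [Pi.one_apply, mul_one]
        apply ENNReal.ofReal_le_ofReal
        apply Real.rpow_le_rpow (by positivity) _ hr.le
        exact_mod_cast hj2
    calc ENNReal.ofReal ((τ (N ω) ω : ℝ) ^ r)
        ≤ ENNReal.ofReal (((X : ℝ) * (a ^ m)⁻¹ * (1 - a)⁻¹) ^ r) := by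
          apply ENNReal.ofReal_le_ofReal
          exact Real.rpow_le_rpow (by positivity) hle hr.le
      _ = ENNReal.ofReal K * (ENNReal.ofReal ((h ^ m)⁻¹) * ENNReal.ofReal ((X : ℝ) ^ r)) := by
          rw [Real.mul_rpow (by positivity) ha1'.le, Real.mul_rpow (by positivity) (by positivity),
            hW, ← ENNReal.ofReal_mul (by positivity), ← ENNReal.ofReal_mul hK0.le]
          congr 1; ring
      _ ≤ ENNReal.ofReal K * (ENNReal.ofReal ((h ^ m)⁻¹) * F m ω) := by gcongr
      _ ≤ _ := by
          gcongr
          exact ENNReal.le_tsum (f := fun n => ENNReal.ofReal ((h ^ n)⁻¹) * F n ω) m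
  have hgn : ∀ n : ℕ, (g ^ n) ^ (1 - s) = (h ^ n) ^ 2 := by
    intro n
    rw [← pow_mul, mul_comm n 2, pow_mul, hh2, ← Real.rpow_natCast, ← Real.rpow_mul hg0.le,
      mul_comm, Real.rpow_mul hg0.le, Real.rpow_natCast]
  have hPB : ∀ n, ℙ (B n) ≤ ENNReal.ofReal ((h ^ n) ^ 2) := by
    intro n
    have := aux_interp (ℙ (B n)) 1 (g ^ n) s (by norm_num) (by positivity) hs0 hs1
      (by simpa using prob_le_one) (hNtail n)
    simpa [hgn] using this
  set d := (2:ℝ) ^ (-(p * s)) with hd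
  have hd0 : 0 < d := by positivity
  have hPE : ∀ n j, ℙ (E n j) ≤ ENNReal.ofReal (C' ^ s * d ^ j * (h ^ n) ^ 2) := by
    intro n j
    have := aux_interp (ℙ (E n j)) (C' * ((2:ℝ)^j) ^ (-p)) (g ^ n) s (by positivity)
      (by positivity) hs0 hs1
      (by simpa using hinc n (2 ^ j) Nat.one_le_two_pow)
      ((measure_mono (fun ω hω => hω.2)).trans (hNtail n))
    rw [hgn, Real.mul_rpow hC'.le (by positivity)] at this
    have e : (((2:ℝ)^j) ^ (-p)) ^ s = d ^ j := by
      rw [hd, ← Real.rpow_natCast, ← Real.rpow_natCast, ← Real.rpow_mul (by norm_num),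
        ← Real.rpow_mul (by norm_num), ← Real.rpow_mul (by norm_num)]
      congr 1; ring
    rwa [e] at this
  set q := (2:ℝ) ^ r * d with hq
  have hq0 : 0 < q := by positivity
  have hq1 : q < 1 := by
    rw [hq, hd, ← Real.rpow_add (by norm_num)]
    exact Real.rpow_lt_one_of_one_lt_of_neg (by norm_num) (by linarith)
  set S : ENNReal := 1 + ∑' j : ℕ, ENNReal.ofReal ((2:ℝ) ^ r * C' ^ s * q ^ j) with hS
  have hSt : S ≠ ⊤ := by
    refine ENNReal.add_ne_top.2 ⟨ENNReal.one_ne_top, ?_⟩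
    exact ((summable_geometric_of_lt_one hq0.le hq1).mul_left _).tsum_ofReal_ne_top
  have hIF : ∀ n, ∫⁻ ω, F n ω ∂ℙ ≤ ENNReal.ofReal ((h ^ n) ^ 2) * S := by
    intro n
    rw [hF]
    simp only
    rw [lintegral_add_left (measurable_one.indicator (hBm n)), lintegral_indicator_one (hBm n),
      lintegral_tsum (fun j => ((measurable_one.indicator (hEm n j)).const_mul _).aemeasurable),
      hS, mul_add, mul_one, ← ENNReal.tsum_mul_left]
    gcongr with j
    · exact hPB n
    · rw [lintegral_const_mul _ (measurable_one.indicator (hEm n j)),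
        lintegral_indicator_one (hEm n j)]
      refine (mul_le_mul_right (hPE n j) _).trans (le_of_eq ?_)
      rw [← ENNReal.ofReal_mul (by positivity), ← ENNReal.ofReal_mul (by positivity)]
      congr 1
      have : ((2:ℝ) ^ (j+1)) ^ r = 2 ^ r * (2 ^ r) ^ j := by
        rw [← pow_succ', ← Real.rpow_natCast, ← Real.rpow_natCast, ← Real.rpow_mul (by norm_num),
          ← Real.rpow_mul (by norm_num), mul_comm]
      rw [this, hq, mul_pow]
      ring
  refine ne_top_of_le_ne_top ?_ (lintegral_mono hpt)
  rw [lintegral_const_mul _ (Measurable.tsum fun n => (hFm n).const_mul _),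
    lintegral_tsum (fun n => ((hFm n).const_mul _).aemeasurable)]
  refine ENNReal.mul_ne_top ENNReal.ofReal_ne_top ?_
  have hle : ∑' n, ∫⁻ ω, ENNReal.ofReal ((h ^ n)⁻¹) * F n ω ∂ℙ ≤
      ∑' n, ENNReal.ofReal (h ^ n) * S := by
    refine ENNReal.tsum_le_tsum fun n => ?_
    rw [lintegral_const_mul _ (hFm n)]
    refine (mul_le_mul_right (hIF n) _).trans (le_of_eq ?_)
    rw [← mul_assoc, ← ENNReal.ofReal_mul (by positivity)]
    congr 2
    field_simp
  refine ne_top_of_le_ne_top ?_ hle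
  rw [ENNReal.tsum_mul_right]
  exact ENNReal.mul_ne_top (summable_geometric_of_lt_one hh0.le hh1).tsum_ofReal_ne_top hSt
end

section
/- Moments of the first simultaneous renewal time: let Y_0 and Y'_0 be independent ℕ-valued random variables, and let Y_1, Y_2, … and Y'_1, Y'_2, … be positive-integer-valued random variables, all independent of each other and of (Y_0, Y'_0), with a common distribution that is aperiodic, i.e. gcd{n ≥ 1 : P[Y_1 = n] > 0} = 1. Set S_n = Σ_{i=0}^n Y_i and S'_n = Σ_{i=0}^n Y'_i, and let T = inf{n ≥ 0 : S_{k₁} = S'_{k₂} = n for some k₁, k₂}. If for some β ≥ 1 one has E[Y_0^β] < ∞, E[(Y'_0)^β] < ∞ and E[Y_1^β] < ∞, then E[T^β] < ∞. -/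
open MeasureTheory

noncomputable section

/-- The first simultaneous renewal time of the two renewal processes
`S_n = ∑_{i≤n} Y_i` and `S'_n = ∑_{i≤n} Y'_i`, as an extended nonnegative real. -/
def firstSimultaneousRenewal {Ω : Type*} (Y Y' : ℕ → Ω → ℕ) (ω : Ω) : ENNReal :=
  sInf {t : ENNReal | ∃ n k₁ k₂ : ℕ, t = n ∧
    (∑ i ∈ Finset.range (k₁ + 1), Y i ω) = n ∧ (∑ i ∈ Finset.range (k₂ + 1), Y' i ω) = n}


lemma sr_exists_lists (D : Set ℕ) (haper : ∀ d : ℕ, (∀ n ∈ D, d ∣ n) → d = 1) (x : ℤ) :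
    ∃ l l' : List ℕ, (∀ n ∈ l, n ∈ D) ∧ (∀ n ∈ l', n ∈ D) ∧
      x + ((l'.sum : ℕ) : ℤ) = ((l.sum : ℕ) : ℤ) := by
  let H : AddSubgroup ℤ :=
    { carrier := {x | ∃ l l' : List ℕ, (∀ n ∈ l, n ∈ D) ∧ (∀ n ∈ l', n ∈ D) ∧
        x + ((l'.sum : ℕ) : ℤ) = ((l.sum : ℕ) : ℤ)}
      zero_mem' := ⟨[], [], by simp⟩
      add_mem' := by
        rintro a b ⟨l, l', h1, h2, h3⟩ ⟨m, m', g1, g2, g3⟩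
        refine ⟨l ++ m, l' ++ m', ?_, ?_, ?_⟩
        · intro n hn
          rcases List.mem_append.1 hn with h | h
          exacts [h1 n h, g1 n h]
        · intro n hn
          rcases List.mem_append.1 hn with h | h
          exacts [h2 n h, g2 n h]
        · simp only [List.sum_append, Nat.cast_add]
          omega
      neg_mem' := by
        rintro a ⟨l, l', h1, h2, h3⟩
        exact ⟨l', l, h2, h1, by omega⟩ }
  obtain ⟨g, hg⟩ := Int.subgroup_cyclic H
  have hD : ∀ n ∈ D, g.natAbs ∣ n := by
    intro n hn
    have : (n : ℤ) ∈ H := ⟨[n], [], by simpa using hn, by simp, by simp⟩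
    rw [hg, AddSubgroup.mem_closure_singleton] at this
    obtain ⟨k, hk⟩ := this
    have : g ∣ (n : ℤ) := ⟨k, by rw [← hk]; simp [mul_comm]⟩
    exact Int.natAbs_dvd_natAbs.2 this
  have h1 := haper _ hD
  have : x ∈ H := by
    rw [hg, AddSubgroup.mem_closure_singleton]
    rcases Int.natAbs_eq g with h | h
    · exact ⟨x, by rw [h, h1]; simp⟩
    · exact ⟨-x, by rw [h, h1]; simp⟩
  exact this

/-- Probability that the leapfrog walk started at `x` hits zero within `n` steps. -/
def srP (ν : Measure ℕ) : ℕ → ℤ → ℝ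
  | 0, x => if x = 0 then 1 else 0
  | n + 1, x => if x = 0 then 1 else ∫ y, srP ν n (x - x.sign * (y : ℤ)) ∂ν

lemma srP_zero (ν : Measure ℕ) (n : ℕ) : srP ν n 0 = 1 := by
  cases n <;> simp [srP]

lemma srP_succ (ν : Measure ℕ) (n : ℕ) (x : ℤ) (hx : x ≠ 0) :
    srP ν (n + 1) x = ∫ y, srP ν n (x - x.sign * (y : ℤ)) ∂ν := by
  simp [srP, hx]

lemma sr_int_bdd (ν : Measure ℕ) [IsProbabilityMeasure ν] (f : ℕ → ℝ) (C : ℝ)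
    (h : ∀ y, 0 ≤ f y ∧ f y ≤ C) : Integrable f ν := by
  refine Integrable.of_bound (C := C) (measurable_of_countable f).aestronglyMeasurable
    (Filter.Eventually.of_forall fun y => ?_)
  rw [Real.norm_of_nonneg (h y).1]
  exact (h y).2

lemma srP_bd (ν : Measure ℕ) [IsProbabilityMeasure ν] (n : ℕ) (x : ℤ) :
    0 ≤ srP ν n x ∧ srP ν n x ≤ 1 := by
  induction n generalizing x with
  | zero => by_cases h : x = 0 <;> simp [srP, h]
  | succ n ih =>
    by_cases h : x = 0
    · simp [srP, h]
    · rw [srP_succ ν n x h]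
      refine ⟨integral_nonneg fun y => (ih _).1, ?_⟩
      calc ∫ y, srP ν n (x - x.sign * (y : ℤ)) ∂ν ≤ ∫ y, (1 : ℝ) ∂ν :=
            integral_mono (sr_int_bdd ν _ 1 fun y => ih _) (integrable_const _) fun y => (ih _).2
        _ = 1 := by simp

lemma srP_int (ν : Measure ℕ) [IsProbabilityMeasure ν] (n : ℕ) (g : ℕ → ℤ) :
    Integrable (fun y => srP ν n (g y)) ν := sr_int_bdd ν _ 1 fun _ => srP_bd ν n _

lemma srP_mono (ν : Measure ℕ) [IsProbabilityMeasure ν] (n : ℕ) (x : ℤ) :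
    srP ν n x ≤ srP ν (n + 1) x := by
  induction n generalizing x with
  | zero =>
    by_cases h : x = 0
    · simp [srP, h]
    · have := (srP_bd ν 1 x).1
      simpa [srP, h] using this
  | succ n ih =>
    by_cases h : x = 0
    · simp [srP, h]
    · rw [srP_succ ν n x h, srP_succ ν (n+1) x h]
      exact integral_mono (srP_int ν n _) (srP_int ν _ _) fun y => ih _

lemma srP_pos (ν : Measure ℕ) [IsProbabilityMeasure ν] (N : ℕ) (l l' : List ℕ)
    (hN : l.length + l'.length = N)
    (hl : ∀ n ∈ l, ν {n} ≠ 0) (hl' : ∀ n ∈ l', ν {n} ≠ 0) (x : ℤ)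
    (hx : x + ((l'.sum : ℕ) : ℤ) = ((l.sum : ℕ) : ℤ)) : 0 < srP ν N x := by
  induction N generalizing x l l' with
  | zero =>
    have h1 : l = [] := List.length_eq_zero_iff.1 (by omega)
    have h2 : l' = [] := List.length_eq_zero_iff.1 (by omega)
    subst h1 h2
    simp at hx
    simp [hx, srP]
  | succ N ih =>
    have key : ∀ d, ν {d} ≠ 0 → x ≠ 0 → 0 < srP ν N (x - x.sign * (d : ℤ)) →
        0 < srP ν (N + 1) x := by
      intro d hd hx0 hp
      rw [srP_succ ν N x hx0]
      rw [integral_pos_iff_support_of_nonneg (fun y => (srP_bd ν N _).1) (srP_int ν N _)]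
      refine lt_of_lt_of_le (pos_iff_ne_zero.2 hd) (measure_mono ?_)
      intro y hy
      rw [Set.mem_singleton_iff] at hy
      subst hy
      exact hp.ne'
    rcases lt_trichotomy x 0 with h | h | h
    · cases l' with
      | nil => simp only [List.sum_nil, Nat.cast_zero, add_zero] at hx; omega
      | cons d t =>
        refine key d (hl' d (by simp)) h.ne ?_
        refine ih l t ?_ hl (fun n hn => hl' n (by simp [hn])) _ ?_
        · simp at hN; omega
        · rw [Int.sign_eq_neg_one_of_neg h]
          simp only [List.sum_cons, Nat.cast_add] at hx
          linarith
    · subst h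
      simp [srP_zero]
    · cases l with
      | nil => simp only [List.sum_nil, Nat.cast_zero, add_zero] at hx; omega
      | cons d t =>
        refine key d (hl d (by simp)) h.ne' ?_
        refine ih t l' ?_ (fun n hn => hl n (by simp [hn])) hl' _ ?_
        · simp at hN; omega
        · rw [Int.sign_eq_one_of_pos h]
          simp only [List.sum_cons, Nat.cast_add] at hx
          linarith

lemma sr_over (ν : Measure ℕ) [IsProbabilityMeasure ν]
    (hint : Integrable (fun y : ℕ => (y : ℝ)) ν) :
    ∃ t₀ : ℕ, ∀ t : ℝ, (t₀ : ℝ) ≤ t → ∫ y : ℕ, max ((y : ℝ) - t) 0 ∂ν ≤ 1 / 4 := by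
  have h : Filter.Tendsto (fun t : ℝ => ∫ y : ℕ, max ((y : ℝ) - t) 0 ∂ν) Filter.atTop
      (nhds (∫ y : ℕ, (0 : ℝ) ∂ν)) := by
    refine tendsto_integral_filter_of_dominated_convergence (fun y : ℕ => (y : ℝ)) ?_ ?_ hint ?_
    · exact Filter.Eventually.of_forall fun t =>
        (measurable_of_countable _).aestronglyMeasurable
    · filter_upwards [Filter.eventually_ge_atTop (0 : ℝ)] with t ht
      refine Filter.Eventually.of_forall fun y => ?_
      rw [Real.norm_of_nonneg (le_max_right _ _)]
      exact max_le (by linarith) (Nat.cast_nonneg y)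
    · refine Filter.Eventually.of_forall fun y => ?_
      refine tendsto_const_nhds.congr' ?_
      filter_upwards [Filter.eventually_ge_atTop (y : ℝ)] with t ht
      exact (max_eq_right (by linarith)).symm
  rw [integral_zero] at h
  have h2 := h.eventually_le_const (show (0 : ℝ) < 1 / 4 by norm_num)
  obtain ⟨a, ha⟩ := Filter.eventually_atTop.1 h2
  exact ⟨⌈a⌉₊, fun t ht => ha t ((Nat.le_ceil a).trans ht)⟩

lemma sr_abs_step (x : ℤ) (hx : x ≠ 0) (y : ℕ) :
    |((x - x.sign * (y : ℤ) : ℤ) : ℝ)| = |(x : ℝ)| - y + 2 * max ((y : ℝ) - |(x : ℝ)|) 0 := by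
  have h : |((x - x.sign * (y : ℤ) : ℤ) : ℝ)| = |(|(x : ℝ)| - y)| := by
    rcases lt_or_gt_of_ne hx with h | h
    · have h' : (x : ℝ) < 0 := by exact_mod_cast h
      rw [Int.sign_eq_neg_one_of_neg h, abs_of_neg h', ← abs_neg]
      congr 1
      push_cast
      ring
    · have h' : (0 : ℝ) < x := by exact_mod_cast h
      rw [Int.sign_eq_one_of_pos h, abs_of_pos h']
      congr 1
      push_cast
      ring
  rw [h]
  rcases le_total (y : ℝ) |(x : ℝ)| with h | h
  · rw [abs_of_nonneg (by linarith), max_eq_right (by linarith)]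
    ring
  · rw [abs_of_nonpos (by linarith), max_eq_left (by linarith)]
    ring

lemma sr_max_int (ν : Measure ℕ) [IsProbabilityMeasure ν]
    (hint : Integrable (fun y : ℕ => (y : ℝ)) ν) (t : ℝ) (ht : 0 ≤ t) :
    Integrable (fun y : ℕ => max ((y : ℝ) - t) 0) ν := by
  refine hint.mono' (measurable_of_countable _).aestronglyMeasurable
    (Filter.Eventually.of_forall fun y => ?_)
  rw [Real.norm_of_nonneg (le_max_right _ _)]
  exact max_le (by linarith) (Nat.cast_nonneg y)

lemma sr_phi (ν : Measure ℕ) [IsProbabilityMeasure ν]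
    (hint : Integrable (fun y : ℕ => (y : ℝ)) ν) (h0 : ∀ᵐ y ∂ν, 1 ≤ y)
    (haper : ∀ d : ℕ, (∀ n : ℕ, ν {n} ≠ 0 → d ∣ n) → d = 1) :
    ∃ (φ : ℤ → ℝ) (C : ℝ), 0 ≤ C ∧ (∀ x, 0 ≤ φ x) ∧
      (∀ x x', |φ x - φ x'| ≤ C * (1 + |((x - x' : ℤ) : ℝ)|)) ∧
      ∀ x : ℤ, x ≠ 0 → Integrable (fun y : ℕ => φ (x - x.sign * (y : ℤ))) ν ∧
        ∫ y : ℕ, φ (x - x.sign * (y : ℤ)) ∂ν ≤ φ x - (∫ y : ℕ, (y : ℝ) ∂ν + 1) := by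
  obtain ⟨t₀, ht₀⟩ := sr_over ν hint
  set m : ℝ := ∫ y : ℕ, (y : ℝ) ∂ν with hm
  have hm1 : 1 ≤ m := by
    calc (1 : ℝ) = ∫ y : ℕ, (1 : ℝ) ∂ν := by simp
      _ ≤ m := integral_mono_ae (integrable_const _) hint
        (by filter_upwards [h0] with y hy; exact_mod_cast hy)
  have hex : ∀ x : ℤ, ∃ n, 0 < srP ν n x := by
    intro x
    obtain ⟨l, l', h1, h2, h3⟩ := sr_exists_lists {n | ν {n} ≠ 0} haper x
    exact ⟨_, srP_pos ν _ l l' rfl h1 h2 x h3⟩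
  choose n hn using hex
  set K : Finset ℤ := Finset.Icc (-(t₀ : ℤ)) t₀ with hK
  set N := K.sup n with hN
  have hNpos : ∀ x ∈ K, 0 < srP ν N x := fun x hx =>
    (hn x).trans_le (monotone_nat_of_le_succ (f := fun n => srP ν n x)
      (fun k => srP_mono ν k x) (Finset.le_sup hx))
  set B : ℝ := ∑ x ∈ K, (2 * m + 1) / srP ν N x with hB
  have hterm : ∀ x ∈ K, 0 ≤ (2 * m + 1) / srP ν N x := fun x hx =>
    div_nonneg (by linarith) (hNpos x hx).le
  have hB0 : 0 ≤ B := Finset.sum_nonneg hterm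
  have hBK : ∀ x ∈ K, 2 * m + 1 ≤ B * srP ν N x := by
    intro x hx
    have : (2 * m + 1) / srP ν N x ≤ B := Finset.single_le_sum hterm hx
    rwa [div_le_iff₀ (hNpos x hx)] at this
  set r : ℤ → ℝ := fun x => ∑ k ∈ Finset.range N, srP ν k x with hr
  have hr0 : ∀ x, 0 ≤ r x := fun x => Finset.sum_nonneg fun k _ => (srP_bd ν k x).1
  have hrN : ∀ x, r x ≤ N := fun x => by
    calc r x ≤ ∑ k ∈ Finset.range N, (1 : ℝ) := Finset.sum_le_sum fun k _ => (srP_bd ν k x).2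
      _ = N := by simp
  have hrint : ∀ g : ℕ → ℤ, Integrable (fun y => r (g y)) ν := fun g =>
    sr_int_bdd ν _ N fun y => ⟨hr0 _, hrN _⟩
  have hrstep : ∀ x : ℤ, x ≠ 0 → ∫ y : ℕ, r (x - x.sign * (y : ℤ)) ∂ν = r x + srP ν N x := by
    intro x hx
    simp only [hr]
    rw [integral_finsetSum _ fun k _ => srP_int ν k _]
    rw [← Finset.sum_range_succ (fun k => srP ν k x) N, Finset.sum_range_succ']
    have : srP ν 0 x = 0 := by simp [srP, hx]
    rw [this, add_zero]
    exact Finset.sum_congr rfl fun k _ => (srP_succ ν k x hx).symm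
  have hA : 0 ≤ 2 * (m + 1) := by linarith
  have habs : ∀ x : ℤ, x ≠ 0 →
      Integrable (fun y : ℕ => |((x - x.sign * (y : ℤ) : ℤ) : ℝ)|) ν ∧
      ∫ y : ℕ, |((x - x.sign * (y : ℤ) : ℤ) : ℝ)| ∂ν =
        |(x : ℝ)| - m + 2 * ∫ y : ℕ, max ((y : ℝ) - |(x : ℝ)|) 0 ∂ν := by
    intro x hx
    simp only [sr_abs_step x hx]
    have i1 := sr_max_int ν hint |(x : ℝ)| (abs_nonneg _)
    have i2 : Integrable (fun y : ℕ => |(x : ℝ)| - (y : ℝ)) ν := (integrable_const _).sub hint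
    refine ⟨i2.add (i1.const_mul 2), ?_⟩
    rw [integral_add i2 (i1.const_mul 2), integral_sub (integrable_const _) hint,
      integral_const_mul]
    simp [hm]
  refine ⟨fun x => 2 * (m + 1) * (|(x : ℝ)| + B * (N - r x)), 2 * (m + 1) * (1 + B * N), ?_, ?_,
    ?_, ?_⟩
  · positivity
  · intro x
    have := hrN x
    exact mul_nonneg hA (add_nonneg (abs_nonneg _) (mul_nonneg hB0 (by linarith)))
  · intro x x'
    have e : 2 * (m + 1) * (|(x : ℝ)| + B * (N - r x)) - 2 * (m + 1) * (|(x' : ℝ)| + B * (N - r x'))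
      = 2 * (m + 1) * ((|(x : ℝ)| - |(x' : ℝ)|) + B * (r x' - r x)) := by ring
    rw [e, abs_mul, abs_of_nonneg hA, mul_assoc (2 * (m + 1)) (1 + B * (N : ℝ))]
    refine mul_le_mul_of_nonneg_left ?_ hA
    have h1 : |(|(x : ℝ)| - |(x' : ℝ)|)| ≤ |((x - x' : ℤ) : ℝ)| := by
      push_cast
      exact abs_abs_sub_abs_le _ _
    have h2 : |r x' - r x| ≤ N := by
      rw [abs_le]
      constructor <;> linarith [hr0 x, hr0 x', hrN x, hrN x']
    have h3 : |B * (r x' - r x)| ≤ B * N := by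
      rw [abs_mul, abs_of_nonneg hB0]
      exact mul_le_mul_of_nonneg_left h2 hB0
    have h4 : 0 ≤ B * N := by positivity
    have h5 := abs_nonneg ((x - x' : ℤ) : ℝ)
    have h6 := mul_nonneg h4 h5
    calc _ ≤ |(|(x : ℝ)| - |(x' : ℝ)|)| + |B * (r x' - r x)| := abs_add_le _ _
      _ ≤ (1 + B * N) * (1 + |((x - x' : ℤ) : ℝ)|) := by nlinarith
  · intro x hx
    obtain ⟨i1, e1⟩ := habs x hx
    have i2 : Integrable (fun y : ℕ => B * (N - r (x - x.sign * (y : ℤ)))) ν :=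
      ((integrable_const _).sub (hrint _)).const_mul B
    refine ⟨(i1.add i2).const_mul _, ?_⟩
    rw [integral_const_mul, integral_add i1 i2, integral_const_mul,
      integral_sub (integrable_const _) (hrint _), hrstep x hx, e1]
    simp only [integral_const, probReal_univ, one_smul]
    have key : |(x : ℝ)| - m + 2 * ∫ y : ℕ, max ((y : ℝ) - |(x : ℝ)|) 0 ∂ν +
        B * (N - (r x + srP ν N x)) ≤ |(x : ℝ)| + B * (N - r x) - 1 / 2 := by
      by_cases hxK : x ∈ K
      · have h1 := hBK x hxK
        have h2 : ∫ y : ℕ, max ((y : ℝ) - |(x : ℝ)|) 0 ∂ν ≤ m :=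
          integral_mono (sr_max_int ν hint _ (abs_nonneg _)) hint fun y =>
            max_le (by linarith [abs_nonneg (x : ℝ)]) (Nat.cast_nonneg y)
        linarith
      · have h1 : (t₀ : ℝ) ≤ |(x : ℝ)| := by
          have : (t₀ : ℤ) ≤ |x| := by
            by_contra hc
            push Not at hc
            exact hxK (Finset.mem_Icc.2 (abs_le.1 hc.le))
          exact_mod_cast this
        have h2 := ht₀ _ h1
        have h3 := mul_nonneg hB0 (srP_bd ν N x).1
        linarith
    have := mul_le_mul_of_nonneg_left key hA
    linarith

def srK (β t : ℝ) : ℝ := (1 + t) ^ (β - 1) - (max (1 - t) 0) ^ (β - 1)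

lemma sr_tangent (β : ℝ) (hβ : 1 ≤ β) (z : ℝ) (hz : 0 ≤ 1 + z) :
    (1 + z) ^ β ≤ 1 + β * (z * (1 + z) ^ (β - 1)) := by
  rcases hz.eq_or_lt with h | h
  · rw [← h, Real.zero_rpow (by linarith)]
    have hz' : z = -1 := by linarith
    rcases hβ.eq_or_lt with hb | hb
    · subst hb; simp [hz']
    · rw [Real.zero_rpow (by linarith)]; simp
  · have hb := one_add_mul_self_le_rpow_one_add (s := (1 + z)⁻¹ - 1) (p := β)
      (by have := inv_pos.2 h; linarith) hβ
    have e : 1 + ((1 + z)⁻¹ - 1) = (1 + z)⁻¹ := by ring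
    rw [e, Real.inv_rpow h.le] at hb
    have hu : 0 < (1 + z) ^ β := Real.rpow_pos_of_pos h _
    have h2 := mul_le_mul_of_nonneg_left hb hu.le
    rw [mul_inv_cancel₀ hu.ne'] at h2
    have e2 : (1 + z) ^ (β - 1) = (1 + z) ^ β * (1 + z)⁻¹ := by
      rw [Real.rpow_sub_one h.ne', div_eq_mul_inv]
    rw [e2]
    have e3 : (1 + z) ^ β * (1 + β * ((1 + z)⁻¹ - 1)) =
      (1 + z) ^ β - β * (z * ((1 + z) ^ β * (1 + z)⁻¹)) := by
      field_simp
      ring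
    linarith

lemma sr_pointwise (β : ℝ) (hβ : 1 ≤ β) (z t : ℝ) (hz : 0 ≤ 1 + z) (ht : |z| ≤ t) :
    (1 + z) ^ β ≤ 1 + β * (z + t * srK β t) := by
  have ht0 : 0 ≤ t := (abs_nonneg z).trans ht
  refine (sr_tangent β hβ z hz).trans ?_
  obtain ⟨h1, h2⟩ := abs_le.1 ht
  have hb : 0 ≤ β - 1 := by linarith
  have a1 : (1 + z) ^ (β - 1) ≤ (1 + t) ^ (β - 1) := Real.rpow_le_rpow hz (by linarith) hb
  have a2 : (max (1 - t) 0) ^ (β - 1) ≤ (1 + z) ^ (β - 1) :=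
    Real.rpow_le_rpow (le_max_right _ _) (max_le (by linarith) hz) hb
  have a3 : 1 ≤ (1 + t) ^ (β - 1) := Real.one_le_rpow (by linarith) hb
  have a4 : (max (1 - t) 0) ^ (β - 1) ≤ 1 :=
    Real.rpow_le_one (le_max_right _ _) (max_le (by linarith) (by norm_num)) hb
  have h3 : |(1 + z) ^ (β - 1) - 1| ≤ srK β t := by
    unfold srK
    rw [abs_le]
    constructor <;> linarith
  have h4 : z * ((1 + z) ^ (β - 1) - 1) ≤ t * srK β t := by
    calc _ ≤ |z * ((1 + z) ^ (β - 1) - 1)| := le_abs_self _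
      _ = |z| * |(1 + z) ^ (β - 1) - 1| := abs_mul _ _
      _ ≤ t * srK β t := mul_le_mul ht h3 (abs_nonneg _) ht0
  have h5 : z * (1 + z) ^ (β - 1) ≤ z + t * srK β t := by linarith
  have := mul_le_mul_of_nonneg_left h5 (show 0 ≤ β by linarith)
  linarith

lemma srK_bd (β : ℝ) (hβ : 1 ≤ β) (t : ℝ) (ht : 0 ≤ t) :
    0 ≤ srK β t ∧ srK β t ≤ (1 + t) ^ (β - 1) := by
  have hb : 0 ≤ β - 1 := by linarith
  have a2 : (max (1 - t) 0) ^ (β - 1) ≤ (1 + t) ^ (β - 1) :=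
    Real.rpow_le_rpow (le_max_right _ _) (max_le (by linarith) (by linarith)) hb
  have a3 : 0 ≤ (max (1 - t) 0) ^ (β - 1) := Real.rpow_nonneg (le_max_right _ _) _
  unfold srK
  constructor <;> linarith

lemma srK_tendsto (β : ℝ) (hβ : 1 ≤ β) :
    Filter.Tendsto (srK β) (nhds 0) (nhds 0) := by
  have hb : 0 ≤ β - 1 := by linarith
  have : Continuous (srK β) := by
    unfold srK
    refine Continuous.sub ?_ ?_
    · exact Continuous.rpow_const (by fun_prop) fun _ => Or.inr hb
    · exact Continuous.rpow_const (by fun_prop) fun _ => Or.inr hb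
  have h := this.tendsto 0
  simpa [srK] using h

lemma sr_dom_int (ν : Measure ℕ) (β : ℝ) (hβ : 1 ≤ β) (h0 : ∀ᵐ y ∂ν, 1 ≤ y)
    (hint : Integrable (fun y : ℕ => (y : ℝ) ^ β) ν) (C : ℝ) (hC : 0 ≤ C) :
    Integrable (fun y : ℕ => (1 + C * (y : ℝ)) ^ β) ν := by
  refine (hint.const_mul ((1 + C) ^ β)).mono' (measurable_of_countable _).aestronglyMeasurable ?_
  filter_upwards [h0] with y hy
  have hy' : (1 : ℝ) ≤ y := by exact_mod_cast hy
  rw [Real.norm_of_nonneg (by positivity), ← Real.mul_rpow (by linarith) (by linarith)]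
  exact Real.rpow_le_rpow (by positivity) (by nlinarith) (by linarith)

lemma sr_err_bd (β : ℝ) (hβ : 1 ≤ β) (C : ℝ) (hC : 0 ≤ C) (y : ℕ) (W : ℝ) (hW : 1 ≤ W) :
    0 ≤ C * y * srK β (C * y / W) ∧ C * y * srK β (C * y / W) ≤ (1 + C * (y : ℝ)) ^ β := by
  have hCy : 0 ≤ C * (y : ℝ) := by positivity
  have ht : 0 ≤ C * (y : ℝ) / W := by positivity
  have ht' : C * (y : ℝ) / W ≤ C * y := div_le_self hCy hW
  obtain ⟨h1, h2⟩ := srK_bd β hβ _ ht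
  refine ⟨mul_nonneg hCy h1, ?_⟩
  have h3 : (1 + C * (y : ℝ) / W) ^ (β - 1) ≤ (1 + C * (y : ℝ)) ^ (β - 1) :=
    Real.rpow_le_rpow (by linarith) (by linarith) (by linarith)
  have e : (1 + C * (y : ℝ)) ^ β = (1 + C * (y : ℝ)) * (1 + C * (y : ℝ)) ^ (β - 1) := by
    rw [Real.rpow_sub_one (by linarith)]
    field_simp
  rw [e]
  exact mul_le_mul (by linarith) (h2.trans h3) h1 (by linarith)

lemma sr_power (ν : Measure ℕ) [IsProbabilityMeasure ν] (β : ℝ) (hβ : 1 ≤ β)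
    (h0 : ∀ᵐ y ∂ν, 1 ≤ y)
    (hint : Integrable (fun y : ℕ => (y : ℝ) ^ β) ν) (C : ℝ) (hC : 0 ≤ C) :
    ∃ R : ℝ, 1 ≤ R ∧ ∀ W : ℝ, R ≤ W → ∀ Δ : ℕ → ℝ, (∀ᵐ y ∂ν, |Δ y| ≤ C * y) →
      (∀ y, 0 ≤ W + Δ y) → Integrable Δ ν → ∫ y, Δ y ∂ν ≤ -1 →
      ∫⁻ y, ENNReal.ofReal ((W + Δ y) ^ β) ∂ν ≤ ENNReal.ofReal (W ^ β) := by
  have hdom := sr_dom_int ν β hβ h0 hint C hC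
  have herr : ∀ W : ℝ, 1 ≤ W → Integrable (fun y : ℕ => C * y * srK β (C * y / W)) ν := by
    intro W hW
    refine hdom.mono' (measurable_of_countable _).aestronglyMeasurable
      (Filter.Eventually.of_forall fun y => ?_)
    obtain ⟨h1, h2⟩ := sr_err_bd β hβ C hC y W hW
    rwa [Real.norm_of_nonneg h1]
  have h : Filter.Tendsto (fun W : ℝ => ∫ y : ℕ, C * y * srK β (C * y / W) ∂ν) Filter.atTop
      (nhds (∫ y : ℕ, (0 : ℝ) ∂ν)) := by
    refine tendsto_integral_filter_of_dominated_convergence _ ?_ ?_ hdom ?_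
    · exact Filter.Eventually.of_forall fun t =>
        (measurable_of_countable _).aestronglyMeasurable
    · filter_upwards [Filter.eventually_ge_atTop (1 : ℝ)] with W hW
      refine Filter.Eventually.of_forall fun y => ?_
      obtain ⟨h1, h2⟩ := sr_err_bd β hβ C hC y W hW
      rwa [Real.norm_of_nonneg h1]
    · refine Filter.Eventually.of_forall fun y => ?_
      have h1 : Filter.Tendsto (fun W : ℝ => C * (y : ℝ) / W) Filter.atTop (nhds 0) :=
        tendsto_const_nhds.div_atTop Filter.tendsto_id
      simpa using ((srK_tendsto β hβ).comp h1).const_mul (C * (y : ℝ))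
  rw [integral_zero] at h
  obtain ⟨a, ha⟩ := Filter.eventually_atTop.1 (h.eventually_le_const (show (0 : ℝ) < 1 by norm_num))
  refine ⟨max a 1, le_max_right _ _, ?_⟩
  intro W hW Δ hΔ hpos hΔint hneg
  have hW1 : 1 ≤ W := (le_max_right _ _).trans hW
  have hW0 : 0 < W := by linarith
  have hsmall := ha W ((le_max_left _ _).trans hW)
  have hi := herr W hW1
  set E : ℕ → ℝ := fun y => C * y * srK β (C * y / W) with hE
  have hpt : ∀ᵐ y ∂ν, (W + Δ y) ^ β ≤ W ^ β * (1 + β * ((Δ y + E y) / W)) := by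
    filter_upwards [hΔ] with y hy
    have e : W + Δ y = W * (1 + Δ y / W) := by field_simp
    have hz : 0 ≤ 1 + Δ y / W := by
      have := hpos y
      rw [e] at this
      exact nonneg_of_mul_nonneg_right this hW0
    rw [e, Real.mul_rpow hW0.le hz]
    refine mul_le_mul_of_nonneg_left ?_ (Real.rpow_nonneg hW0.le _)
    have := sr_pointwise β hβ (Δ y / W) (C * y / W) hz
      (by rw [abs_div, abs_of_pos hW0]; exact div_le_div_of_nonneg_right hy hW0.le)
    refine this.trans (le_of_eq ?_)
    simp only [hE]
    ring
  have hI : Integrable (fun y => W ^ β * (1 + β * ((Δ y + E y) / W))) ν :=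
    ((integrable_const _).add (((hΔint.add hi).div_const W).const_mul β)).const_mul _
  have hI' : Integrable (fun y => β * ((Δ y + E y) / W)) ν :=
    ((hΔint.add hi).div_const W).const_mul β
  have hnn : 0 ≤ᵐ[ν] fun y => W ^ β * (1 + β * ((Δ y + E y) / W)) := by
    filter_upwards [hpt] with y hy
    exact (Real.rpow_nonneg (hpos y) _).trans hy
  calc ∫⁻ y, ENNReal.ofReal ((W + Δ y) ^ β) ∂ν
      ≤ ∫⁻ y, ENNReal.ofReal (W ^ β * (1 + β * ((Δ y + E y) / W))) ∂ν :=
        lintegral_mono_ae (by filter_upwards [hpt] with y hy; exact ENNReal.ofReal_le_ofReal hy)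
    _ = ENNReal.ofReal (∫ y, W ^ β * (1 + β * ((Δ y + E y) / W)) ∂ν) :=
        (ofReal_integral_eq_lintegral_ofReal hI hnn).symm
    _ ≤ ENNReal.ofReal (W ^ β) := by
        refine ENNReal.ofReal_le_ofReal ?_
        rw [integral_const_mul, integral_add (integrable_const _) hI', integral_const_mul,
          integral_div, integral_add hΔint hi]
        simp only [integral_const, probReal_univ, one_smul]
        have h1 : (∫ y, Δ y ∂ν + ∫ y, E y ∂ν) / W ≤ 0 :=
          div_nonpos_of_nonpos_of_nonneg (by linarith) hW0.le
        have h2 : β * ((∫ y, Δ y ∂ν + ∫ y, E y ∂ν) / W) ≤ 0 :=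
          mul_nonpos_of_nonneg_of_nonpos (by linarith) h1
        have h3 := mul_nonneg (Real.rpow_nonneg hW0.le β) (neg_nonneg.2 h2)
        linarith

lemma sr_lyap (ν : Measure ℕ) [IsProbabilityMeasure ν] (β : ℝ) (hβ : 1 ≤ β)
    (h0 : ∀ᵐ y ∂ν, 1 ≤ y)
    (hint : Integrable (fun y : ℕ => (y : ℝ) ^ β) ν)
    (haper : ∀ d : ℕ, (∀ n : ℕ, ν {n} ≠ 0 → d ∣ n) → d = 1) :
    ∃ (H : ℕ → ℕ → ENNReal) (Q : ENNReal), Q ≠ ⊤ ∧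
      (∀ s s' : ℕ, ((s : ENNReal) + s') ^ β ≤ H s s') ∧
      (∀ s s' : ℕ, H s s' ≤ Q * (1 + ((s : ENNReal) + s')) ^ β) ∧
      (∀ s s' : ℕ, s < s' → ∫⁻ y, H (s + y) s' ∂ν ≤ H s s') ∧
      (∀ s s' : ℕ, s' < s → ∫⁻ y, H s (s' + y) ∂ν ≤ H s s') := by
  have hβ0 : 0 ≤ β := by linarith
  have hint1 : Integrable (fun y : ℕ => (y : ℝ)) ν := by
    refine hint.mono' (measurable_of_countable _).aestronglyMeasurable ?_
    filter_upwards [h0] with y hy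
    have hy' : (1 : ℝ) ≤ y := by exact_mod_cast hy
    rw [Real.norm_of_nonneg (by linarith)]
    exact Real.self_le_rpow_of_one_le hy' hβ
  obtain ⟨φ, C, hC, hφ0, hφL, hφd⟩ := sr_phi ν hint1 h0 haper
  obtain ⟨R, hR1, hR⟩ := sr_power ν β hβ h0 hint (1 + 2 * C) (by linarith)
  set W : ℕ → ℕ → ℝ := fun s s' => R + s + s' + φ ((s' : ℤ) - s) with hW
  have hWR : ∀ s s', R ≤ W s s' := fun s s' => by
    have := hφ0 ((s' : ℤ) - s)
    simp only [hW]
    have h1 : (0 : ℝ) ≤ s := Nat.cast_nonneg s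
    have h2 : (0 : ℝ) ≤ s' := Nat.cast_nonneg s'
    linarith
  have hstep : ∀ s s' : ℕ, ∀ x : ℤ, x = (s' : ℤ) - s → x ≠ 0 →
      ∀ G : ℕ → ℝ, (∀ y : ℕ, G y = R + s + s' + y + φ (x - x.sign * (y : ℤ))) →
      ∫⁻ y, ENNReal.ofReal (G y ^ β) ∂ν ≤ ENNReal.ofReal (W s s' ^ β) := by
    intro s s' x hx hx0 G hG
    obtain ⟨i1, e1⟩ := hφd x hx0
    have hGe : ∀ y : ℕ, G y = W s s' + ((y : ℝ) + φ (x - x.sign * (y : ℤ)) - φ x) := by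
      intro y
      rw [hG]
      simp only [hW, hx]
      ring
    simp only [hGe]
    refine hR (W s s') (hWR s s') _ ?_ ?_ ?_ ?_
    · filter_upwards [h0] with y hy
      have hy' : (1 : ℝ) ≤ y := by exact_mod_cast hy
      have h1 := hφL (x - x.sign * (y : ℤ)) x
      have h2 : |((x - x.sign * (y : ℤ) - x : ℤ) : ℝ)| ≤ y := by
        rcases lt_or_gt_of_ne hx0 with h | h
        · rw [Int.sign_eq_neg_one_of_neg h]
          simp
        · rw [Int.sign_eq_one_of_pos h]
          simp
      have h3 : |φ (x - x.sign * (y : ℤ)) - φ x| ≤ C * (1 + y) :=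
        h1.trans (mul_le_mul_of_nonneg_left (by linarith) hC)
      calc _ = |(y : ℝ) + (φ (x - x.sign * (y : ℤ)) - φ x)| := by congr 1; ring
        _ ≤ |(y : ℝ)| + |φ (x - x.sign * (y : ℤ)) - φ x| := abs_add_le _ _
        _ ≤ y + C * (1 + y) := by rw [abs_of_nonneg (by linarith : (0 : ℝ) ≤ y)]; linarith
        _ ≤ (1 + 2 * C) * y := by nlinarith
    · intro y
      rw [← hGe, hG]
      have := hφ0 (x - x.sign * (y : ℤ))
      have h1 : (0 : ℝ) ≤ s := Nat.cast_nonneg s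
      have h2 : (0 : ℝ) ≤ s' := Nat.cast_nonneg s'
      have h3 : (0 : ℝ) ≤ y := Nat.cast_nonneg y
      linarith
    · exact (hint1.add i1).sub (integrable_const _)
    · have e : ∫ y : ℕ, ((y : ℝ) + φ (x - x.sign * (y : ℤ)) - φ x) ∂ν =
          ∫ y : ℕ, (y : ℝ) ∂ν + ∫ y : ℕ, φ (x - x.sign * (y : ℤ)) ∂ν - φ x := by
        have i3 : Integrable (fun y : ℕ => (y : ℝ) + φ (x - x.sign * (y : ℤ))) ν := hint1.add i1
        rw [integral_sub i3 (integrable_const _)]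
        rw [integral_add hint1 i1]
        simp
      rw [e]
      linarith
  refine ⟨fun s s' => ENNReal.ofReal (W s s' ^ β),
    ENNReal.ofReal ((R + φ 0 + C + 1) ^ β), ENNReal.ofReal_ne_top, ?_, ?_, ?_, ?_⟩
  · intro s s'
    have e : ((s : ENNReal) + s') ^ β = ENNReal.ofReal (((s : ℝ) + s') ^ β) := by
      rw [← ENNReal.ofReal_rpow_of_nonneg (by positivity) hβ0,
        ENNReal.ofReal_add (by positivity) (by positivity), ENNReal.ofReal_natCast,
        ENNReal.ofReal_natCast]
    rw [e]
    refine ENNReal.ofReal_le_ofReal (Real.rpow_le_rpow (by positivity) ?_ hβ0)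
    have := hφ0 ((s' : ℤ) - s)
    simp only [hW]
    linarith
  · intro s s'
    have e : (1 + ((s : ENNReal) + s')) ^ β = ENNReal.ofReal ((1 + ((s : ℝ) + s')) ^ β) := by
      rw [← ENNReal.ofReal_rpow_of_nonneg (by positivity) hβ0,
        ENNReal.ofReal_add (by positivity) (by positivity),
        ENNReal.ofReal_add (by positivity) (by positivity), ENNReal.ofReal_natCast,
        ENNReal.ofReal_natCast, ENNReal.ofReal_one]
    have hφ00 := hφ0 0
    rw [e, ← ENNReal.ofReal_mul (Real.rpow_nonneg (by linarith) _),
      ← Real.mul_rpow (by linarith) (by positivity)]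
    refine ENNReal.ofReal_le_ofReal (Real.rpow_le_rpow (by linarith [hWR s s']) ?_ hβ0)
    have h1 := (abs_le.1 (hφL ((s' : ℤ) - s) 0)).2
    have h2 : |((((s' : ℤ) - s) - 0 : ℤ) : ℝ)| ≤ s + s' := by
      push_cast
      have h1 : (0 : ℝ) ≤ s := Nat.cast_nonneg s
      have h2 : (0 : ℝ) ≤ s' := Nat.cast_nonneg s'
      rw [abs_le]
      constructor <;> linarith
    have h3 := mul_le_mul_of_nonneg_left h2 hC
    simp only [hW]
    have h4 : (0 : ℝ) ≤ (s : ℝ) + s' := by positivity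
    have h5 := mul_nonneg (show 0 ≤ R + φ 0 by linarith) h4
    nlinarith
  · intro s s' h
    refine hstep s s' ((s' : ℤ) - s) rfl (by omega) (fun y => W (s + y) s') ?_
    intro y
    rw [Int.sign_eq_one_of_pos (by omega)]
    simp only [hW]
    push_cast
    rw [show (s' : ℤ) - (s + y) = s' - s - 1 * y by ring]
    ring
  · intro s s' h
    refine hstep s s' ((s' : ℤ) - s) rfl (by omega) (fun y => W s (s' + y)) ?_
    intro y
    rw [Int.sign_eq_neg_one_of_neg (by omega)]
    simp only [hW]
    push_cast
    rw [show (s' : ℤ) + y - s = s' - s - -1 * y by ring]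
    ring

def srS (y : ℕ → ℕ) (k : ℕ) : ℕ := ∑ i ∈ Finset.range (k + 1), y i

def srIdx (y y' : ℕ → ℕ) : ℕ → ℕ × ℕ
  | 0 => (0, 0)
  | n + 1 =>
    if srS y (srIdx y y' n).1 < srS y' (srIdx y y' n).2 then
      ((srIdx y y' n).1 + 1, (srIdx y y' n).2)
    else if srS y' (srIdx y y' n).2 < srS y (srIdx y y' n).1 then
      ((srIdx y y' n).1, (srIdx y y' n).2 + 1)
    else srIdx y y' n

lemma srS_congr (y z : ℕ → ℕ) (k : ℕ) (h : ∀ i ≤ k, y i = z i) : srS y k = srS z k :=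
  Finset.sum_congr rfl fun i hi => h i (by rw [Finset.mem_range] at hi; omega)

lemma srIdx_mono (y y' : ℕ → ℕ) (n : ℕ) :
    (srIdx y y' n).1 ≤ (srIdx y y' (n + 1)).1 ∧ (srIdx y y' n).2 ≤ (srIdx y y' (n + 1)).2 := by
  rw [srIdx]
  split_ifs <;> simp

lemma srIdx_congr (y y' z z' : ℕ → ℕ) (n : ℕ)
    (h : ∀ i ≤ (srIdx y y' n).1, y i = z i) (h' : ∀ i ≤ (srIdx y y' n).2, y' i = z' i) :
    srIdx z z' n = srIdx y y' n := by
  induction n with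
  | zero => rfl
  | succ n ih =>
    obtain ⟨m1, m2⟩ := srIdx_mono y y' n
    have g : ∀ i ≤ (srIdx y y' n).1, y i = z i := fun i hi => h i (hi.trans m1)
    have g' : ∀ i ≤ (srIdx y y' n).2, y' i = z' i := fun i hi => h' i (hi.trans m2)
    have e := ih g g'
    rw [srIdx, srIdx, e, srS_congr y z _ g, srS_congr y' z' _ g']

lemma sr_fiber {Ω ι : Type*} [MeasurableSpace Ω] (P : Measure Ω)
    (X : ι → Ω → ℕ) (hX : ∀ i, Measurable (X i)) (hind : ProbabilityTheory.iIndepFun X P)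
    (J : Finset ι) (B : Set Ω)
    (hB : ∀ ω ω', (∀ i ∈ J, X i ω = X i ω') → ω ∈ B → ω' ∈ B) :
    MeasurableSet B ∧ ∀ j, j ∉ J → ∀ f : ℕ → ENNReal,
      ∫⁻ ω in B, f (X j ω) ∂P = P B * ∫⁻ y, f y ∂(P.map (X j)) := by
  classical
  set Z : Ω → (J → ℕ) := fun ω i => X i ω with hZ
  have hZm : Measurable Z := measurable_pi_lambda _ fun i => hX i
  have hA : MeasurableSet (Z '' B) := (Set.to_countable _).measurableSet
  have hBA : Z ⁻¹' (Z '' B) = B := by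
    refine Set.Subset.antisymm ?_ (Set.subset_preimage_image _ _)
    rintro ω ⟨ω', h1, h2⟩
    refine hB ω' ω (fun i hi => ?_) h1
    exact congrFun h2 ⟨i, hi⟩
  have hBm : MeasurableSet B := hBA ▸ hZm hA
  refine ⟨hBm, fun j hj f => ?_⟩
  have hi := hind.indepFun_finset J {j} (by simpa using hj) hX
  have hi2 : ProbabilityTheory.IndepFun
      (fun ω => (Z '' B).indicator (fun _ => (1 : ENNReal)) (Z ω)) (fun ω => f (X j ω)) P :=
    hi.comp (φ := fun z => (Z '' B).indicator (fun _ => (1 : ENNReal)) z)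
      (ψ := fun z : (({j} : Finset ι) → ℕ) => f (z ⟨j, by simp⟩))
      (measurable_const.indicator hA)
      ((measurable_of_countable f).comp (measurable_pi_apply _))
  have hf : Measurable (fun ω => f (X j ω)) := (measurable_of_countable f).comp (hX j)
  have h3 := ProbabilityTheory.lintegral_mul_eq_lintegral_mul_lintegral_of_indepFun
    ((measurable_const.indicator hA).comp hZm) hf hi2
  rw [lintegral_map (measurable_of_countable f) (hX j)]
  have e1 : (fun ω => (Z '' B).indicator (fun _ => (1 : ENNReal)) (Z ω)) =
      B.indicator (fun _ => 1) := by
    conv_rhs => rw [← hBA]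
    rfl
  change ∫⁻ ω, ((fun ω => (Z '' B).indicator (fun _ => (1 : ENNReal)) (Z ω)) * 
    (fun ω => f (X j ω))) ω ∂P = (∫⁻ ω, (fun ω => (Z '' B).indicator (fun _ => (1 : ENNReal)) (Z ω)) ω ∂P) * _ at h3
  rw [e1, lintegral_indicator_const hBm, one_mul] at h3
  rw [← h3, ← lintegral_indicator hBm]
  refine lintegral_congr fun ω => ?_
  by_cases h : ω ∈ B <;> simp [h]

lemma sr_super {Ω : Type*} [MeasurableSpace Ω] (P : Measure Ω)
    (Y Y' : ℕ → Ω → ℕ)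
    (hYmeas : ∀ i, Measurable (Y i)) (hY'meas : ∀ i, Measurable (Y' i))
    (hindep : ProbabilityTheory.iIndepFun (Sum.elim Y Y') P)
    (ν : Measure ℕ)
    (hid : ∀ i : ℕ, 1 ≤ i → P.map (Y i) = ν) (hid' : ∀ i : ℕ, 1 ≤ i → P.map (Y' i) = ν)
    (H : ℕ → ℕ → ENNReal)
    (h1 : ∀ s s' : ℕ, s < s' → ∫⁻ y, H (s + y) s' ∂ν ≤ H s s')
    (h2 : ∀ s s' : ℕ, s' < s → ∫⁻ y, H s (s' + y) ∂ν ≤ H s s')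
    (V : ℕ → Ω → ENNReal)
    (hV : ∀ n ω, V n ω = H (srS (fun i => Y i ω) (srIdx (fun i => Y i ω) (fun i => Y' i ω) n).1)
      (srS (fun i => Y' i ω) (srIdx (fun i => Y i ω) (fun i => Y' i ω) n).2)) (n : ℕ) :
    Measurable (V n) ∧ ∫⁻ ω, V (n + 1) ω ∂P ≤ ∫⁻ ω, V n ω ∂P := by
  classical
  set q : Ω → (ℕ × ℕ) × (ℕ × ℕ) := fun ω =>
    (srIdx (fun i => Y i ω) (fun i => Y' i ω) n,
     (srS (fun i => Y i ω) (srIdx (fun i => Y i ω) (fun i => Y' i ω) n).1,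
      srS (fun i => Y' i ω) (srIdx (fun i => Y i ω) (fun i => Y' i ω) n).2)) with hq
  have hX : ∀ i, Measurable (Sum.elim Y Y' i) := by
    rintro (i | i)
    exacts [hYmeas i, hY'meas i]
  have hfib : ∀ k l s s' : ℕ, MeasurableSet (q ⁻¹' {((k, l), (s, s'))}) ∧
      ∀ j, j ∉ (Finset.range (k + 1)).disjSum (Finset.range (l + 1)) → ∀ f : ℕ → ENNReal,
      ∫⁻ ω in q ⁻¹' {((k, l), (s, s'))}, f (Sum.elim Y Y' j ω) ∂P =
        P (q ⁻¹' {((k, l), (s, s'))}) * ∫⁻ y, f y ∂(P.map (Sum.elim Y Y' j)) := by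
    intro k l s s'
    refine sr_fiber P _ hX hindep _ _ ?_
    intro ω ω' hag hω
    simp only [hq, Set.mem_preimage, Set.mem_singleton_iff, Prod.mk.injEq] at hω ⊢
    obtain ⟨e1, e2, e3⟩ := hω
    have g : ∀ i ≤ k, Y i ω = Y i ω' := fun i hi =>
      hag (Sum.inl i) (by simp; omega)
    have g' : ∀ i ≤ l, Y' i ω = Y' i ω' := fun i hi =>
      hag (Sum.inr i) (by simp; omega)
    have e := srIdx_congr (fun i => Y i ω) (fun i => Y' i ω) (fun i => Y i ω') (fun i => Y' i ω') n
      (by rw [e1]; exact g) (by rw [e1]; exact g')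
    rw [e, e1]
    rw [e1] at e2 e3
    refine ⟨rfl, ?_, ?_⟩
    · rw [← e2]
      exact (srS_congr _ _ _ g).symm
    · rw [← e3]
      exact (srS_congr _ _ _ g').symm
  have hqm : Measurable q := measurable_to_countable' fun ⟨⟨k, l⟩, ⟨s, s'⟩⟩ => (hfib k l s s').1
  have hdec : ∀ f : Ω → ENNReal, ∫⁻ ω, f ω ∂P = ∑' p, ∫⁻ ω in q ⁻¹' {p}, f ω ∂P := by
    intro f
    rw [← lintegral_iUnion (fun p => hqm (measurableSet_singleton p)) ?_ f]
    · rw [← Set.preimage_iUnion, Set.iUnion_of_singleton, Set.preimage_univ, Measure.restrict_univ]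
    · exact pairwise_disjoint_fiber q
  constructor
  · have : V n = (fun p : (ℕ × ℕ) × (ℕ × ℕ) => H p.2.1 p.2.2) ∘ q := by
      funext ω
      rw [hV]
      rfl
    rw [this]
    exact (measurable_of_countable _).comp hqm
  rw [hdec (V (n + 1)), hdec (V n)]
  refine ENNReal.tsum_le_tsum ?_
  rintro ⟨⟨k, l⟩, ⟨s, s'⟩⟩
  obtain ⟨hm, hf⟩ := hfib k l s s'
  set B := q ⁻¹' {((k, l), (s, s'))} with hB
  have hmem : ∀ ω ∈ B, srIdx (fun i => Y i ω) (fun i => Y' i ω) n = (k, l) ∧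
      srS (fun i => Y i ω) k = s ∧ srS (fun i => Y' i ω) l = s' := by
    intro ω hω
    simp only [hB, hq, Set.mem_preimage, Set.mem_singleton_iff, Prod.mk.injEq] at hω
    obtain ⟨e1, e2, e3⟩ := hω
    rw [e1] at e2 e3
    exact ⟨e1, e2, e3⟩
  have hR : ∫⁻ ω in B, V n ω ∂P = H s s' * P B := by
    rw [← setLIntegral_const]
    refine setLIntegral_congr_fun hm fun ω hω => ?_
    obtain ⟨e1, e2, e3⟩ := hmem ω hω
    simp only [hV, e1, e2, e3]
  rw [hR]
  rcases lt_trichotomy s s' with h | h | h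
  · have hL : ∫⁻ ω in B, V (n + 1) ω ∂P = ∫⁻ ω in B, H (s + Y (k + 1) ω) s' ∂P := by
      refine setLIntegral_congr_fun hm fun ω hω => ?_
      obtain ⟨e1, e2, e3⟩ := hmem ω hω
      have e4 : srIdx (fun i => Y i ω) (fun i => Y' i ω) (n + 1) = (k + 1, l) := by
        rw [srIdx, e1]
        simp only [e2, e3, h, if_true]
      have e5 : srS (fun i => Y i ω) (k + 1) = s + Y (k + 1) ω := by
        rw [srS, Finset.sum_range_succ, ← e2]
        rfl
      simp only [hV, e4, e5, e3]
    rw [hL]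
    have := hf (Sum.inl (k + 1)) (by simp) (fun y => H (s + y) s')
    simp only [Sum.elim_inl] at this
    rw [this, hid (k + 1) (by omega), mul_comm]
    gcongr
    exact h1 s s' h
  · refine le_of_eq ?_
    rw [← hR]
    refine setLIntegral_congr_fun hm fun ω hω => ?_
    obtain ⟨e1, e2, e3⟩ := hmem ω hω
    have e4 : srIdx (fun i => Y i ω) (fun i => Y' i ω) (n + 1) = (k, l) := by
      rw [srIdx, e1]
      simp only [e2, e3, h, lt_irrefl, if_false]
    simp only [hV, e4, e1]
  · have hL : ∫⁻ ω in B, V (n + 1) ω ∂P = ∫⁻ ω in B, H s (s' + Y' (l + 1) ω) ∂P := by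
      refine setLIntegral_congr_fun hm fun ω hω => ?_
      obtain ⟨e1, e2, e3⟩ := hmem ω hω
      have e4 : srIdx (fun i => Y i ω) (fun i => Y' i ω) (n + 1) = (k, l + 1) := by
        rw [srIdx, e1]
        simp only [e2, e3, h, if_true, h.not_gt, if_false]
      have e5 : srS (fun i => Y' i ω) (l + 1) = s' + Y' (l + 1) ω := by
        rw [srS, Finset.sum_range_succ, ← e3]
        rfl
      simp only [hV, e4, e5, e2]
    rw [hL]
    have := hf (Sum.inr (l + 1)) (by simp) (fun y => H s (s' + y))
    simp only [Sum.elim_inr] at this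
    rw [this, hid' (l + 1) (by omega), mul_comm]
    gcongr
    exact h2 s s' h

lemma srS_ge (y : ℕ → ℕ) (hy : ∀ i, 1 ≤ i → 0 < y i) (k : ℕ) : k ≤ srS y k := by
  induction k with
  | zero => simp
  | succ k ih =>
    have : srS y (k + 1) = srS y k + y (k + 1) := Finset.sum_range_succ _ _
    have := hy (k + 1) (by omega)
    omega

lemma sr_liminf {Ω : Type*} (Y Y' : ℕ → Ω → ℕ) (ω : Ω)
    (hpos : ∀ i : ℕ, 1 ≤ i → 0 < Y i ω) (hpos' : ∀ i : ℕ, 1 ≤ i → 0 < Y' i ω)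
    (β : ℝ) (hβ : 1 ≤ β)
    (H : ℕ → ℕ → ENNReal) (hH : ∀ s s' : ℕ, ((s : ENNReal) + s') ^ β ≤ H s s')
    (V : ℕ → ENNReal)
    (hV : ∀ n, V n = H (srS (fun i => Y i ω) (srIdx (fun i => Y i ω) (fun i => Y' i ω) n).1)
      (srS (fun i => Y' i ω) (srIdx (fun i => Y i ω) (fun i => Y' i ω) n).2)) :
    (firstSimultaneousRenewal Y Y' ω) ^ β ≤ Filter.liminf V Filter.atTop := by
  have hβ0 : 0 ≤ β := by linarith
  set I := srIdx (fun i => Y i ω) (fun i => Y' i ω) with hI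
  by_cases hst : ∃ n, srS (fun i => Y i ω) (I n).1 = srS (fun i => Y' i ω) (I n).2
  · obtain ⟨n, hn⟩ := hst
    have hc : ∀ m, n ≤ m → I m = I n := by
      intro m hm
      induction m, hm using Nat.le_induction with
      | base => rfl
      | succ m hm ih =>
        rw [hI, srIdx, ← hI, ih]
        simp only [hn, lt_irrefl, if_false]
    refine Filter.le_liminf_of_le (by isBoundedDefault) ?_
    filter_upwards [Filter.eventually_ge_atTop n] with m hm
    rw [hV, hc m hm]
    refine le_trans ?_ (hH _ _)
    refine ENNReal.rpow_le_rpow ?_ hβ0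
    refine le_trans ?_ le_self_add
    exact sInf_le ⟨_, (I n).1, (I n).2, rfl, rfl, hn.symm⟩
  · push Not at hst
    have hsum : ∀ m, (I m).1 + (I m).2 = m := by
      intro m
      induction m with
      | zero => simp [hI, srIdx]
      | succ m ih =>
        have h := hst m
        rw [hI, srIdx, ← hI]
        rcases lt_or_gt_of_ne h with h | h
        · simp only [h, if_true]; omega
        · simp only [h, if_true, h.not_gt, if_false]; omega
    have hge : ∀ m : ℕ, (m : ENNReal) ≤ V m := by
      intro m
      rw [hV]
      refine le_trans ?_ (hH _ _)
      have a1 := srS_ge (fun i => Y i ω) hpos (I m).1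
      have a2 := srS_ge (fun i => Y' i ω) hpos' (I m).2
      have a3 := hsum m
      have a4 : (m : ENNReal) ≤ (srS (fun i => Y i ω) (I m).1 : ENNReal) +
          (srS (fun i => Y' i ω) (I m).2 : ENNReal) := by
        exact_mod_cast (by omega : m ≤ srS (fun i => Y i ω) (I m).1 + srS (fun i => Y' i ω) (I m).2)
      refine le_trans ?_ (ENNReal.rpow_le_rpow a4 hβ0)
      rcases Nat.eq_zero_or_pos m with h | h
      · simp [h]
      · calc (m : ENNReal) = (m : ENNReal) ^ (1 : ℝ) := by simp
          _ ≤ (m : ENNReal) ^ β := ENNReal.rpow_le_rpow_of_exponent_le (by exact_mod_cast h) hβ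
    have ht : Filter.Tendsto V Filter.atTop (nhds ⊤) :=
      tendsto_nhds_top_mono' ENNReal.tendsto_nat_nhds_top hge
    rw [ht.liminf_eq]
    exact le_top

/-- Theorem 3.2; Theorem 4.2 of Lindvall, moments of the first
simultaneous renewal time. Let `Y_0, Y'_0` be ℕ-valued, `Y_1, Y_2, …, Y'_1, Y'_2, …`
positive-integer-valued with a common aperiodic distribution, all mutually independent.
If `E[Y_0^β], E[(Y'_0)^β], E[Y_1^β] < ∞` for some `β ≥ 1`, then `E[T^β] < ∞` for the
first simultaneous renewal time `T`. -/
theorem simultaneous_renewal_moment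
    {Ω : Type*} [MeasurableSpace Ω] (ℙ : Measure Ω) (hℙ : IsProbabilityMeasure ℙ)
    (Y Y' : ℕ → Ω → ℕ)
    (hYmeas : ∀ i, Measurable (Y i)) (hY'meas : ∀ i, Measurable (Y' i))
    (hpos : ∀ i : ℕ, 1 ≤ i → ∀ ω, 0 < Y i ω) (hpos' : ∀ i : ℕ, 1 ≤ i → ∀ ω, 0 < Y' i ω)
    -- all the variables are mutually independent
    (hindep : ProbabilityTheory.iIndepFun
      (Sum.elim Y Y') ℙ)
    -- the inter-renewal times are identically distributed
    (hid : ∀ i : ℕ, 1 ≤ i → ℙ.map (Y i) = ℙ.map (Y 1))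
    (hid' : ∀ i : ℕ, 1 ≤ i → ℙ.map (Y' i) = ℙ.map (Y 1))
    -- aperiodicity: gcd {n ≥ 1 : P[Y_1 = n] > 0} = 1
    (haper : ∀ d : ℕ, (∀ n : ℕ, 1 ≤ n → ℙ {ω | Y 1 ω = n} ≠ 0 → d ∣ n) → d = 1)
    (β : ℝ) (hβ : 1 ≤ β)
    (hY0 : ∫⁻ ω, (Y 0 ω : ENNReal) ^ β ∂ℙ ≠ ⊤)
    (hY'0 : ∫⁻ ω, (Y' 0 ω : ENNReal) ^ β ∂ℙ ≠ ⊤)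
    (hY1 : ∫⁻ ω, (Y 1 ω : ENNReal) ^ β ∂ℙ ≠ ⊤) :
    ∫⁻ ω, (firstSimultaneousRenewal Y Y' ω) ^ β ∂ℙ ≠ ⊤ := by
  have hβ0 : 0 ≤ β := by linarith
  set ν : Measure ℕ := ℙ.map (Y 1) with hν
  haveI : IsProbabilityMeasure ν := Measure.isProbabilityMeasure_map (hYmeas 1).aemeasurable
  have h0 : ∀ᵐ y ∂ν, 1 ≤ y := by
    rw [hν, ae_map_iff (hYmeas 1).aemeasurable (measurableSet_Ici)]
    exact Filter.Eventually.of_forall fun ω => hpos 1 le_rfl ω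
  have hint : Integrable (fun y : ℕ => (y : ℝ) ^ β) ν := by
    refine ⟨(measurable_of_countable _).aestronglyMeasurable, ?_⟩
    rw [hasFiniteIntegral_iff_ofReal (Filter.Eventually.of_forall fun y => by positivity), hν,
      lintegral_map (measurable_of_countable _) (hYmeas 1), lt_top_iff_ne_top]
    convert hY1 using 3 with ω
    rw [← ENNReal.ofReal_rpow_of_nonneg (Nat.cast_nonneg _) hβ0, ENNReal.ofReal_natCast]
  have hap : ∀ d : ℕ, (∀ n : ℕ, ν {n} ≠ 0 → d ∣ n) → d = 1 := by
    intro d hd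
    refine haper d fun n _ hn => hd n ?_
    rw [hν, Measure.map_apply (hYmeas 1) (measurableSet_singleton n)]
    exact hn
  obtain ⟨H, Q, hQ, hH1, hH2, hH3, hH4⟩ := sr_lyap ν β hβ h0 hint hap
  set V : ℕ → Ω → ENNReal := fun n ω =>
    H (srS (fun i => Y i ω) (srIdx (fun i => Y i ω) (fun i => Y' i ω) n).1)
      (srS (fun i => Y' i ω) (srIdx (fun i => Y i ω) (fun i => Y' i ω) n).2) with hVdef
  have hsup := fun n => sr_super ℙ Y Y' hYmeas hY'meas hindep ν hid hid' H hH3 hH4 V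
    (fun _ _ => rfl) n
  have hanti : ∀ n, ∫⁻ ω, V n ω ∂ℙ ≤ ∫⁻ ω, V 0 ω ∂ℙ := by
    intro n
    induction n with
    | zero => exact le_rfl
    | succ n ih => exact (hsup n).2.trans ih
  have hV0 : ∫⁻ ω, V 0 ω ∂ℙ < ⊤ := by
    have hb : ∀ ω, V 0 ω ≤ (Q * 2 ^ (β - 1)) * (1 + 2 ^ (β - 1) *
        ((Y 0 ω : ENNReal) ^ β + (Y' 0 ω : ENNReal) ^ β)) := by
      intro ω
      have e : V 0 ω = H (Y 0 ω) (Y' 0 ω) := by simp [hVdef, srIdx, srS]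
      rw [e]
      refine (hH2 _ _).trans ?_
      rw [mul_assoc]
      gcongr
      refine (ENNReal.rpow_add_le_mul_rpow_add_rpow _ _ hβ).trans ?_
      rw [ENNReal.one_rpow]
      gcongr
      exact ENNReal.rpow_add_le_mul_rpow_add_rpow _ _ hβ
    have h2 : (2 : ENNReal) ^ (β - 1) ≠ ⊤ :=
      ENNReal.rpow_ne_top_of_nonneg (by linarith) (by norm_num)
    refine (lintegral_mono hb).trans_lt ?_
    have m0 : Measurable fun ω => (Y 0 ω : ENNReal) ^ β :=
      (measurable_of_countable fun y : ℕ => (y : ENNReal) ^ β).comp (hYmeas 0)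
    rw [lintegral_const_mul' _ _ (ENNReal.mul_ne_top hQ h2),
      lintegral_add_left measurable_const, lintegral_const_mul' _ _ h2,
      lintegral_add_left m0]
    refine ENNReal.mul_lt_top (ENNReal.mul_ne_top hQ h2).lt_top ?_
    refine ENNReal.add_lt_top.2 ⟨by simp, ENNReal.mul_lt_top h2.lt_top ?_⟩
    exact ENNReal.add_lt_top.2 ⟨hY0.lt_top, hY'0.lt_top⟩
  refine ne_of_lt (lt_of_le_of_lt ?_ hV0)
  calc ∫⁻ ω, (firstSimultaneousRenewal Y Y' ω) ^ β ∂ℙ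
      ≤ ∫⁻ ω, Filter.liminf (fun n => V n ω) Filter.atTop ∂ℙ :=
        lintegral_mono fun ω => sr_liminf Y Y' ω (fun i hi => hpos i hi ω)
          (fun i hi => hpos' i hi ω) β hβ H hH1 _ fun _ => rfl
    _ ≤ Filter.liminf (fun n => ∫⁻ ω, V n ω ∂ℙ) Filter.atTop :=
        lintegral_liminf_le fun n => (hsup n).1
    _ ≤ Filter.liminf (fun _ : ℕ => ∫⁻ ω, V 0 ω ∂ℙ) Filter.atTop :=
        Filter.liminf_le_liminf (Filter.Eventually.of_forall hanti)
    _ = ∫⁻ ω, V 0 ω ∂ℙ := Filter.liminf_const _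

end
end

section
/- Nummelin splitting: let 𝓟 be a Markov kernel on (X, 𝓑), let A₀ ∈ 𝓑, η ∈ (0,1), and let θ be a probability measure on (X, 𝓑) with 𝓟(x,·) ≥ η θ(·) for every x ∈ A₀. Let X̃ = X ⊔ A₁, where A₁ is a disjoint identical copy of A₀. For a finite measure μ on X define its lift μ* on X̃ by μ*|_X = (1−η) μ|_{A₀} + μ|_{X∖A₀} and μ*|_{A₁} = η μ|_{A₀} (under the identification A₁ ≅ A₀). Define the split kernel 𝓟̃ on X̃ by: 𝓟̃(x,·) = (𝓟(x,·))* for x ∈ X∖A₀; 𝓟̃(x,·) = [(𝓟(x,·))* − η θ*(·)]/(1−η) for x ∈ A₀; and 𝓟̃(x,·) = θ*(·) for x ∈ A₁. Then 𝓟̃ is a Markov kernel, A₁ is an atom for 𝓟̃, and for every probability measure μ on X, (μ𝓟)* = μ*𝓟̃; consequently ‖μ𝓟^n − ν𝓟^n‖_TV ≤ ‖μ*𝓟̃^n − ν*𝓟̃^n‖_TV for all probability measures μ, ν on X and all n ≥ 1. -/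
open MeasureTheory

noncomputable section

attribute [local instance] Classical.propDecidable

/-- The lift `μ*` of a measure `μ` on `X` to the split space `X̃ = X ⊔ A₁`, realized as
`X ⊕ X` (the second summand hosting the copy `A₁ ≅ A₀`):
`μ*|_X = (1-η) μ|_{A₀} + μ|_{X∖A₀}` and `μ*|_{A₁} = η μ|_{A₀}`. -/
def liftMeasure {X : Type*} [MeasurableSpace X] (A₀ : Set X) (η : ℝ)
    (μ : Measure X) : Measure (X ⊕ X) :=
  Measure.map Sum.inl (ENNReal.ofReal (1 - η) • μ.restrict A₀ + μ.restrict A₀ᶜ)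
    + Measure.map Sum.inr (ENNReal.ofReal η • μ.restrict A₀)

/-- The Nummelin split kernel `𝒫̃` on `X̃ = X ⊔ A₁`:
`𝒫̃(x,·) = (𝒫(x,·))*` for `x ∈ X∖A₀`, `𝒫̃(x,·) = [(𝒫(x,·))* - η θ*]/(1-η)` for
`x ∈ A₀`, and `𝒫̃(x,·) = θ*` for `x ∈ A₁`. -/
def splitKernel {X : Type*} [MeasurableSpace X] (A₀ : Set X) (η : ℝ)
    (θ : Measure X) (K : X → Measure X) : (X ⊕ X) → Measure (X ⊕ X)
  | Sum.inl x =>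
      if x ∈ A₀ then
        (ENNReal.ofReal (1 - η))⁻¹ •
          (liftMeasure A₀ η (K x) - ENNReal.ofReal η • liftMeasure A₀ η θ)
      else liftMeasure A₀ η (K x)
  | Sum.inr _ => liftMeasure A₀ η θ

/-- `n`-fold action of a kernel on a measure: `μ𝒫ⁿ`. -/
def iterBind {X : Type*} [MeasurableSpace X] (K : X → Measure X) :
    ℕ → Measure X → Measure X
  | 0, μ => μ
  | (n+1), μ => (iterBind K n μ).bind K

section helpers
variable {X : Type*} [MeasurableSpace X]

lemma lift_apply {A₀ : Set X} (hA₀ : MeasurableSet A₀) (η : ℝ) (μ : Measure X)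
    {S : Set (X ⊕ X)} (hS : MeasurableSet S) :
    liftMeasure A₀ η μ S = ENNReal.ofReal (1 - η) * μ (Sum.inl ⁻¹' S ∩ A₀)
      + μ (Sum.inl ⁻¹' S ∩ A₀ᶜ) + ENNReal.ofReal η * μ (Sum.inr ⁻¹' S ∩ A₀) := by
  have h1 : MeasurableSet (Sum.inl ⁻¹' S : Set X) := measurable_inl hS
  have h2 : MeasurableSet (Sum.inr ⁻¹' S : Set X) := measurable_inr hS
  simp only [liftMeasure, Measure.add_apply, Measure.map_apply measurable_inl hS,
    Measure.map_apply measurable_inr hS, Measure.smul_apply, smul_eq_mul,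
    Measure.restrict_apply h1, Measure.restrict_apply h2]

lemma eta_add {η : ℝ} (hη0 : 0 < η) (hη1 : η < 1) :
    ENNReal.ofReal (1 - η) + ENNReal.ofReal η = 1 := by
  rw [← ENNReal.ofReal_add (by linarith) hη0.le]; simp

lemma lift_proj {A₀ : Set X} (hA₀ : MeasurableSet A₀) {η : ℝ} (hη0 : 0 < η) (hη1 : η < 1)
    (μ : Measure X) {A : Set X} (hA : MeasurableSet A) :
    MeasurableSet (Sum.elim id id ⁻¹' A : Set (X ⊕ X)) ∧
    liftMeasure A₀ η μ (Sum.elim id id ⁻¹' A) = μ A := by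
  have hm : MeasurableSet (Sum.elim id id ⁻¹' A : Set (X ⊕ X)) :=
    (measurable_id.sumElim measurable_id) hA
  refine ⟨hm, ?_⟩
  rw [lift_apply hA₀ η μ hm]
  have e1 : (Sum.inl ⁻¹' (Sum.elim id id ⁻¹' A : Set (X ⊕ X)) : Set X) = A := rfl
  have e2 : (Sum.inr ⁻¹' (Sum.elim id id ⁻¹' A : Set (X ⊕ X)) : Set X) = A := rfl
  rw [e1, e2, add_right_comm, ← add_mul, eta_add hη0 hη1, one_mul, ← Set.diff_eq,
    measure_inter_add_diff _ hA₀]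

lemma lift_prob {A₀ : Set X} (hA₀ : MeasurableSet A₀) {η : ℝ} (hη0 : 0 < η) (hη1 : η < 1)
    (μ : Measure X) [hμ : IsProbabilityMeasure μ] :
    IsProbabilityMeasure (liftMeasure A₀ η μ) :=
  ⟨by simpa using (lift_proj hA₀ hη0 hη1 μ MeasurableSet.univ).2⟩

lemma lift_mono {A₀ : Set X} (hA₀ : MeasurableSet A₀) (η : ℝ) {c : ENNReal}
    {μ ν : Measure X} (h : c • μ ≤ ν) :
    c • liftMeasure A₀ η μ ≤ liftMeasure A₀ η ν := by
  refine Measure.le_iff.2 fun S hS => ?_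
  have h' : ∀ s, c * μ s ≤ ν s := fun s => h s
  rw [Measure.smul_apply, smul_eq_mul, lift_apply hA₀ η μ hS, lift_apply hA₀ η ν hS, mul_add,
    mul_add, mul_left_comm, mul_left_comm c]
  gcongr <;> exact h' _

lemma lift_meas {A₀ : Set X} (hA₀ : MeasurableSet A₀) (η : ℝ) {K : X → Measure X}
    (hK : Measurable K) : Measurable (fun x => liftMeasure A₀ η (K x)) := by
  refine Measure.measurable_of_measurable_coe _ fun S hS => ?_
  have h1 : MeasurableSet (Sum.inl ⁻¹' S : Set X) := measurable_inl hS
  have h2 : MeasurableSet (Sum.inr ⁻¹' S : Set X) := measurable_inr hS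
  have hm : ∀ s : Set X, MeasurableSet s → Measurable fun x => K x s :=
    fun s hs => (Measure.measurable_coe hs).comp hK
  simp only [lift_apply hA₀ η _ hS]
  exact (((hm _ (h1.inter hA₀)).const_mul _).add (hm _ (h1.inter hA₀.compl))).add
    ((hm _ (h2.inter hA₀)).const_mul _)

lemma split_inl_apply {A₀ : Set X} (hA₀ : MeasurableSet A₀) {η : ℝ} (hη0 : 0 < η) (hη1 : η < 1)
    {θ : Measure X} [IsProbabilityMeasure θ] {K : X → Measure X}
    (hminor : ∀ x ∈ A₀, ENNReal.ofReal η • θ ≤ K x) {x : X} (hx : x ∈ A₀)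
    {S : Set (X ⊕ X)} (hS : MeasurableSet S) :
    splitKernel A₀ η θ K (Sum.inl x) S = (ENNReal.ofReal (1 - η))⁻¹ *
      (liftMeasure A₀ η (K x) S - ENNReal.ofReal η * liftMeasure A₀ η θ S) := by
  have := lift_prob hA₀ hη0 hη1 θ
  have hfin : IsFiniteMeasure (ENNReal.ofReal η • liftMeasure A₀ η θ) :=
    Measure.smul_finite _ ENNReal.ofReal_ne_top
  simp only [splitKernel, if_pos hx, Measure.smul_apply, smul_eq_mul]
  rw [Measure.sub_apply hS (lift_mono hA₀ η (hminor x hx))]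
  simp

lemma split_key {A₀ : Set X} (hA₀ : MeasurableSet A₀) {η : ℝ} (hη0 : 0 < η) (hη1 : η < 1)
    {θ : Measure X} [IsProbabilityMeasure θ] {K : X → Measure X}
    (hminor : ∀ x ∈ A₀, ENNReal.ofReal η • θ ≤ K x) {x : X} (hx : x ∈ A₀)
    {S : Set (X ⊕ X)} (hS : MeasurableSet S) :
    ENNReal.ofReal (1 - η) * splitKernel A₀ η θ K (Sum.inl x) S
      + ENNReal.ofReal η * liftMeasure A₀ η θ S = liftMeasure A₀ η (K x) S := by
  have hne : ENNReal.ofReal (1 - η) ≠ 0 := by simp; linarith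
  rw [split_inl_apply hA₀ hη0 hη1 hminor hx hS, ← mul_assoc,
    ENNReal.mul_inv_cancel hne ENNReal.ofReal_ne_top, one_mul]
  exact tsub_add_cancel_of_le (lift_mono hA₀ η (hminor x hx) S)

lemma split_meas {A₀ : Set X} (hA₀ : MeasurableSet A₀) {η : ℝ} (hη0 : 0 < η) (hη1 : η < 1)
    {θ : Measure X} [IsProbabilityMeasure θ] {K : X → Measure X} (hK : Measurable K)
    (hminor : ∀ x ∈ A₀, ENNReal.ofReal η • θ ≤ K x) :
    Measurable (splitKernel A₀ η θ K) := by
  refine Measure.measurable_of_measurable_coe _ fun S hS => ?_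
  refine measurable_fun_sum ?_ measurable_const
  have hm : Measurable fun x => liftMeasure A₀ η (K x) S :=
    (Measure.measurable_coe hS).comp (lift_meas hA₀ η hK)
  have : (fun x => splitKernel A₀ η θ K (Sum.inl x) S) = fun x => if x ∈ A₀ then
      (ENNReal.ofReal (1 - η))⁻¹ *
      (liftMeasure A₀ η (K x) S - ENNReal.ofReal η * liftMeasure A₀ η θ S)
      else liftMeasure A₀ η (K x) S := by
    funext x
    split_ifs with hx
    · exact split_inl_apply hA₀ hη0 hη1 hminor hx hS
    · simp [splitKernel, hx]
  change Measurable (fun x => splitKernel A₀ η θ K (Sum.inl x) S)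
  rw [this]
  exact Measurable.ite hA₀ ((hm.sub measurable_const).const_mul _) hm

lemma split_prob {A₀ : Set X} (hA₀ : MeasurableSet A₀) {η : ℝ} (hη0 : 0 < η) (hη1 : η < 1)
    {θ : Measure X} [IsProbabilityMeasure θ] {K : X → Measure X}
    (hKprob : ∀ x, IsProbabilityMeasure (K x))
    (hminor : ∀ x ∈ A₀, ENNReal.ofReal η • θ ≤ K x) (z : X ⊕ X) :
    IsProbabilityMeasure (splitKernel A₀ η θ K z) := by
  have hθ := lift_prob hA₀ hη0 hη1 θ
  have hne : ENNReal.ofReal (1 - η) ≠ 0 := by simp; linarith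
  rcases z with x | x
  · have hx' := lift_prob hA₀ hη0 hη1 (K x)
    by_cases hx : x ∈ A₀
    · constructor
      rw [split_inl_apply hA₀ hη0 hη1 hminor hx MeasurableSet.univ, measure_univ, measure_univ,
        mul_one]
      have : (1 : ENNReal) - ENNReal.ofReal η = ENNReal.ofReal (1 - η) := by
        rw [← eta_add hη0 hη1]; exact ENNReal.add_sub_cancel_right ENNReal.ofReal_ne_top
      rw [this, ENNReal.inv_mul_cancel hne ENNReal.ofReal_ne_top]
    · simpa [splitKernel, hx] using hx'
  · exact hθ

lemma split_bind {A₀ : Set X} (hA₀ : MeasurableSet A₀) {η : ℝ} (hη0 : 0 < η) (hη1 : η < 1)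
    {θ : Measure X} [IsProbabilityMeasure θ] {K : X → Measure X} (hK : Measurable K)
    (hminor : ∀ x ∈ A₀, ENNReal.ofReal η • θ ≤ K x) (μ : Measure X) :
    liftMeasure A₀ η (μ.bind K) = (liftMeasure A₀ η μ).bind (splitKernel A₀ η θ K) := by
  ext S hS
  have hM := split_meas hA₀ hη0 hη1 hK hminor
  have hMS : Measurable fun z => splitKernel A₀ η θ K z S := (Measure.measurable_coe hS).comp hM
  have h1 : MeasurableSet (Sum.inl ⁻¹' S : Set X) := measurable_inl hS
  have h2 : MeasurableSet (Sum.inr ⁻¹' S : Set X) := measurable_inr hS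
  have hm : ∀ s : Set X, MeasurableSet s → Measurable fun x => K x s :=
    fun s hs => (Measure.measurable_coe hs).comp hK
  have hL : liftMeasure A₀ η (μ.bind K) S = ∫⁻ x, liftMeasure A₀ η (K x) S ∂μ := by
    simp only [lift_apply hA₀ η _ hS]
    rw [lintegral_add_right _ ((hm _ (h2.inter hA₀)).const_mul _),
      lintegral_add_right _ (hm _ (h1.inter hA₀.compl)),
      lintegral_const_mul _ (hm _ (h1.inter hA₀)), lintegral_const_mul _ (hm _ (h2.inter hA₀)),
      Measure.bind_apply (h1.inter hA₀) hK.aemeasurable,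
      Measure.bind_apply (h1.inter hA₀.compl) hK.aemeasurable,
      Measure.bind_apply (h2.inter hA₀) hK.aemeasurable]
  rw [hL, Measure.bind_apply hS hM.aemeasurable, ← lintegral_add_compl _ hA₀]
  conv_rhs => rw [liftMeasure]
  rw [lintegral_add_measure, lintegral_map hMS measurable_inl, lintegral_map hMS measurable_inr,
    lintegral_add_measure, lintegral_smul_measure, lintegral_smul_measure, add_right_comm,
    smul_eq_mul, smul_eq_mul]
  congr 1
  · have hi : Measurable fun x : X => splitKernel A₀ η θ K (Sum.inl x) S :=
      hMS.comp measurable_inl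
    have hr : Measurable fun x : X => splitKernel A₀ η θ K (Sum.inr x) S :=
      hMS.comp measurable_inr
    rw [← lintegral_const_mul _ hi, ← lintegral_const_mul _ hr,
      ← lintegral_add_right _ (hr.const_mul _)]
    exact setLIntegral_congr_fun hA₀ fun x hx => (split_key hA₀ hη0 hη1 hminor hx hS).symm
  · refine setLIntegral_congr_fun hA₀.compl fun x hx => ?_
    have hx' : x ∉ A₀ := hx
    simp [splitKernel, hx']

lemma iter_prob {K : X → Measure X} (hK : Measurable K)
    (hKprob : ∀ x, IsProbabilityMeasure (K x)) (μ : Measure X) [hμ : IsProbabilityMeasure μ]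
    (n : ℕ) : IsProbabilityMeasure (iterBind K n μ) := by
  induction n with
  | zero => exact hμ
  | succ n ih =>
    constructor
    rw [iterBind, Measure.bind_apply MeasurableSet.univ hK.aemeasurable]
    simp

lemma tv_le (μ ν : Measure X) [IsProbabilityMeasure μ] [IsProbabilityMeasure ν] {A : Set X}
    (hA : MeasurableSet A) : |(μ A).toReal - (ν A).toReal| ≤ tvDist μ ν := by
  refine le_ciSup (f := fun A : {A : Set X // MeasurableSet A} =>
    |(μ A.1).toReal - (ν A.1).toReal|) ⟨1, ?_⟩ ⟨A, hA⟩
  rintro _ ⟨B, rfl⟩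
  have a1 : (μ B.1).toReal ≤ 1 := measureReal_le_one
  have a2 : (ν B.1).toReal ≤ 1 := measureReal_le_one
  have a3 : 0 ≤ (μ B.1).toReal := ENNReal.toReal_nonneg
  have a4 : 0 ≤ (ν B.1).toReal := ENNReal.toReal_nonneg
  exact abs_le.2 ⟨by linarith, by linarith⟩

end helpers

/-- Nummelin splitting. Given a Markov kernel `𝒫` on `X`, a set
`A₀`, `η ∈ (0,1)` and a probability measure `θ` with `𝒫(x,·) ≥ η θ` for all `x ∈ A₀`,
the split kernel `𝒫̃` on `X̃ = X ⊔ A₁` is a Markov kernel, `A₁` is an atom for `𝒫̃`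
(all its points having transition measure `θ*`), the splitting intertwines the
dynamics, `(μ𝒫)* = μ*𝒫̃`, and consequently
`‖μ𝒫ⁿ - ν𝒫ⁿ‖_TV ≤ ‖μ*𝒫̃ⁿ - ν*𝒫̃ⁿ‖_TV`. -/
theorem nummelin_splitting
    {X : Type*} [MeasurableSpace X]
    (K : X → Measure X) (hKmeas : Measurable K) (hKprob : ∀ x, IsProbabilityMeasure (K x))
    (A₀ : Set X) (hA₀ : MeasurableSet A₀)
    (η : ℝ) (hη0 : 0 < η) (hη1 : η < 1)
    (θ : Measure X) (hθ : IsProbabilityMeasure θ)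
    (hminor : ∀ x ∈ A₀, ENNReal.ofReal η • θ ≤ K x) :
    -- `𝒫̃` is a Markov kernel
    (Measurable (splitKernel A₀ η θ K) ∧
      ∀ z : X ⊕ X, IsProbabilityMeasure (splitKernel A₀ η θ K z)) ∧
    -- `A₁` is an atom for `𝒫̃`
    (∀ x ∈ A₀, splitKernel A₀ η θ K (Sum.inr x) = liftMeasure A₀ η θ) ∧
    -- `(μ𝒫)* = μ*𝒫̃`
    (∀ μ : Measure X, IsProbabilityMeasure μ →
      liftMeasure A₀ η (μ.bind K) = (liftMeasure A₀ η μ).bind (splitKernel A₀ η θ K)) ∧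
    -- `‖μ𝒫ⁿ - ν𝒫ⁿ‖_TV ≤ ‖μ*𝒫̃ⁿ - ν*𝒫̃ⁿ‖_TV`
    (∀ μ ν : Measure X, IsProbabilityMeasure μ → IsProbabilityMeasure ν → ∀ n : ℕ,
      1 ≤ n →
      tvDist (iterBind K n μ) (iterBind K n ν)
        ≤ tvDist (iterBind (splitKernel A₀ η θ K) n (liftMeasure A₀ η μ))
            (iterBind (splitKernel A₀ η θ K) n (liftMeasure A₀ η ν))) := by
  refine ⟨⟨split_meas hA₀ hη0 hη1 hKmeas hminor, split_prob hA₀ hη0 hη1 hKprob hminor⟩,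
    fun _ _ => rfl, fun μ _ => split_bind hA₀ hη0 hη1 hKmeas hminor μ, ?_⟩
  intro μ ν hμ hν n _
  have hit : ∀ (μ : Measure X) (n : ℕ), iterBind (splitKernel A₀ η θ K) n (liftMeasure A₀ η μ)
      = liftMeasure A₀ η (iterBind K n μ) := by
    intro μ n
    induction n with
    | zero => rfl
    | succ n ih => rw [iterBind, ih, iterBind, split_bind hA₀ hη0 hη1 hKmeas hminor]
  rw [hit, hit]
  have p1 := iter_prob hKmeas hKprob μ n
  have p2 := iter_prob hKmeas hKprob ν n
  have q1 := lift_prob hA₀ hη0 hη1 (iterBind K n μ)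
  have q2 := lift_prob hA₀ hη0 hη1 (iterBind K n ν)
  have : Nonempty {A : Set X // MeasurableSet A} := ⟨⟨∅, MeasurableSet.empty⟩⟩
  refine ciSup_le fun A => ?_
  obtain ⟨hm, e1⟩ := lift_proj hA₀ hη0 hη1 (iterBind K n μ) A.2
  obtain ⟨_, e2⟩ := lift_proj hA₀ hη0 hη1 (iterBind K n ν) A.2
  rw [← e1, ← e2]
  exact tv_le _ _ hm

end
end

section
/- For each i ∈ {1,…,m} the π-measure of the set of states where particle i has low energy is comparable to that energy threshold: there exist constants c, C > 0 and ε₁ > 0 such that for all 0 < ε < ε₁, c·ε ≤ π({x ∈ Δ : x^i < ε}) ≤ C·ε. -/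
open MeasureTheory Set Filter

lemma aux_one (a b : ℝ) (hb : 0 ≤ b) (hba : b ≤ a) :
    ∫⁻ t in Ioo (0:ℝ) b, ENNReal.ofReal ((a - t) ^ (-(1/2) : ℝ))
      = ENNReal.ofReal (2 * (Real.sqrt a - Real.sqrt (a - b))) := by
  have hint : IntervalIntegrable (fun t : ℝ => (a - t) ^ (-(1/2) : ℝ)) volume 0 b := by
    have h := (intervalIntegral.intervalIntegrable_rpow' (a := a) (b := a - b)
      (r := (-(1/2) : ℝ)) (by norm_num)).comp_sub_left a
    simpa using h
  have h2 : IntegrableOn (fun t : ℝ => (a - t) ^ (-(1/2) : ℝ)) (Ioo 0 b) volume :=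
    ((intervalIntegrable_iff_integrableOn_Ioc_of_le hb).1 hint).mono_set Ioo_subset_Ioc_self
  rw [← ofReal_integral_eq_lintegral_ofReal h2]
  · congr 1
    rw [← integral_Ioc_eq_integral_Ioo, ← intervalIntegral.integral_of_le hb,
      intervalIntegral.integral_comp_sub_left (fun t : ℝ => t ^ (-(1/2) : ℝ)) a,
      integral_rpow (Or.inl (by norm_num))]
    rw [Real.sqrt_eq_rpow, Real.sqrt_eq_rpow]
    norm_num
    ring
  · filter_upwards [ae_restrict_mem measurableSet_Ioo] with t ht
    exact Real.rpow_nonneg (by linarith [ht.2]) _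

lemma aux_fub {n : ℕ} (j : Fin (n+1)) (g : (Fin (n+1) → ℝ) → ENNReal) (hg : Measurable g) :
    ∫⁻ x, g x = ∫⁻ z : Fin n → ℝ, ∫⁻ t : ℝ, g (j.insertNth t z) := by
  have h := (volume_preserving_piFinSuccAbove (fun _ : Fin (n+1) => ℝ) j).symm
  rw [← h.map_eq, lintegral_map_equiv, Measure.volume_eq_prod, lintegral_prod_symm']
  · rfl
  · exact hg.comp (MeasurableEquiv.measurable _)

lemma simU_meas (m : ℕ) (E : ℝ) : MeasurableSet (simU m E) := by
  unfold simU
  apply MeasurableSet.inter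
  · have : {x : Fin m → ℝ | ∀ i, 0 < x i} = ⋂ i, {x | 0 < x i} := by ext; simp
    show MeasurableSet {x : Fin m → ℝ | ∀ i, 0 < x i}
    rw [this]
    exact MeasurableSet.iInter fun i => measurableSet_lt measurable_const (measurable_pi_apply i)
  · show MeasurableSet {x : Fin m → ℝ | ∑ i, x i < E}
    exact measurableSet_lt (by fun_prop) measurable_const

lemma piPre_eq (m : ℕ) (E : ℝ) (i : Fin m) (ε : ℝ) :
    piPre m E {x : Delta m E | x.1 i < ε} =
      ∫⁻ x in simU m E ∩ {x | x i < ε}, ENNReal.ofReal ((E - ∑ i, x i) ^ (-(1/2) : ℝ)) := by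
  have hs : MeasurableSet {x : Delta m E | x.1 i < ε} :=
    measurableSet_lt ((measurable_pi_apply i).comp measurable_subtype_coe) measurable_const
  rw [piPre, withDensity_apply _ hs]
  unfold tank lebU
  rw [setLIntegral_subtype (simU_meas m E) _
    (fun x : Fin m → ℝ => ENNReal.ofReal ((E - ∑ i, x i) ^ (-(1/2) : ℝ)))]
  congr 2
  ext x
  simp only [mem_image, mem_ofPred_eq, mem_inter_iff]
  constructor
  · rintro ⟨y, hy, rfl⟩
    exact ⟨y.2, hy⟩
  · rintro ⟨h1, h2⟩
    exact ⟨⟨x, h1⟩, h2, rfl⟩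

lemma box_vol {n : ℕ} (i : Fin (n+1)) (ε b : ℝ) (hb : 0 ≤ b) :
    volume (Set.pi univ (fun k : Fin (n+1) => if k = i then Ioo 0 ε else Ioo 0 b))
      = ENNReal.ofReal (b ^ n * ε) := by
  rw [volume_pi, Measure.pi_pi, Fin.prod_univ_succAbove _ i]
  simp only [if_true, Fin.succAbove_ne, if_false, Real.volume_Ioo, sub_zero, Finset.prod_const,
    Finset.card_univ, Fintype.card_fin]
  rw [ENNReal.ofReal_mul (by positivity), ENNReal.ofReal_pow hb, mul_comm]

lemma upper (m : ℕ) (E : ℝ) (hE : 0 < E) (i : Fin m) :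
    ∃ K > (0:ℝ), ∀ ε : ℝ, 0 < ε → ε ≤ E →
      ∫⁻ x in simU m E ∩ {x | x i < ε}, ENNReal.ofReal ((E - ∑ i, x i) ^ (-(1/2) : ℝ))
        ≤ ENNReal.ofReal (K * ε) := by
  have hmeas : ∀ ε, MeasurableSet (simU m E ∩ {x | x i < ε}) := fun ε =>
    (simU_meas m E).inter (measurableSet_lt (measurable_pi_apply i) measurable_const)
  have hsq : 0 < Real.sqrt E := Real.sqrt_pos.2 hE
  match m, i, hmeas with
  | 1, i, hmeas =>
    refine ⟨2 / Real.sqrt E, by positivity, fun ε h0 h1 => ?_⟩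
    rw [← lintegral_indicator (hmeas ε), aux_fub i _ (Measurable.indicator (by fun_prop) (hmeas ε))]
    have key : ∀ z : Fin 0 → ℝ, ∫⁻ t : ℝ, (simU 1 E ∩ {x | x i < ε}).indicator
        (fun x => ENNReal.ofReal ((E - ∑ i, x i) ^ (-(1/2) : ℝ))) (i.insertNth t z)
        ≤ ENNReal.ofReal (2 / Real.sqrt E * ε) := by
      intro z
      calc _ ≤ ∫⁻ t : ℝ, (Ioo (0:ℝ) ε).indicator
              (fun t => ENNReal.ofReal ((E - t) ^ (-(1/2) : ℝ))) t := by
            refine lintegral_mono fun t => ?_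
            by_cases hm : i.insertNth (α := fun _ => ℝ) t z ∈ simU 1 E ∩ {x | x i < ε}
            · have ht : t ∈ Ioo 0 ε := by
                obtain ⟨⟨hp, hs⟩, hi⟩ := hm
                exact ⟨by simpa using hp i, by simpa using hi⟩
              rw [indicator_of_mem hm, indicator_of_mem ht, Fin.sum_univ_succAbove _ i]
              simp
            · rw [indicator_of_notMem hm]; exact zero_le
        _ ≤ _ := by
          rw [lintegral_indicator measurableSet_Ioo, aux_one E ε h0.le h1]
          apply ENNReal.ofReal_le_ofReal
          have e1 := Real.sq_sqrt hE.le
          have e2 := Real.sq_sqrt (sub_nonneg.2 h1)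
          have e3 := Real.sqrt_nonneg (E - ε)
          have e4 : Real.sqrt (E - ε) ≤ Real.sqrt E := Real.sqrt_le_sqrt (by linarith)
          rw [div_mul_eq_mul_div, le_div_iff₀ hsq]
          nlinarith
    refine (lintegral_mono key).trans ?_
    rw [lintegral_const, volume_pi, ← pi_univ (univ : Set (Fin 0)), Measure.pi_pi]
    simp
  | n+2, i, hmeas =>
    obtain ⟨j, hj⟩ := exists_ne i
    obtain ⟨i', rfl⟩ := Fin.exists_succAbove_eq hj.symm
    refine ⟨2 * Real.sqrt E * E ^ n, by positivity, fun ε h0 h1 => ?_⟩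
    rw [← lintegral_indicator (hmeas ε), aux_fub j _ (Measurable.indicator (by fun_prop) (hmeas ε))]
    set B : Set (Fin (n+1) → ℝ) :=
      Set.pi univ (fun k : Fin (n+1) => if k = i' then Ioo 0 ε else Ioo 0 E) with hB
    have hBm : MeasurableSet B := by
      refine MeasurableSet.univ_pi fun k => ?_
      split_ifs <;> exact measurableSet_Ioo
    calc _ ≤ ∫⁻ z, B.indicator (fun _ => ENNReal.ofReal (2 * Real.sqrt E)) z := by
          refine lintegral_mono fun z => ?_
          have hiff : ∀ t, j.insertNth (α := fun _ => ℝ) t z ∈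
              simU (n+2) E ∩ {x | x (j.succAbove i') < ε} →
              z ∈ B ∧ t ∈ Ioo 0 (E - ∑ k, z k) := by
            rintro t ⟨⟨hp, hs⟩, hi⟩
            have ht : 0 < t := by simpa using hp j
            have hz : ∀ k, 0 < z k := fun k => by simpa using hp (j.succAbove k)
            rw [Fin.sum_univ_succAbove _ j] at hs
            simp only [Fin.insertNth_apply_same, Fin.insertNth_apply_succAbove] at hs
            simp only [mem_ofPred_eq, Fin.insertNth_apply_succAbove] at hi
            refine ⟨?_, ht, by linarith⟩
            intro k _
            have hk : z k ≤ ∑ k, z k :=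
              Finset.single_le_sum (fun l _ => (hz l).le) (Finset.mem_univ k)
            by_cases hki : k = i'
            · subst hki; simp [hz, hi]
            · simp only [hki, if_false]; exact ⟨hz k, by linarith⟩
          by_cases hz : z ∈ B
          · rw [indicator_of_mem hz]
            calc _ ≤ ∫⁻ t : ℝ, Set.indicator (Ioo (0:ℝ) (E - ∑ k, z k))
                    (fun t => ENNReal.ofReal ((E - ∑ k, z k - t) ^ (-(1/2) : ℝ))) t := by
                  refine lintegral_mono fun t => ?_
                  by_cases hm : j.insertNth (α := fun _ => ℝ) t z ∈
                    simU (n+2) E ∩ {x | x (j.succAbove i') < ε}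
                  · rw [indicator_of_mem hm, indicator_of_mem (hiff t hm).2,
                      Fin.sum_univ_succAbove _ j]
                    simp only [Fin.insertNth_apply_same, Fin.insertNth_apply_succAbove]
                    rw [sub_sub, add_comm]
                  · rw [indicator_of_notMem hm]; exact zero_le
              _ ≤ _ := by
                rw [lintegral_indicator measurableSet_Ioo]
                have hzs : 0 ≤ ∑ k, z k := Finset.sum_nonneg fun k _ => by
                  have := hz k (mem_univ k)
                  by_cases hki : k = i'
                  · simp only [hki, if_true] at this ⊢; exact this.1.le
                  · simp only [hki, if_false] at this; exact this.1.le
                rcases le_total (E - ∑ k, z k) 0 with h | h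
                · rw [Ioo_eq_empty (by simpa using h)]; simp
                · rw [aux_one _ _ h le_rfl]
                  apply ENNReal.ofReal_le_ofReal
                  have : Real.sqrt (E - ∑ k, z k) ≤ Real.sqrt E :=
                    Real.sqrt_le_sqrt (by linarith)
                  simp only [sub_self, Real.sqrt_zero]
                  linarith
          · rw [indicator_of_notMem hz]
            have : ∀ t, (simU (n+2) E ∩ {x | x (j.succAbove i') < ε}).indicator
              (fun x => ENNReal.ofReal ((E - ∑ i, x i) ^ (-(1/2) : ℝ)))
                (j.insertNth (α := fun _ => ℝ) t z) = 0 := fun t =>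
              indicator_of_notMem (fun hm => hz (hiff t hm).1) _
            simp only [this, lintegral_zero, le_refl]
      _ = _ := by
        rw [lintegral_indicator hBm, setLIntegral_const, hB, box_vol i' ε E hE.le,
          ← ENNReal.ofReal_mul (by positivity), mul_assoc (2 * Real.sqrt E)]

lemma lower (m : ℕ) (E : ℝ) (hE : 0 < E) (i : Fin m) :
    ∃ K > (0:ℝ), ∃ ε₁ > (0:ℝ), ε₁ ≤ E ∧ ∀ ε : ℝ, 0 < ε → ε < ε₁ →
      ENNReal.ofReal (K * ε) ≤
      ∫⁻ x in simU m E ∩ {x | x i < ε}, ENNReal.ofReal ((E - ∑ i, x i) ^ (-(1/2) : ℝ)) := by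
  match m, i with
  | n+1, i =>
    have hn : (0:ℝ) < n + 1 := by positivity
    set b : ℝ := E / (n+1) with hb
    have hb0 : 0 < b := by positivity
    have hbE : (n+1) * b = E := by rw [hb]; field_simp
    refine ⟨E ^ (-(1/2) : ℝ) * b ^ n, by positivity, b, hb0, ?_, fun ε h0 h1 => ?_⟩
    · rw [hb]; exact div_le_self hE.le (by linarith [(Nat.cast_nonneg n : (0:ℝ) ≤ n)])
    set B : Set (Fin (n+1) → ℝ) :=
      Set.pi univ (fun k : Fin (n+1) => if k = i then Ioo 0 ε else Ioo 0 b) with hB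
    have hBm : MeasurableSet B := by
      refine MeasurableSet.univ_pi fun k => ?_
      split_ifs <;> exact measurableSet_Ioo
    have hBs : ∀ x ∈ B, (∀ k, 0 < x k) ∧ (∀ k, x k < b) ∧ x i < ε := by
      intro x hx
      have hi : x i ∈ Ioo 0 ε := by simpa using hx i (mem_univ i)
      have hk : ∀ k, 0 < x k ∧ x k < b := fun k => by
        by_cases hki : k = i
        · subst hki; exact ⟨hi.1, hi.2.trans h1⟩
        · have := hx k (mem_univ k)
          simp only [hki, if_false] at this
          exact this
      exact ⟨fun k => (hk k).1, fun k => (hk k).2, hi.2⟩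
    have hsum : ∀ x ∈ B, ∑ k, x k < E := by
      intro x hx
      calc ∑ k, x k < ∑ k : Fin (n+1), b :=
            Finset.sum_lt_sum_of_nonempty Finset.univ_nonempty fun k _ => (hBs x hx).2.1 k
        _ = E := by simp [hbE]
    calc _ = ∫⁻ x in B, ENNReal.ofReal (E ^ (-(1/2) : ℝ)) := by
          rw [setLIntegral_const, hB, box_vol i ε b hb0.le,
            ← ENNReal.ofReal_mul (by positivity), mul_assoc]
      _ ≤ ∫⁻ x in B, ENNReal.ofReal ((E - ∑ i, x i) ^ (-(1/2) : ℝ)) := by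
          refine setLIntegral_mono' hBm fun x hx => ENNReal.ofReal_le_ofReal ?_
          refine Real.rpow_le_rpow_of_nonpos (by linarith [hsum x hx]) ?_ (by norm_num)
          have : 0 ≤ ∑ k, x k := Finset.sum_nonneg fun k _ => ((hBs x hx).1 k).le
          linarith
      _ ≤ _ := lintegral_mono_set (t := simU (n+1) E ∩ {x | x i < ε}) fun x hx => ⟨⟨(hBs x hx).1, hsum x hx⟩, (hBs x hx).2.2⟩

/-- For each `i`, the `π`-measure of the set of states where particle
`i` has energy below `ε` is comparable to `ε`: there are `c, C > 0` and `ε₁ > 0` with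
`c ε ≤ π({x ∈ Δ : x^i < ε}) ≤ C ε` for all `0 < ε < ε₁`. -/
theorem pi_measure_low_energy (m : ℕ) (hm : 1 ≤ m) (E : ℝ) (hE : 0 < E) (i : Fin m) :
    ∃ c > (0:ℝ), ∃ C > (0:ℝ), ∃ ε₁ > (0:ℝ), ∀ ε : ℝ, 0 < ε → ε < ε₁ →
      ENNReal.ofReal (c * ε) ≤ piMeasure m E {x : Delta m E | x.1 i < ε} ∧
      piMeasure m E {x : Delta m E | x.1 i < ε} ≤ ENNReal.ofReal (C * ε) := by
  obtain ⟨K, hK, hup⟩ := upper m E hE i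
  obtain ⟨L, hL, ε₁, hε₁, hε₁E, hlo⟩ := lower m E hE i
  have huniv : piPre m E Set.univ = piPre m E {x : Delta m E | x.1 i < E} := by
    congr 1
    ext x
    simp only [mem_univ, mem_ofPred_eq, true_iff]
    exact (Finset.single_le_sum (fun l _ => (x.2.1 l).le) (Finset.mem_univ i)).trans_lt x.2.2
  have hfin : piPre m E Set.univ ≠ ⊤ := by
    rw [huniv, piPre_eq]
    exact ne_top_of_le_ne_top ENNReal.ofReal_ne_top (hup E hE le_rfl)
  have hpos : piPre m E Set.univ ≠ 0 := by
    have h := hlo (ε₁ / 2) (by positivity) (by linarith)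
    rw [← piPre_eq] at h
    have h2 := h.trans (measure_mono (subset_univ _))
    have h3 : 0 < ENNReal.ofReal (L * (ε₁ / 2)) := ENNReal.ofReal_pos.2 (by positivity)
    exact (h3.trans_le h2).ne'
  obtain ⟨Z, hZ0, hZ⟩ : ∃ Z : ℝ, 0 < Z ∧ piPre m E Set.univ = ENNReal.ofReal Z :=
    ⟨(piPre m E Set.univ).toReal, ENNReal.toReal_pos hpos hfin, (ENNReal.ofReal_toReal hfin).symm⟩
  refine ⟨Z⁻¹ * L, by positivity, Z⁻¹ * K, by positivity, ε₁, hε₁, fun ε h0 h1 => ?_⟩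
  have hpi : piMeasure m E {x : Delta m E | x.1 i < ε}
      = ENNReal.ofReal Z⁻¹ * piPre m E {x : Delta m E | x.1 i < ε} := by
    rw [piMeasure, Measure.smul_apply, smul_eq_mul, hZ, ENNReal.ofReal_inv_of_pos hZ0]
  rw [hpi, piPre_eq, mul_assoc, mul_assoc, ENNReal.ofReal_mul (q := L * ε) (by positivity),
    ENNReal.ofReal_mul (q := K * ε) (by positivity)]
  exact ⟨mul_le_mul_right (hlo ε h0 h1) _, mul_le_mul_right (hup ε h0 (by linarith)) _⟩
end
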